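/- For every nonnegative integer n, write the polynomial (q;q^3)_n (q^2;q^3)_n = \prod_{j=0}^{n-1} (1 - q^{3j+1})(1 - q^{3j+2}) in its 3-dissection (q;q^3)_n (q^2;q^3)_n = A_n(q^3) - q B_n(q^3) - q^2 C_n(q^3), where A_n, B_n, C_n are the uniquely determined polynomials with integer coefficients collecting the coefficients of the powers of q congruent to 0, 1, 2 modulo 3 respectively. Then A_n(q), B_n(q) and C_n(q) are polynomials in q with nonnegative integer coefficients. -/

import Mathlib

open Polynomial

/-- The polynomial `(q;q³)_n (q²;q³)_n = ∏_{j=0}^{n-1} (1 - q^{3j+1})(1 - q^{3j+2})`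
over the integers. -/
noncomputable def borweinPoly (n : ℕ) : Polynomial ℤ :=
  ∏ j ∈ Finset.range n, ((1 - X ^ (3 * j + 1)) * (1 - X ^ (3 * j + 2)))

/-- `c` has the sign which the Borwein conjecture prescribes for a coefficient of index `m`. -/
def HasBorweinSign (m : ℕ) (c : ℤ) : Prop :=
  (m % 3 = 0 → 0 ≤ c) ∧ (m % 3 ≠ 0 → c ≤ 0)

theorem natDegree_one_sub_X_pow (k : ℕ) :
    (1 - X ^ k : ℤ[X]).natDegree = k := by
  rw [← neg_sub, natDegree_neg]
  simpa using natDegree_X_pow_sub_C (n := k) (r := (1 : ℤ))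

theorem reverse_one_sub_X_pow {k : ℕ} (hk : 0 < k) :
    (1 - X ^ k : ℤ[X]).reverse = -(1 - X ^ k) := by
  ext m
  rw [coeff_reverse, natDegree_one_sub_X_pow]
  simp only [coeff_sub, coeff_neg, coeff_one, coeff_X_pow]
  rcases le_or_gt m k with h | h
  · rw [revAt_le h]
    have h1 : (k - m = 0) ↔ m = k := by omega
    have h2 : (k - m = k) ↔ m = 0 := by omega
    simp only [h1, h2]
    ring
  · rw [revAt_eq_self_of_lt h]
    have h1 : m ≠ 0 := by omega
    have h2 : m ≠ k := by omega
    simp [h1, h2]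

theorem one_sub_X_pow_ne_zero (k : ℕ) (hk : 0 < k) : (1 - X ^ k : ℤ[X]) ≠ 0 := by
  intro h
  have := natDegree_one_sub_X_pow k
  rw [h] at this
  simp at this
  omega

theorem borweinPoly_succ (n : ℕ) : borweinPoly (n + 1) =
    borweinPoly n * ((1 - X ^ (3 * n + 1)) * (1 - X ^ (3 * n + 2))) := by
  rw [borweinPoly, Finset.prod_range_succ, ← borweinPoly]

theorem borweinPoly_ne_zero (n : ℕ) : borweinPoly n ≠ 0 := by
  rw [borweinPoly, Finset.prod_ne_zero_iff]
  intro j _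
  exact mul_ne_zero (one_sub_X_pow_ne_zero _ (by omega)) (one_sub_X_pow_ne_zero _ (by omega))

theorem natDegree_borweinPoly (n : ℕ) : (borweinPoly n).natDegree = 3 * n ^ 2 := by
  induction n with
  | zero => simp [borweinPoly]
  | succ n ih =>
    rw [borweinPoly_succ, natDegree_mul (borweinPoly_ne_zero n)
      (mul_ne_zero (one_sub_X_pow_ne_zero _ (by omega)) (one_sub_X_pow_ne_zero _ (by omega))),
      natDegree_mul (one_sub_X_pow_ne_zero _ (by omega)) (one_sub_X_pow_ne_zero _ (by omega)),
      natDegree_one_sub_X_pow, natDegree_one_sub_X_pow, ih]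
    ring

theorem reverse_borweinPoly (n : ℕ) : (borweinPoly n).reverse = borweinPoly n := by
  induction n with
  | zero => simpa [borweinPoly] using reverse_C (1 : ℤ)
  | succ n ih =>
    rw [borweinPoly_succ, reverse_mul_of_domain, reverse_mul_of_domain, ih,
      reverse_one_sub_X_pow (by omega), reverse_one_sub_X_pow (by omega)]
    ring

theorem coeff_borweinPoly_symm (n m : ℕ) (hm : m ≤ 3 * n ^ 2) :
    (borweinPoly n).coeff m = (borweinPoly n).coeff (3 * n ^ 2 - m) := by
  conv_lhs => rw [← reverse_borweinPoly, coeff_reverse, natDegree_borweinPoly, revAt_le hm]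

theorem hasBorweinSign_of_le_half (n : ℕ)
    (h : ∀ m, 2 * m ≤ 3 * n ^ 2 → HasBorweinSign m ((borweinPoly n).coeff m)) (m : ℕ) :
    HasBorweinSign m ((borweinPoly n).coeff m) := by
  rcases le_or_gt (2 * m) (3 * n ^ 2) with hm | hm
  · exact h m hm
  rcases le_or_gt m (3 * n ^ 2) with hm' | hm'
  · have := h (3 * n ^ 2 - m) (by omega)
    rw [← coeff_borweinPoly_symm n m hm'] at this
    exact ⟨fun h0 => this.1 (by omega), fun h0 => this.2 (by omega)⟩
  · rw [coeff_eq_zero_of_natDegree_lt (by rw [natDegree_borweinPoly]; exact hm')]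
    exact ⟨fun _ => le_rfl, fun _ => le_rfl⟩

theorem dissection_nonneg (P A B C : ℤ[X])
    (hdissect : P = A.comp (X ^ 3) - X * B.comp (X ^ 3) - X ^ 2 * C.comp (X ^ 3))
    (h : ∀ m, HasBorweinSign m (P.coeff m)) :
    (∀ k, 0 ≤ A.coeff k) ∧ (∀ k, 0 ≤ B.coeff k) ∧ (∀ k, 0 ≤ C.coeff k) := by
  simp only [← expand_eq_comp_X_pow] at hdissect
  have key : ∀ (Q : ℤ[X]) (k : ℕ), (expand ℤ 3 Q).coeff k = if 3 ∣ k then Q.coeff (k / 3) else 0 :=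
    fun Q k => coeff_expand (by norm_num) Q k
  refine ⟨fun k => ?_, fun k => ?_, fun k => ?_⟩
  · have h0 := (h (3 * k)).1 (by omega)
    have e1 : (X * expand ℤ 3 B).coeff (3 * k) = 0 := by
      rcases k with _ | k
      · simp
      · rw [show 3 * (k + 1) = (3 * k + 2) + 1 by ring, coeff_X_mul, key, if_neg (by omega)]
    have e2 : (X ^ 2 * expand ℤ 3 C).coeff (3 * k) = 0 := by
      rcases k with _ | k
      · simp
      · rw [show 3 * (k + 1) = (3 * k + 1) + 2 by ring, coeff_X_pow_mul, key, if_neg (by omega)]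
    rw [hdissect, coeff_sub, coeff_sub, e1, e2, key, if_pos (by omega)] at h0
    simpa using h0
  · have h0 := (h (3 * k + 1)).2 (by omega)
    have e2 : (X ^ 2 * expand ℤ 3 C).coeff (3 * k + 1) = 0 := by
      rcases k with _ | k
      · rw [coeff_X_pow_mul']; simp
      · rw [show 3 * (k + 1) + 1 = (3 * k + 2) + 2 by ring, coeff_X_pow_mul, key,
          if_neg (by omega)]
    rw [hdissect, coeff_sub, coeff_sub, e2, coeff_X_mul, key, key, if_neg (by omega),
      if_pos (by omega), Nat.mul_div_cancel_left _ (by norm_num)] at h0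
    simpa using h0
  · have h0 := (h (3 * k + 2)).2 (by omega)
    rw [hdissect, coeff_sub, coeff_sub, coeff_X_pow_mul, show 3 * k + 2 = (3 * k + 1) + 1 by ring,
      coeff_X_mul, key, key, key, if_neg (by omega), if_neg (by omega),
      if_pos (by omega), Nat.mul_div_cancel_left _ (by norm_num)] at h0
    simpa using h0

/-- The number whose base `2 ^ K` digits of index `i < L` are the values `d i`. -/
def pack (K L : ℕ) (d : ℕ → ℕ) : ℕ := ∑ i ∈ Finset.range L, d i * 2 ^ (K * i)

theorem pack_succ (K L : ℕ) (d : ℕ → ℕ) :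
    pack K (L + 1) d = pack K L d + d L * 2 ^ (K * L) := by
  rw [pack, Finset.sum_range_succ, ← pack]

theorem pack_lt {K L : ℕ} {d : ℕ → ℕ} (hd : ∀ i < L, d i < 2 ^ K) :
    pack K L d < 2 ^ (K * L) := by
  induction L with
  | zero => simp [pack]
  | succ L ih =>
    have h1 := ih fun i hi => hd i (by omega)
    have h2 : (d L + 1) * 2 ^ (K * L) ≤ 2 ^ K * 2 ^ (K * L) :=
      Nat.mul_le_mul_right _ (hd L (by omega))
    rw [pack_succ, Nat.mul_succ, pow_add]
    linarith

theorem land_add_mul_two_pow {k a b c d : ℕ} (ha : a < 2 ^ k) (hc : c < 2 ^ k) :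
    (a + b * 2 ^ k) &&& (c + d * 2 ^ k) = (a &&& c) + (b &&& d) * 2 ^ k := by
  apply Nat.eq_of_testBit_eq
  intro i
  rw [Nat.testBit_and, add_comm a, add_comm c, add_comm (a &&& c), mul_comm b, mul_comm d,
    mul_comm (b &&& d), Nat.testBit_two_pow_mul_add _ ha, Nat.testBit_two_pow_mul_add _ hc,
    Nat.testBit_two_pow_mul_add _ (lt_of_le_of_lt Nat.and_le_left ha)]
  split_ifs <;> simp [Nat.testBit_and]

theorem pack_land {K L : ℕ} {d e : ℕ → ℕ} (hd : ∀ i < L, d i < 2 ^ K) (he : ∀ i < L, e i < 2 ^ K) :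
    pack K L d &&& pack K L e = pack K L fun i => d i &&& e i := by
  induction L with
  | zero => simp [pack]
  | succ L ih =>
    have hd' : ∀ i < L, d i < 2 ^ K := fun i hi => hd i (by omega)
    have he' : ∀ i < L, e i < 2 ^ K := fun i hi => he i (by omega)
    rw [pack_succ, pack_succ, pack_succ, land_add_mul_two_pow (pack_lt hd') (pack_lt he'),
      ih hd' he']

theorem pack_injective {K L : ℕ} {d e : ℕ → ℕ} (hd : ∀ i < L, d i < 2 ^ K)
    (he : ∀ i < L, e i < 2 ^ K) (h : pack K L d = pack K L e) : ∀ i < L, d i = e i := by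
  induction L with
  | zero => intro i hi; omega
  | succ L ih =>
    have hd' : ∀ i < L, d i < 2 ^ K := fun i hi => hd i (by omega)
    have he' : ∀ i < L, e i < 2 ^ K := fun i hi => he i (by omega)
    rw [pack_succ, pack_succ] at h
    have h1 : pack K L d = pack K L e := by
      have := congrArg (· % 2 ^ (K * L)) h
      simpa [Nat.mod_eq_of_lt (pack_lt hd'), Nat.mod_eq_of_lt (pack_lt he')] using this
    have h2 : d L = e L := by
      rw [h1] at h
      exact Nat.eq_of_mul_eq_mul_right (by positivity) (Nat.add_left_cancel h)
    intro i hi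
    rcases Nat.lt_succ_iff_lt_or_eq.mp hi with hi | rfl
    · exact ih hd' he' h1 i hi
    · exact h2

/-- The digits of period three. -/
def cyc (d₀ d₁ d₂ : ℕ) (i : ℕ) : ℕ := if i % 3 = 0 then d₀ else if i % 3 = 1 then d₁ else d₂

/-- The number with `3 * r` digits in base `2 ^ K`, repeating `d₀, d₁, d₂`. -/
def packCyc (K r d₀ d₁ d₂ : ℕ) : ℕ :=
  (d₀ + d₁ * 2 ^ K + d₂ * 2 ^ (2 * K)) * ((2 ^ (3 * K * r) - 1) / (2 ^ (3 * K) - 1))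

theorem packCyc_eq {K : ℕ} (hK : 0 < K) (r d₀ d₁ d₂ : ℕ) :
    packCyc K r d₀ d₁ d₂ = pack K (3 * r) (cyc d₀ d₁ d₂) := by
  have h2 : 2 ≤ 2 ^ (3 * K) := by
    calc 2 = 2 ^ 1 := rfl
      _ ≤ 2 ^ (3 * K) := Nat.pow_le_pow_right (by norm_num) (by omega)
  have hg : (2 ^ (3 * K * r) - 1) / (2 ^ (3 * K) - 1) = ∑ i ∈ Finset.range r, (2 ^ (3 * K)) ^ i := by
    rw [Nat.geomSum_eq h2, ← pow_mul]
  rw [packCyc, hg]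
  induction r with
  | zero => simp [pack]
  | succ r ih =>
    have hg' : (2 ^ (3 * K * r) - 1) / (2 ^ (3 * K) - 1)
        = ∑ i ∈ Finset.range r, (2 ^ (3 * K)) ^ i := by
      rw [Nat.geomSum_eq h2, ← pow_mul]
    rw [show 3 * (r + 1) = 3 * r + 1 + 1 + 1 by ring, pack_succ, pack_succ, pack_succ, ← ih hg',
      Finset.sum_range_succ]
    have e0 : cyc d₀ d₁ d₂ (3 * r) = d₀ := by simp [cyc]
    have e1 : cyc d₀ d₁ d₂ (3 * r + 1) = d₁ := by simp [cyc, Nat.add_mod]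
    have e2 : cyc d₀ d₁ d₂ (3 * r + 1 + 1) = d₂ := by simp [cyc, Nat.add_mod, add_assoc]
    rw [e0, e1, e2]
    ring

theorem cyc_lt {b d₀ d₁ d₂ : ℕ} (h₀ : d₀ < b) (h₁ : d₁ < b) (h₂ : d₂ < b) (i : ℕ) :
    cyc d₀ d₁ d₂ i < b := by
  unfold cyc
  split_ifs <;> assumption

/-- `Z` is congruent modulo `2 ^ (K * L)` to the number with signed digits `q i`, `i < L`. -/
def Represents (K L Z : ℕ) (q : ℕ → ℤ) : Prop :=
  (Z : ℤ) ≡ ∑ i ∈ Finset.range L, q i * 2 ^ (K * i) [ZMOD 2 ^ (K * L)]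

theorem Represents.land_add_pack {K L Z : ℕ} {q : ℕ → ℤ} (h : Represents K L Z q) (b : ℕ → ℕ)
    (hq : ∀ i < L, 0 ≤ q i + b i ∧ q i + b i < 2 ^ K) :
    (Z + pack K L b) &&& (2 ^ (K * L) - 1) = pack K L fun i => (q i + b i).toNat := by
  have hlt : pack K L (fun i => (q i + b i).toNat) < 2 ^ (K * L) := by
    apply pack_lt
    intro i hi
    have := hq i hi
    zify
    rw [Int.toNat_of_nonneg this.1]
    exact this.2
  have hc : ((pack K L fun i => (q i + b i).toNat : ℕ) : ℤ) =
      ∑ i ∈ Finset.range L, q i * 2 ^ (K * i) + (pack K L b : ℕ) := by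
    rw [pack, pack]
    push_cast
    rw [← Finset.sum_add_distrib]
    apply Finset.sum_congr rfl
    intro i hi
    rw [Int.toNat_of_nonneg (hq i (Finset.mem_range.mp hi)).1]
    ring
  rw [Nat.and_two_pow_sub_one_eq_mod, ← Nat.mod_eq_of_lt hlt]
  zify
  rw [hc]
  exact (h.add_right _)

theorem land_seven_mul {k d c : ℕ} (hd : d < 8 * 2 ^ k) (h : d &&& 7 * 2 ^ k = c * 2 ^ k) :
    c * 2 ^ k ≤ d ∧ d < (c + 1) * 2 ^ k := by
  have h1 : (d &&& 7 * 2 ^ k) / 2 ^ k = d / 2 ^ k := by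
    rw [← Nat.shiftRight_eq_div_pow, Nat.shiftRight_and_distrib, Nat.shiftRight_eq_div_pow,
      Nat.shiftRight_eq_div_pow, Nat.mul_div_cancel _ (by positivity),
      show 7 = 2 ^ 3 - 1 by norm_num, Nat.and_two_pow_sub_one_eq_mod, Nat.mod_eq_of_lt]
    exact Nat.div_lt_of_lt_mul (by linarith)
  rw [h, Nat.mul_div_cancel _ (by positivity)] at h1
  have h2 := Nat.div_add_mod d (2 ^ k)
  have h3 := Nat.mod_lt d (show 2 ^ k > 0 by positivity)
  rw [← h1, mul_comm] at h2
  rw [add_mul]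
  omega

theorem Represents.digit_bounds {k L Z : ℕ} {q : ℕ → ℤ} {b c : ℕ → ℕ}
    (h : Represents (k + 3) L Z q)
    (hq : ∀ i < L, 0 ≤ q i + b i ∧ q i + b i < 2 ^ (k + 3)) (hc : ∀ i < L, c i < 8)
    (hland : (Z + pack (k + 3) L b) &&& pack (k + 3) L (fun _ => 7 * 2 ^ k) =
      pack (k + 3) L (fun i => c i * 2 ^ k)) :
    ∀ i < L, (c i * 2 ^ k : ℤ) ≤ q i + b i ∧ q i + b i < (c i + 1) * 2 ^ k := by
  have h8 : 2 ^ (k + 3) = 8 * 2 ^ k := by ring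
  have hm : ∀ i < L, (fun _ : ℕ => 7 * 2 ^ k) i < 2 ^ (k + 3) := by
    intro i _
    have : 0 < 2 ^ k := by positivity
    simp only [h8]
    omega
  have hd : ∀ i < L, (fun i => (q i + b i).toNat) i < 2 ^ (k + 3) := by
    intro i hi
    have := hq i hi
    zify
    rw [Int.toNat_of_nonneg this.1]
    exact this.2
  have hfull : (2 ^ ((k + 3) * L) - 1) &&& pack (k + 3) L (fun _ => 7 * 2 ^ k) =
      pack (k + 3) L (fun _ => 7 * 2 ^ k) := by
    rw [Nat.land_comm, Nat.and_two_pow_sub_one_eq_mod, Nat.mod_eq_of_lt (pack_lt hm)]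
  rw [← hfull, ← Nat.land_assoc, h.land_add_pack b hq, pack_land hd hm] at hland
  have hcl : ∀ i < L, c i * 2 ^ k < 2 ^ (k + 3) := by
    intro i hi
    rw [h8]
    exact Nat.mul_lt_mul_of_pos_right (hc i hi) (by positivity)
  have := pack_injective (fun i hi => lt_of_le_of_lt Nat.and_le_left (hd i hi)) hcl hland
  intro i hi
  have h1 := land_seven_mul (by rw [← h8]; exact hd i hi) (this i hi)
  zify at h1
  rwa [Int.toNat_of_nonneg (hq i hi).1] at h1

theorem Represents.mono {K L l Z : ℕ} {q : ℕ → ℤ} (h : Represents K L Z q) (hl : l ≤ L) :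
    Represents K l Z q := by
  have h1 : (2 : ℤ) ^ (K * l) ∣ 2 ^ (K * L) := pow_dvd_pow _ (Nat.mul_le_mul_left _ hl)
  refine (h.of_dvd h1).trans ?_
  obtain ⟨c, rfl⟩ := Nat.exists_eq_add_of_le hl
  rw [Finset.sum_range_add]
  conv_rhs => rw [← add_zero (∑ i ∈ Finset.range l, _)]
  refine Int.ModEq.add_left _ (Int.modEq_zero_iff_dvd.mpr (Finset.dvd_sum fun i _ => ?_))
  exact (pow_dvd_pow _ (Nat.mul_le_mul_left _ (by omega))).mul_left _

theorem represents_coeff {K L Z : ℕ} {P : ℤ[X]}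
    (h : (Z : ℤ) ≡ P.eval (2 ^ K) [ZMOD 2 ^ (K * L)]) : Represents K L Z P.coeff := by
  have : Represents K (L + (P.natDegree + 1)) (P.eval (2 ^ K) % 2 ^ (K * (L + (P.natDegree + 1)))).toNat
      P.coeff := by
    rw [Represents, Int.toNat_of_nonneg (Int.emod_nonneg _ (by positivity))]
    refine (Int.mod_modEq _ _).trans ?_
    rw [eval_eq_sum_range' (n := L + (P.natDegree + 1)) (by omega)]
    simp only [← pow_mul]
    rfl
  have h2 := this.mono (l := L) (by omega)
  rw [Represents, Int.toNat_of_nonneg (Int.emod_nonneg _ (by positivity))] at h2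
  refine h.trans (Int.ModEq.trans (Int.ModEq.symm ?_) h2)
  exact (Int.mod_modEq _ _).of_dvd (pow_dvd_pow _ (Nat.mul_le_mul_left _ (by omega)))

/-- Multiplication by `(1 - X ^ (3 * n + 1)) * (1 - X ^ (3 * n + 2))` on packed coefficients. -/
def packStep (K L n Z : ℕ) : ℕ :=
  Nat.land (Nat.shiftLeft (Nat.shiftLeft Z (K * (3 * n + 1)) - Z) (K * (3 * n + 2)) -
    (Nat.shiftLeft Z (K * (3 * n + 1)) - Z)) (2 ^ (K * L) - 1)

theorem packStep_modEq {K L n Z : ℕ}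
    (h : (Z : ℤ) ≡ (borweinPoly n).eval (2 ^ K) [ZMOD 2 ^ (K * L)]) :
    (packStep K L n Z : ℤ) ≡ (borweinPoly (n + 1)).eval (2 ^ K) [ZMOD 2 ^ (K * L)] := by
  have hs : ∀ Y a : ℕ, ((Nat.shiftLeft Y a - Y : ℕ) : ℤ) = Y * (2 ^ a - 1) := by
    intro Y a
    have : Nat.shiftLeft Y a = Y * 2 ^ a := Nat.shiftLeft_eq Y a
    rw [this, Nat.cast_sub (Nat.le_mul_of_pos_right _ (by positivity))]
    push_cast
    ring
  have h1 : packStep K L n Z = (Nat.shiftLeft (Nat.shiftLeft Z (K * (3 * n + 1)) - Z)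
      (K * (3 * n + 2)) - (Nat.shiftLeft Z (K * (3 * n + 1)) - Z)) % (2 ^ (K * L)) :=
    Nat.and_two_pow_sub_one_eq_mod _ _
  rw [h1, Int.natCast_mod]
  push_cast
  refine (Int.mod_modEq _ _).trans ?_
  rw [hs, hs, borweinPoly_succ]
  simp only [eval_mul, eval_sub, eval_one, eval_pow, eval_X, ← pow_mul]
  have := h.mul_right ((2 ^ (K * (3 * n + 1)) - 1) * (2 ^ (K * (3 * n + 2)) - 1))
  rw [← mul_assoc] at this
  exact this.trans (congrArg (· % _) (by ring))

theorem coeff_mul_one_sub_X_pow (P : ℤ[X]) (a i : ℕ) :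
    (P * (1 - X ^ a)).coeff i = P.coeff i - if a ≤ i then P.coeff (i - a) else 0 := by
  rw [mul_sub, mul_one, coeff_sub, coeff_mul_X_pow']

theorem abs_coeff_mul_one_sub_X_pow_lt {P : ℤ[X]} {L : ℕ} {c : ℤ} (a : ℕ)
    (h : ∀ i < L, |P.coeff i| < c) : ∀ i < L, |(P * (1 - X ^ a)).coeff i| < 2 * c := by
  intro i hi
  have h1 := abs_lt.mp (h i hi)
  rw [coeff_mul_one_sub_X_pow, abs_lt]
  split_ifs
  · have h2 := abs_lt.mp (h (i - a) (by omega))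
    constructor <;> linarith
  · constructor <;> linarith

/-- The first `L` coefficients of `P` have the signs of the Borwein conjecture and are smaller
than `c` in absolute value. -/
def SmallBorweinSigns (L : ℕ) (c : ℤ) (P : ℤ[X]) : Prop :=
  ∀ i < L, HasBorweinSign i (P.coeff i) ∧ |P.coeff i| < c

/-- A test of the signs and the sizes of the packed digits. -/
def signTest (k r Z : ℕ) : Bool :=
  Nat.beq (Nat.land (Z + packCyc (k + 3) r (4 * 2 ^ k) (4 * 2 ^ k - 1) (4 * 2 ^ k - 1))
    (packCyc (k + 3) r (7 * 2 ^ k) (7 * 2 ^ k) (7 * 2 ^ k)))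
    (packCyc (k + 3) r (4 * 2 ^ k) (3 * 2 ^ k) (3 * 2 ^ k))

theorem smallBorweinSigns_of_signTest {k r Z : ℕ} {P : ℤ[X]}
    (h : (Z : ℤ) ≡ P.eval (2 ^ (k + 3)) [ZMOD 2 ^ ((k + 3) * (3 * r))])
    (hP : ∀ i < 3 * r, |P.coeff i| < 4 * 2 ^ k) (ht : signTest k r Z = true) :
    SmallBorweinSigns (3 * r) (2 ^ k) P := by
  have h0 : 0 < 2 ^ k := by positivity
  rw [signTest, Nat.beq_eq, packCyc_eq (by omega), packCyc_eq (by omega), packCyc_eq (by omega)] at ht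
  have e1 : cyc (7 * 2 ^ k) (7 * 2 ^ k) (7 * 2 ^ k) = fun _ => 7 * 2 ^ k := by
    funext i
    simp [cyc]
  have e2 : cyc (4 * 2 ^ k) (3 * 2 ^ k) (3 * 2 ^ k) = fun i => cyc 4 3 3 i * 2 ^ k := by
    funext i
    simp only [cyc]
    split_ifs <;> rfl
  rw [e1, e2] at ht
  have h8 : (2 : ℤ) ^ (k + 3) = 8 * 2 ^ k := by ring
  have := (represents_coeff h).digit_bounds (b := cyc (4 * 2 ^ k) (4 * 2 ^ k - 1) (4 * 2 ^ k - 1))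
    ?_ (fun i _ => cyc_lt (by norm_num) (by norm_num) (by norm_num) i) ht
  · intro i hi
    have h1 := this i hi
    simp only [HasBorweinSign, abs_lt]
    have h0' : (0 : ℤ) < 2 ^ k := by positivity
    have hb : ((4 * 2 ^ k - 1 : ℕ) : ℤ) = 4 * 2 ^ k - 1 := by
      rw [Nat.cast_sub (by omega)]
      push_cast
      ring
    unfold cyc at h1
    split_ifs at h1 with hi0
    · push_cast at h1
      refine ⟨⟨fun _ => by linarith, fun h => absurd hi0 h⟩, by linarith, by linarith⟩
    · rw [hb] at h1
      push_cast at h1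
      exact ⟨⟨fun h => absurd h hi0, fun _ => by linarith⟩, by linarith, by linarith⟩
    · rw [hb] at h1
      push_cast at h1
      exact ⟨⟨fun h => absurd h hi0, fun _ => by linarith⟩, by linarith, by linarith⟩
  · intro i hi
    have h1 := abs_lt.mp (hP i hi)
    have hb : (4 * 2 ^ k - 1 : ℤ) ≤ cyc (4 * 2 ^ k) (4 * 2 ^ k - 1) (4 * 2 ^ k - 1) i ∧
        (cyc (4 * 2 ^ k) (4 * 2 ^ k - 1) (4 * 2 ^ k - 1) i : ℤ) ≤ 4 * 2 ^ k := by
      unfold cyc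
      split_ifs <;> constructor <;> push_cast [Nat.cast_sub (show 1 ≤ 4 * 2 ^ k by omega)] <;>
        linarith
    rw [h8]
    constructor <;> linarith [hb.1, hb.2]

/-- Iterates `packStep`, applying `signTest` at each stage and the test `fin` at the end. -/
def signLoop (k r : ℕ) (fin : ℕ → Bool) : ℕ → ℕ → ℕ → Bool
  | 0, _, Z => fin Z
  | c + 1, n, Z => match signTest k r (packStep (k + 3) (3 * r) n Z) with
    | true => signLoop k r fin c (n + 1) (packStep (k + 3) (3 * r) n Z)
    | false => false

theorem signLoop_sound {k r : ℕ} {fin : ℕ → Bool} (c n Z : ℕ)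
    (h : (Z : ℤ) ≡ (borweinPoly n).eval (2 ^ (k + 3)) [ZMOD 2 ^ ((k + 3) * (3 * r))])
    (hP : SmallBorweinSigns (3 * r) (2 ^ k) (borweinPoly n))
    (hloop : signLoop k r fin c n Z = true) :
    (∀ j ≤ c, SmallBorweinSigns (3 * r) (2 ^ k) (borweinPoly (n + j))) ∧
    ∃ Z' : ℕ, fin Z' = true ∧
      (Z' : ℤ) ≡ (borweinPoly (n + c)).eval (2 ^ (k + 3)) [ZMOD 2 ^ ((k + 3) * (3 * r))] := by
  induction c generalizing n Z with
  | zero =>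
    refine ⟨fun j hj => ?_, Z, hloop, h⟩
    obtain rfl : j = 0 := by omega
    exact hP
  | succ c ih =>
    rw [signLoop] at hloop
    split at hloop
    case h_2 => exact absurd hloop (by simp)
    case h_1 ht =>
      have h' := packStep_modEq h
      have hP' := smallBorweinSigns_of_signTest h' (P := borweinPoly (n + 1)) (by
        rw [borweinPoly_succ, ← mul_assoc]
        have := abs_coeff_mul_one_sub_X_pow_lt (3 * n + 2)
          (abs_coeff_mul_one_sub_X_pow_lt (3 * n + 1) fun i hi => (hP i hi).2)
        intro i hi
        refine (this i hi).trans_eq (by ring)) ht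
      obtain ⟨h1, h2⟩ := ih (n + 1) _ h' hP' hloop
      refine ⟨fun j hj => ?_, ?_⟩
      · rcases j with _ | j
        · exact hP
        · rw [show n + (j + 1) = n + 1 + j by ring]
          exact h1 j (by omega)
      · rwa [show n + (c + 1) = n + 1 + c by ring]

theorem abs_prod_sub_le {E L : ℕ} {P : ℤ[X]}
    (hdom : ∀ i < L, 2 * ∑ j ∈ Finset.range (i + 1 - E), |P.coeff j| ≤ |P.coeff i|)
    (c : ℕ → Bool) (e : ℕ) : ∀ i < L,
    |(P * ∏ x ∈ Finset.range e, if c x then 1 - X ^ (E + x) else 1).coeff i - P.coeff i| ≤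
      2 * (∑ j ∈ Finset.range (i + 1 - E), |P.coeff j| -
        ∑ j ∈ Finset.range (i + 1 - (E + e)), |P.coeff j|) := by
  induction e with
  | zero => intro i _; simp
  | succ e ih =>
    intro i hi
    have hmono : ∀ i, 0 ≤ ∑ j ∈ Finset.range i, |P.coeff j| :=
      fun i => Finset.sum_nonneg fun _ _ => abs_nonneg _
    have hs : ∑ j ∈ Finset.range (i + 1 - (E + e)), |P.coeff j| =
        ∑ j ∈ Finset.range (i + 1 - (E + (e + 1))), |P.coeff j| +
          if E + e ≤ i then |P.coeff (i - (E + e))| else 0 := by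
      split_ifs with hle
      · rw [show i + 1 - (E + e) = (i + 1 - (E + (e + 1))) + 1 by omega, Finset.sum_range_succ,
          show i + 1 - (E + (e + 1)) = i - (E + e) by omega]
      · rw [show i + 1 - (E + e) = 0 by omega, show i + 1 - (E + (e + 1)) = 0 by omega]
        simp
    have h1 := ih i hi
    rw [Finset.prod_range_succ, ← mul_assoc]
    set G := P * ∏ x ∈ Finset.range e, if c x then 1 - X ^ (E + x) else 1
    rw [hs] at h1
    split_ifs with hc
    · rw [coeff_mul_one_sub_X_pow]
      split_ifs at h1 ⊢ with hle
      · have h2 := ih (i - (E + e)) (by omega)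
        have h3 := hdom (i - (E + e)) (by omega)
        have h4 := hmono (i - (E + e) + 1 - (E + e))
        have h5 : |G.coeff (i - (E + e))| ≤ 2 * |P.coeff (i - (E + e))| := by
          have := abs_sub_abs_le_abs_sub (G.coeff (i - (E + e))) (P.coeff (i - (E + e)))
          linarith
        have h6 := abs_sub (G.coeff i - P.coeff i) (G.coeff (i - (E + e)))
        rw [sub_right_comm]
        linarith
      · rw [sub_zero]
        linarith
    · rw [mul_one]
      have : 0 ≤ if E + e ≤ i then |P.coeff (i - (E + e))| else 0 := by
        split_ifs
        · exact abs_nonneg _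
        · exact le_rfl
      linarith

theorem borweinPoly_add (n c : ℕ) : borweinPoly (n + c) = borweinPoly n *
    ∏ x ∈ Finset.range (3 * c), if x % 3 ≠ 2 then 1 - X ^ (3 * n + 1 + x) else 1 := by
  induction c with
  | zero => simp
  | succ c ih =>
    rw [← add_assoc, borweinPoly_succ, ih, show 3 * (c + 1) = 3 * c + 1 + 1 + 1 by ring,
      Finset.prod_range_succ, Finset.prod_range_succ, Finset.prod_range_succ,
      if_pos (by omega), if_pos (by omega), if_neg (by omega)]
    ring

theorem hasBorweinSign_of_dominant {n L : ℕ}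
    (hsign : ∀ i < L, HasBorweinSign i ((borweinPoly n).coeff i))
    (hdom : ∀ i < L, 2 * ∑ j ∈ Finset.range (i + 1 - (3 * n + 1)), |(borweinPoly n).coeff j| ≤
      |(borweinPoly n).coeff i|) (c : ℕ) :
    ∀ i < L, HasBorweinSign i ((borweinPoly (n + c)).coeff i) := by
  intro i hi
  have h := abs_prod_sub_le hdom (fun x => decide (x % 3 ≠ 2)) (3 * c) i hi
  simp only [decide_eq_true_eq] at h
  rw [← borweinPoly_add] at h
  have h1 : 0 ≤ ∑ j ∈ Finset.range (i + 1 - (3 * n + 1 + 3 * c)), |(borweinPoly n).coeff j| :=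
    Finset.sum_nonneg fun _ _ => abs_nonneg _
  have h2 := hdom i hi
  have h3 := abs_le.mp (show |(borweinPoly (n + c)).coeff i - (borweinPoly n).coeff i| ≤
    |(borweinPoly n).coeff i| by linarith)
  constructor
  · intro h0
    have := (hsign i hi).1 h0
    rw [abs_of_nonneg this] at h3
    linarith
  · intro h0
    have := (hsign i hi).2 h0
    rw [abs_of_nonpos this] at h3
    linarith

/-- The packed absolute values of the coefficients, given the packed coefficients. -/
def packAbs (k r Z : ℕ) : ℕ :=
  2 * Nat.land (Nat.land (Z + packCyc (k + 3) r (4 * 2 ^ k) (4 * 2 ^ k - 1) (4 * 2 ^ k - 1))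
      (2 ^ ((k + 3) * (3 * r)) - 1)) (packCyc (k + 3) r (2 ^ (k + 3) - 1) 0 0) +
    packCyc (k + 3) r 0 (4 * 2 ^ k - 1) (4 * 2 ^ k - 1) -
    (Nat.land (Z + packCyc (k + 3) r (4 * 2 ^ k) (4 * 2 ^ k - 1) (4 * 2 ^ k - 1))
      (2 ^ ((k + 3) * (3 * r)) - 1) + packCyc (k + 3) r (4 * 2 ^ k) 0 0)

theorem packAbs_eq {k r Z : ℕ} {P : ℤ[X]}
    (h : (Z : ℤ) ≡ P.eval (2 ^ (k + 3)) [ZMOD 2 ^ ((k + 3) * (3 * r))])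
    (hP : SmallBorweinSigns (3 * r) (2 ^ k) P) :
    packAbs k r Z = pack (k + 3) (3 * r) fun i => (P.coeff i).natAbs := by
  have h0 : 0 < 2 ^ k := by positivity
  have h0' : (0 : ℤ) < 2 ^ k := by positivity
  have h8' : (2 : ℤ) ^ (k + 3) = 8 * 2 ^ k := by ring
  have h8 : 2 ^ (k + 3) = 8 * 2 ^ k := by ring
  have hb : ((4 * 2 ^ k - 1 : ℕ) : ℤ) = 4 * 2 ^ k - 1 := by
    rw [Nat.cast_sub (by omega)]
    push_cast
    ring
  have hq : ∀ i < 3 * r,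
      0 ≤ P.coeff i + cyc (4 * 2 ^ k) (4 * 2 ^ k - 1) (4 * 2 ^ k - 1) i ∧
      P.coeff i + cyc (4 * 2 ^ k) (4 * 2 ^ k - 1) (4 * 2 ^ k - 1) i < 2 ^ (k + 3) := by
    intro i hi
    have h1 := abs_lt.mp (hP i hi).2
    rw [h8']
    unfold cyc
    split_ifs <;> push_cast [hb] <;> constructor <;> linarith
  have hd : ∀ i < 3 * r,
      (P.coeff i + cyc (4 * 2 ^ k) (4 * 2 ^ k - 1) (4 * 2 ^ k - 1) i).toNat < 2 ^ (k + 3) := by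
    intro i hi
    have := hq i hi
    zify
    rw [Int.toNat_of_nonneg this.1]
    exact this.2
  have hW := (represents_coeff h).land_add_pack _ hq
  rw [packAbs, packCyc_eq (by omega), packCyc_eq (by omega), packCyc_eq (by omega),
    packCyc_eq (by omega)]
  change 2 * ((Z + _ &&& _) &&& _) + _ - ((Z + _ &&& _) + _) = _
  rw [hW, pack_land hd fun i _ => cyc_lt (by omega) (by omega) (by omega) i]
  apply Nat.sub_eq_of_eq_add
  simp only [pack, Finset.mul_sum, ← Finset.sum_add_distrib]
  apply Finset.sum_congr rfl
  intro i hi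
  rw [Finset.mem_range] at hi
  have hs := (hP i hi).1
  have h1 := hq i hi
  have h2 := hd i hi
  have key : 2 * ((P.coeff i + cyc (4 * 2 ^ k) (4 * 2 ^ k - 1) (4 * 2 ^ k - 1) i).toNat &&&
      cyc (2 ^ (k + 3) - 1) 0 0 i) + cyc 0 (4 * 2 ^ k - 1) (4 * 2 ^ k - 1) i =
      (P.coeff i).natAbs + ((P.coeff i + cyc (4 * 2 ^ k) (4 * 2 ^ k - 1) (4 * 2 ^ k - 1) i).toNat +
        cyc (4 * 2 ^ k) 0 0 i) := by
    by_cases hi0 : i % 3 = 0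
    · have := hs.1 hi0
      simp only [cyc, if_pos hi0] at h1 h2 ⊢
      rw [Nat.and_two_pow_sub_one_eq_mod, Nat.mod_eq_of_lt h2]
      omega
    · have h3 := hs.2 hi0
      have e : ∀ d₀ d₁, cyc d₀ d₁ d₁ i = d₁ := by intro d₀ d₁; simp [cyc, hi0]
      rw [e] at h1 h2 ⊢
      rw [e, e, e, Nat.and_zero]
      omega
  linear_combination 2 ^ ((k + 3) * i) * key

theorem pack_mod {K L l : ℕ} {d : ℕ → ℕ} (hl : l ≤ L) (hd : ∀ i < L, d i < 2 ^ K) :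
    pack K L d % 2 ^ (K * l) = pack K l d := by
  obtain ⟨c, rfl⟩ := Nat.exists_eq_add_of_le hl
  have h : pack K l d < 2 ^ (K * l) := pack_lt fun i hi => hd i (by omega)
  rw [pack, Finset.sum_range_add, ← pack, Nat.add_mod, Nat.mod_eq_of_lt h,
    Nat.mod_eq_zero_of_dvd (Finset.dvd_sum fun i _ => ?_), add_zero, Nat.mod_eq_of_lt h]
  exact (pow_dvd_pow _ (Nat.mul_le_mul_left _ (by omega))).mul_left _

theorem land_pack_mono {K L l X : ℕ} {d e : ℕ → ℕ} (hl : l ≤ L) (hd : ∀ i < L, d i < 2 ^ K)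
    (he : ∀ i < L, e i < 2 ^ K) (h : X &&& pack K L d = pack K L e) :
    X &&& pack K l d = pack K l e := by
  rw [← pack_mod hl hd, ← pack_mod hl he, ← h, ← Nat.and_two_pow_sub_one_eq_mod,
    ← Nat.and_two_pow_sub_one_eq_mod, Nat.land_assoc]

theorem add_pack_land {K L l Z : ℕ} {b d : ℕ → ℕ} (hl : l ≤ L) (hb : ∀ i < L, b i < 2 ^ K)
    (hd : ∀ i < l, d i < 2 ^ K) :
    (Z + pack K L b) &&& pack K l d = (Z + pack K l b) &&& pack K l d := by
  have hfull : (2 ^ (K * l) - 1) &&& pack K l d = pack K l d := by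
    rw [Nat.land_comm, Nat.and_two_pow_sub_one_eq_mod, Nat.mod_eq_of_lt (pack_lt hd)]
  rw [← hfull, ← Nat.land_assoc, ← Nat.land_assoc, Nat.and_two_pow_sub_one_eq_mod,
    Nat.and_two_pow_sub_one_eq_mod, Nat.add_mod, pack_mod hl hb, Nat.add_mod Z (pack K l b),
    Nat.mod_eq_of_lt (pack_lt fun i hi => hb i (by omega))]

/-- A test that each coefficient dominates twice the sum of all coefficients whose index is smaller
by at least `E`. The argument is the packed sequence of absolute values. -/
def dominanceTest (k r E A : ℕ) : Bool :=
  Nat.beq (Nat.land (A + (2 ^ ((k + 3) * (3 * r)) -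
      Nat.land (A * packCyc (k + 3) r 1 1 1 * 2 ^ ((k + 3) * E + 1)) (2 ^ ((k + 3) * (3 * r)) - 1)) +
      packCyc (k + 3) r (4 * 2 ^ k) (4 * 2 ^ k) (4 * 2 ^ k))
    (packCyc (k + 3) r (7 * 2 ^ k) (7 * 2 ^ k) (7 * 2 ^ k)))
    (packCyc (k + 3) r (4 * 2 ^ k) (4 * 2 ^ k) (4 * 2 ^ k))

theorem eval_sum_C_mul_X_pow (K L : ℕ) (d : ℕ → ℕ) :
    (∑ i ∈ Finset.range L, C (d i : ℤ) * X ^ i : ℤ[X]).eval (2 ^ K) = (pack K L d : ℕ) := by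
  rw [eval_finsetSum, pack]
  push_cast
  apply Finset.sum_congr rfl
  intro i _
  simp [pow_mul]

theorem coeff_sum_C_mul_X_pow (L : ℕ) (d : ℕ → ℤ) (i : ℕ) :
    (∑ j ∈ Finset.range L, C (d j) * X ^ j).coeff i = if i < L then d i else 0 := by
  rw [finsetSum_coeff]
  simp only [coeff_C_mul_X_pow]
  rw [Finset.sum_ite_eq]
  simp

theorem coeff_mul_geom_sum (P : ℤ[X]) (L : ℕ) : ∀ i < L,
    (P * ∑ j ∈ Finset.range L, X ^ j).coeff i = ∑ j ∈ Finset.range (i + 1), P.coeff j := by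
  have hg : P * (∑ j ∈ Finset.range L, X ^ j) * (1 - X) = P - P * X ^ L := by
    rw [mul_assoc, geom_sum_mul_neg]
    ring
  intro i
  induction i with
  | zero =>
    intro hi
    rw [mul_coeff_zero, finsetSum_coeff]
    simp [coeff_X_pow, hi.ne']
  | succ i ih =>
    intro hi
    have := congrArg (fun Q => coeff Q (i + 1)) hg
    simp only [coeff_sub, coeff_mul_X_pow', mul_sub, mul_one, if_neg (show ¬ L ≤ i + 1 by omega),
      coeff_mul_X, sub_zero] at this
    rw [ih (by omega)] at this
    rw [Finset.sum_range_succ]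
    linarith

theorem dominated_of_dominanceTest {k r E A : ℕ} {a : ℕ → ℕ}
    (hA : A = pack (k + 3) (3 * r) a) (ha : ∀ i < 3 * r, a i < 2 ^ k)
    (ht : dominanceTest k r E A = true) :
    ∀ i < 3 * r, 2 * ∑ j ∈ Finset.range (i + 1 - E), (a j : ℤ) ≤ a i := by
  have h0 : 0 < 2 ^ k := by positivity
  have h0' : (0 : ℤ) < 2 ^ k := by positivity
  have h8' : (2 : ℤ) ^ (k + 3) = 8 * 2 ^ k := by ring
  have h8 : 2 ^ (k + 3) = 8 * 2 ^ k := by ring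
  rw [dominanceTest, Nat.beq_eq, packCyc_eq (by omega), packCyc_eq (by omega),
    packCyc_eq (by omega)] at ht
  have e1 : ∀ c, cyc c c c = fun _ => c := by
    intro c
    funext i
    simp [cyc]
  simp only [e1] at ht
  set P : ℤ[X] := ∑ i ∈ Finset.range (3 * r), C (a i : ℤ) * X ^ i with hPdef
  set Q : ℤ[X] := P - 2 * (P * (∑ j ∈ Finset.range (3 * r), X ^ j) * X ^ E) with hQdef
  have hcoeff : ∀ i < 3 * r, Q.coeff i = a i - 2 * ∑ j ∈ Finset.range (i + 1 - E), (a j : ℤ) := by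
    intro i hi
    have hP : ∀ i < 3 * r, P.coeff i = a i := by
      intro i hi
      rw [hPdef, coeff_sum_C_mul_X_pow, if_pos hi]
    rw [hQdef, coeff_sub, hP i hi, show (2 : ℤ[X]) = C 2 from rfl, coeff_C_mul, coeff_mul_X_pow']
    split_ifs with hE
    · rw [coeff_mul_geom_sum _ _ _ (by omega), show i - E + 1 = i + 1 - E by omega,
        Finset.sum_congr rfl fun j hj => hP j (by have := Finset.mem_range.mp hj; omega)]
    · rw [show i + 1 - E = 0 by omega]
      simp
  have hrep : Represents (k + 3) (3 * r) (A + (2 ^ ((k + 3) * (3 * r)) -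
      Nat.land (A * pack (k + 3) (3 * r) (fun _ => 1) * 2 ^ ((k + 3) * E + 1))
      (2 ^ ((k + 3) * (3 * r)) - 1))) Q.coeff := by
    apply represents_coeff
    have h1 : ∀ x m : ℕ, Nat.land x (2 ^ m - 1) = x % 2 ^ m := Nat.and_two_pow_sub_one_eq_mod
    have hev : Q.eval (2 ^ (k + 3)) =
        A - A * (pack (k + 3) (3 * r) (fun _ => 1) : ℕ) * 2 ^ ((k + 3) * E + 1) := by
      have := eval_sum_C_mul_X_pow (k + 3) (3 * r) fun _ => 1
      simp only [Nat.cast_one, map_one, one_mul] at this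
      rw [hQdef, eval_sub, eval_mul, eval_mul, eval_mul, this, hPdef, eval_sum_C_mul_X_pow, ← hA,
        eval_pow, eval_X, eval_ofNat, ← pow_mul, pow_succ]
      ring_nf
    rw [h1, hev]
    push_cast [Nat.cast_sub (Nat.mod_lt _ (show 0 < 2 ^ ((k + 3) * (3 * r)) by positivity)).le]
    rw [sub_eq_add_neg (A : ℤ)]
    refine Int.ModEq.add_left _ ?_
    rw [← zero_sub (_ * _)]
    exact Int.ModEq.sub (by simp [Int.ModEq]) (Int.mod_modEq _ _)
  intro i
  induction i using Nat.strong_induction_on with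
  | _ i ih =>
    intro hi
    have hlt : ∀ c < 8, ∀ i < 3 * r, (fun _ : ℕ => c * 2 ^ k) i < 2 ^ (k + 3) := by
      intro c hc i _
      simp only [h8]
      nlinarith
    have hland := land_pack_mono (l := i + 1) (by omega) (hlt 7 (by norm_num))
      (hlt 4 (by norm_num)) ht
    have := (hrep.mono (l := i + 1) (by omega)).digit_bounds (c := fun _ => 4) (b := fun _ => 4 * 2 ^ k)
      ?_ (fun _ _ => by norm_num) ?_ i (by omega)
    · rw [hcoeff i hi] at this
      push_cast at this
      linarith [this.1]
    · intro j hj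
      rw [hcoeff j (by omega), h8']
      have hnn : ∀ n, 0 ≤ ∑ j ∈ Finset.range n, (a j : ℤ) :=
        fun n => Finset.sum_nonneg fun _ _ => by positivity
      have hj1 : (a j : ℤ) < 2 ^ k := by exact_mod_cast ha j (by omega)
      have hj0 : (0 : ℤ) ≤ a j := by positivity
      have hup : 2 * ∑ j ∈ Finset.range (j + 1 - E), (a j : ℤ) ≤ 4 * 2 ^ k := by
        rcases Nat.eq_zero_or_pos (j + 1 - E) with h | h
        · rw [h]
          simp only [Finset.range_zero, Finset.sum_empty]
          linarith
        · rcases j with _ | j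
          · have : (0 + 1 - E) = 1 := by omega
            rw [this]
            simp only [Finset.range_one, Finset.sum_singleton]
            linarith
          · have hprev := ih j (by omega) (by omega)
            have hj2 : (a j : ℤ) < 2 ^ k := by exact_mod_cast ha j (by omega)
            rw [show j + 1 + 1 - E = (j + 1 - E) + 1 by omega, Finset.sum_range_succ]
            have hj3 : (a (j + 1 - E) : ℤ) < 2 ^ k := by exact_mod_cast ha _ (by omega)
            linarith
      have := hnn (j + 1 - E)
      push_cast
      constructor <;> linarith
    · rw [← add_pack_land (by omega : i + 1 ≤ 3 * r) (hlt 4 (by norm_num))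
        fun i _ => hlt 7 (by norm_num) i (by omega)]
      exact hland

theorem signLoop_eq_true : signLoop 321 12167
    (fun Z => dominanceTest 321 12167 2236 (packAbs 321 12167 Z)) 745 0 1 = true := by
  decide +kernel

theorem hasBorweinSign_of_lt (n : ℕ) {i : ℕ} (hi : i < 36501) :
    HasBorweinSign i ((borweinPoly n).coeff i) := by
  have h0 : borweinPoly 0 = 1 := by simp [borweinPoly]
  obtain ⟨h1, Z, hZ, hmod⟩ := signLoop_sound 745 0 1
    (by rw [h0, eval_one, Nat.cast_one])
    (by
      rw [h0]
      intro i _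
      rw [coeff_one]
      have : (1 : ℤ) < 2 ^ 321 := one_lt_pow₀ (by norm_num) (by norm_num)
      have h3 : (0 : ℤ) < 2 ^ 321 := by positivity
      split_ifs with h
      · subst h
        exact ⟨⟨fun _ => by norm_num, fun h => absurd rfl h⟩, by rwa [abs_one]⟩
      · exact ⟨⟨fun _ => le_rfl, fun _ => le_rfl⟩, by rwa [abs_zero]⟩)
    signLoop_eq_true
  rcases le_or_gt n 745 with hn | hn
  · have := (h1 n hn i hi).1
    rwa [zero_add] at this
  · obtain ⟨c, rfl⟩ := Nat.exists_eq_add_of_le hn.le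
    have hs := h1 745 le_rfl
    rw [zero_add] at hs hmod
    refine hasBorweinSign_of_dominant (L := 3 * 12167) (fun i hi => (hs i hi).1) ?_ c i hi
    have hA := packAbs_eq hmod hs
    have hlt : ∀ i < 3 * 12167, (fun i => ((borweinPoly 745).coeff i).natAbs) i < 2 ^ 321 := by
      intro i hi
      zify
      exact (hs i hi).2
    have := dominated_of_dominanceTest hA hlt hZ
    intro i hi
    have h2 := this i hi
    simpa only [Int.natCast_natAbs] using h2

/-- The sum of the values of `f` on `[i, n)`. -/
def tailSum (n : ℕ) (f : ℕ → ℝ) (i : ℕ) : ℝ := ∑ j ∈ Finset.Ico i n, f j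

theorem tailSum_mul_le {n : ℕ} {A B : ℕ → ℝ} (h : ∀ i j, i ≤ j → A j * B i ≤ A i * B j) (i j : ℕ)
    (hij : i ≤ j) : tailSum n A j * tailSum n B i ≤ tailSum n A i * tailSum n B j := by
  rcases le_total j n with hj | hj
  · have key : tailSum n A j * ∑ l ∈ Finset.Ico i j, B l ≤
        (∑ l ∈ Finset.Ico i j, A l) * tailSum n B j := by
      rw [tailSum, tailSum, Finset.sum_mul_sum, Finset.sum_mul_sum, Finset.sum_comm]
      refine Finset.sum_le_sum fun l hl => Finset.sum_le_sum fun p hp => h l p ?_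
      rw [Finset.mem_Ico] at hl hp
      omega
    have hA : tailSum n A i = (∑ l ∈ Finset.Ico i j, A l) + tailSum n A j :=
      (Finset.sum_Ico_consecutive _ hij hj).symm
    have hB : tailSum n B i = (∑ l ∈ Finset.Ico i j, B l) + tailSum n B j :=
      (Finset.sum_Ico_consecutive _ hij hj).symm
    rw [hA, hB]
    linarith
  · simp [tailSum, Finset.Ico_eq_empty_of_le hj]

theorem sum_mul_tailSum (n a : ℕ) (w f : ℕ → ℝ) :
    ∑ i ∈ Finset.Ico a n, w i * tailSum n f i =
      ∑ j ∈ Finset.Ico a n, (∑ i ∈ Finset.Ico a (j + 1), w i) * f j := by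
  simp only [tailSum, Finset.mul_sum, Finset.sum_mul]
  exact Finset.sum_Ico_Ico_comm a n fun i j => w i * f j

theorem tailSum_add_one (n : ℕ) (f : ℕ → ℝ) (i : ℕ) :
    tailSum n f (i + 1) = tailSum (n - 1) (fun j => f (j + 1)) i := by
  rw [tailSum, tailSum, Finset.sum_Ico_add' f i (n - 1) 1]
  rcases Nat.eq_zero_or_pos n with rfl | hn
  · simp
  · rw [Nat.sub_add_cancel hn]

theorem tailSum_tailSum (n : ℕ) (f : ℕ → ℝ) (i : ℕ) :
    tailSum n (tailSum n f) i = ∑ k ∈ Finset.range (n - i), (k + 1 : ℝ) * f (i + k) := by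
  have h := sum_mul_tailSum n i (fun _ => 1) f
  simp only [one_mul, Finset.sum_const, Nat.card_Ico, nsmul_eq_mul, mul_one] at h
  rw [tailSum, h, Finset.sum_Ico_eq_sum_range]
  refine Finset.sum_congr rfl fun k _ => ?_
  rw [show i + k + 1 - i = k + 1 by omega]
  push_cast
  ring

section LogConcave

variable {n : ℕ} {f : ℕ → ℝ}

theorem tailSum_mul_zero_le (h0 : ∀ j, 0 ≤ f j)
    (hlc : ∀ i j k, i ≤ j → f (j + k) * f i ≤ f (i + k) * f j) (i : ℕ) :
    tailSum n f i * f 0 ≤ f i * tailSum n f 0 := by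
  rw [tailSum, tailSum, Finset.sum_Ico_eq_sum_range, Finset.sum_Ico_eq_sum_range, Finset.sum_mul,
    Finset.mul_sum]
  calc ∑ k ∈ Finset.range (n - i), f (i + k) * f 0 ≤ ∑ k ∈ Finset.range (n - i), f i * f (0 + k) := by
        refine Finset.sum_le_sum fun k _ => ?_
        rw [mul_comm (f i)]
        exact hlc 0 i k (Nat.zero_le _)
    _ ≤ _ := Finset.sum_le_sum_of_subset_of_nonneg (by gcongr; omega)
        fun k _ _ => mul_nonneg (h0 _) (h0 _)

theorem tailSum_nonneg (h0 : ∀ j, 0 ≤ f j) (i : ℕ) : 0 ≤ tailSum n f i :=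
  Finset.sum_nonneg fun j _ => h0 j

theorem sum_succ_mul_le (h0 : ∀ j, 0 ≤ f j)
    (hlc : ∀ i j k, i ≤ j → f (j + k) * f i ≤ f (i + k) * f j) :
    (∑ j ∈ Finset.range n, (j + 1 : ℝ) * f j) * f 0 ≤ (∑ j ∈ Finset.range n, f j) ^ 2 := by
  have h := tailSum_tailSum n f 0
  simp only [zero_add, Nat.sub_zero] at h
  rw [← h, tailSum, Finset.sum_mul, Finset.range_eq_Ico, sq, Finset.sum_mul]
  exact Finset.sum_le_sum fun i _ => tailSum_mul_zero_le h0 hlc i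

theorem sum_succ_mul_add_two_mul_le (h0 : ∀ j, 0 ≤ f j)
    (hlc : ∀ i j k, i ≤ j → f (j + k) * f i ≤ f (i + k) * f j) :
    (∑ j ∈ Finset.range n, (j + 1 : ℝ) * (j + 2) * f j) * f 0 ^ 2 ≤
      2 * (∑ j ∈ Finset.range n, f j) ^ 3 := by
  have hw : ∀ j : ℕ, ∑ i ∈ Finset.Ico 0 (j + 1), (i + 1 : ℝ) = (j + 1) * (j + 2) / 2 := by
    intro j
    rw [← Finset.range_eq_Ico]
    induction j with
    | zero => simp
    | succ j ih => rw [Finset.sum_range_succ, ih]; push_cast; ring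
  have h1 : ∑ j ∈ Finset.range n, (j + 1 : ℝ) * (j + 2) * f j =
      2 * ∑ j ∈ Finset.range n, (j + 1 : ℝ) * tailSum n f j := by
    rw [Finset.range_eq_Ico, sum_mul_tailSum, Finset.mul_sum]
    refine Finset.sum_congr rfl fun j _ => ?_
    rw [hw]
    ring
  have h2 : (∑ j ∈ Finset.range n, (j + 1 : ℝ) * tailSum n f j) * f 0 ≤
      (∑ j ∈ Finset.range n, (j + 1 : ℝ) * f j) * tailSum n f 0 := by
    rw [Finset.sum_mul, Finset.sum_mul]
    refine Finset.sum_le_sum fun j _ => ?_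
    rw [mul_assoc, mul_assoc]
    exact mul_le_mul_of_nonneg_left (tailSum_mul_zero_le h0 hlc j) (by positivity)
  have h3 := sum_succ_mul_le (n := n) h0 hlc
  have h4 : tailSum n f 0 = ∑ j ∈ Finset.range n, f j := by rw [tailSum, Finset.range_eq_Ico]
  have h5 : 0 ≤ tailSum n f 0 := tailSum_nonneg h0 0
  rw [h1]
  calc 2 * (∑ j ∈ Finset.range n, (j + 1 : ℝ) * tailSum n f j) * f 0 ^ 2
      = 2 * ((∑ j ∈ Finset.range n, (j + 1 : ℝ) * tailSum n f j) * f 0) * f 0 := by ring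
    _ ≤ 2 * ((∑ j ∈ Finset.range n, (j + 1 : ℝ) * f j) * tailSum n f 0) * f 0 := by
        gcongr
        exact h0 0
    _ = 2 * ((∑ j ∈ Finset.range n, (j + 1 : ℝ) * f j) * f 0) * tailSum n f 0 := by ring
    _ ≤ 2 * (∑ j ∈ Finset.range n, f j) ^ 2 * tailSum n f 0 := by gcongr
    _ = _ := by rw [h4]; ring

theorem tailSum_tailSum_succ_mul_le (h0 : ∀ j, 0 ≤ f j)
    (hlc : ∀ i j k, i ≤ j → f (j + k) * f i ≤ f (i + k) * f j) (i j : ℕ) (hij : i ≤ j) :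
    tailSum n (tailSum n f) (j + 1) * f i ≤ tailSum n (tailSum n f) (i + 1) * f j := by
  rw [tailSum_tailSum, tailSum_tailSum, Finset.sum_mul, Finset.sum_mul]
  calc _ ≤ ∑ k ∈ Finset.range (n - (j + 1)), (k + 1 : ℝ) * f (i + 1 + k) * f j := by
        refine Finset.sum_le_sum fun k _ => ?_
        rw [mul_assoc, mul_assoc, add_assoc j, add_assoc i]
        exact mul_le_mul_of_nonneg_left (hlc i j (1 + k) hij) (by positivity)
    _ ≤ _ := by
        refine Finset.sum_le_sum_of_subset_of_nonneg (by gcongr) fun k _ _ => ?_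
        have := h0 (i + 1 + k)
        have := h0 j
        positivity

theorem sum_mul_tailSum_of_partial_sums {w W : ℕ → ℝ} (h0 : w 0 = W 0)
    (hs : ∀ j, W (j + 1) = W j + w (j + 1)) (n : ℕ) (f : ℕ → ℝ) :
    ∑ i ∈ Finset.range n, w i * tailSum n f i = ∑ j ∈ Finset.range n, W j * f j := by
  have hw : ∀ j, ∑ i ∈ Finset.range (j + 1), w i = W j := by
    intro j
    induction j with
    | zero => simpa using h0
    | succ j ih => rw [Finset.sum_range_succ, ih, hs]
  rw [Finset.range_eq_Ico, sum_mul_tailSum]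
  exact Finset.sum_congr rfl fun j _ => by rw [← Finset.range_eq_Ico, hw]

theorem tailSum_self (n : ℕ) (f : ℕ → ℝ) : tailSum n f n = 0 := by simp [tailSum]

theorem tailSum_comp_add_one {n : ℕ} {f : ℕ → ℝ} (hf : f n = 0) (i : ℕ) :
    tailSum n (fun j => f (j + 1)) i = tailSum n f (i + 1) := by
  have h := tailSum_add_one (n + 1) f i
  rw [Nat.add_sub_cancel] at h
  rw [← h]
  rcases le_or_gt (i + 1) n with hi | hi
  · rw [tailSum, Finset.sum_Ico_succ_top hi, hf, add_zero, tailSum]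
  · rw [tailSum, tailSum, Finset.Ico_eq_empty_of_le (by omega), Finset.Ico_eq_empty_of_le (by omega)]

/-- The fourth moment of a log-concave sequence about `-1/2`. -/
theorem fourth_moment_mul_le (h0 : ∀ j, 0 ≤ f j)
    (hlc : ∀ i j k, i ≤ j → f (j + k) * f i ≤ f (i + k) * f j) :
    (∑ j ∈ Finset.range n, (j + 1 / 2 : ℝ) ^ 4 * f j) * (∑ j ∈ Finset.range n, f j) ≤
      6 * (∑ j ∈ Finset.range n, (j + 1 / 2 : ℝ) ^ 2 * f j) ^ 2 := by
  set T1 := tailSum n f with hT1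
  set T2 := tailSum n T1 with hT2
  set T3 := tailSum n T2 with hT3
  have hM : T1 0 = ∑ j ∈ Finset.range n, f j := by rw [hT1, tailSum, Finset.range_eq_Ico]
  have hM0 : 0 ≤ T1 0 := tailSum_nonneg h0 0
  have key : ∀ j, T3 (j + 1) * T1 0 ≤ T3 1 * T1 j := by
    intro j
    have h := tailSum_mul_le (n := n) (A := fun j => T2 (j + 1)) (B := f)
      (tailSum_tailSum_succ_mul_le h0 hlc) 0 j (Nat.zero_le j)
    rwa [tailSum_comp_add_one (tailSum_self _ _), tailSum_comp_add_one (tailSum_self _ _)] at h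
  have h1 : ∑ l ∈ Finset.range n, (l : ℝ) * T1 l =
      ∑ j ∈ Finset.range n, (j * (j + 1) / 2 : ℝ) * f j :=
    sum_mul_tailSum_of_partial_sums (W := fun j : ℕ => (j * (j + 1) / 2 : ℝ)) (by simp)
      (fun j => by push_cast; ring) n f
  have h2 : T3 1 = ∑ j ∈ Finset.range n, (j * (j + 1) / 2 : ℝ) * f j := by
    rw [← h1, hT3, tailSum, ← sum_mul_tailSum_of_partial_sums (w := fun i => if i = 0 then 0 else 1)
      (W := fun j : ℕ => (j : ℝ)) (by simp) (fun j => by simp) n T1]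
    rcases Nat.eq_zero_or_pos n with rfl | hn
    · simp
    · rw [Finset.range_eq_Ico, Finset.sum_eq_sum_Ico_succ_bot hn]
      simp only [if_true, zero_mul, zero_add]
      refine Finset.sum_congr rfl fun i hi => ?_
      rw [Finset.mem_Ico] at hi
      rw [if_neg (by omega), one_mul]
  have h3 : ∑ l ∈ Finset.range n, (l : ℝ) * T3 (l + 1) =
      ∑ j ∈ Finset.range n, (((j : ℝ) - 1) * j * (j + 1) * (j + 2) / 24 : ℝ) * f j := by
    rw [← sum_mul_tailSum_of_partial_sums (w := fun j : ℕ => (((j : ℝ) - 1) * j * (j + 1) / 6 : ℝ))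
      (by simp) (fun j => by push_cast; ring) n f, ← hT1,
      ← sum_mul_tailSum_of_partial_sums (w := fun j : ℕ => (((j : ℝ) - 1) * j / 2 : ℝ))
      (by simp) (fun j => by push_cast; ring) n T1, ← hT2,
      ← sum_mul_tailSum_of_partial_sums (w := fun j : ℕ => if j = 0 then 0 else ((j : ℝ) - 1))
      (by simp) (fun j => by simp; ring) n T2, ← hT3]
    have h := Finset.sum_range_succ' (fun j : ℕ => (if j = 0 then 0 else ((j : ℝ) - 1)) * T3 j) n
    rw [Finset.sum_range_succ, hT3, tailSum_self, ← hT3] at h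
    simpa using h.symm
  have h4 : (∑ l ∈ Finset.range n, (l : ℝ) * T3 (l + 1)) * T1 0 ≤ T3 1 * T3 1 := by
    nth_rewrite 2 [h2]
    rw [← h1, Finset.mul_sum]
    rw [Finset.sum_mul]
    refine Finset.sum_le_sum fun l _ => ?_
    have := mul_le_mul_of_nonneg_left (key l) (Nat.cast_nonneg (α := ℝ) l)
    linarith
  set S2 := ∑ j ∈ Finset.range n, (j + 1 / 2 : ℝ) ^ 2 * f j with hS2
  set S4 := ∑ j ∈ Finset.range n, (j + 1 / 2 : ℝ) ^ 4 * f j with hS4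
  have e2 : T3 1 = (S2 - T1 0 / 4) / 2 := by
    rw [h2, hM, hS2, Finset.sum_div, ← Finset.sum_sub_distrib, Finset.sum_div]
    exact Finset.sum_congr rfl fun j _ => by ring
  have e4 : ∑ l ∈ Finset.range n, (l : ℝ) * T3 (l + 1) = (S4 - 5 / 2 * S2 + 9 / 16 * T1 0) / 24 := by
    rw [h3, hM, hS2, hS4, Finset.mul_sum, Finset.mul_sum, ← Finset.sum_sub_distrib,
      ← Finset.sum_add_distrib, Finset.sum_div]
    exact Finset.sum_congr rfl fun j _ => by ring
  have hS2n : 0 ≤ S2 := Finset.sum_nonneg fun j _ => mul_nonneg (by positivity) (h0 j)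
  rw [e2, e4] at h4
  rw [← hM]
  nlinarith [mul_nonneg hS2n hM0, mul_nonneg hM0 hM0]

end LogConcave

/-- The midpoint `3j + 3/2` of the two exponents `3j + 1` and `3j + 2`. -/
noncomputable def node (j : ℕ) : ℝ := 3 * j + 3 / 2

/-- The weight `x / (1 + x + x²)` for `x = exp (-t (3j + 3/2))`. -/
noncomputable def weight (t : ℝ) (j : ℕ) : ℝ := (1 + 2 * Real.cosh (node j * t))⁻¹

/-- The mean `(x + 2x²) / (1 + x + x²)` for `x = exp (-t (3j + 3/2))`. -/
noncomputable def tilt (t : ℝ) (j : ℕ) : ℝ :=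
  (Real.exp (-(node j * t)) + 2 * Real.exp (-(node j * t)) ^ 2) /
    (1 + Real.exp (-(node j * t)) + Real.exp (-(node j * t)) ^ 2)

/-- The total weight. -/
noncomputable def mass (n : ℕ) (t : ℝ) : ℝ := ∑ j ∈ Finset.range n, weight t j

/-- The `k`-th moment of the weights. -/
noncomputable def moment (k n : ℕ) (t : ℝ) : ℝ := ∑ j ∈ Finset.range n, node j ^ k * weight t j

theorem node_pos (j : ℕ) : 0 < node j := by unfold node; positivity

theorem weight_pos (t : ℝ) (j : ℕ) : 0 < weight t j := by
  have := Real.one_le_cosh (node j * t)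
  exact inv_pos.2 (by linarith)

theorem weight_le (t : ℝ) (j : ℕ) : weight t j ≤ 1 / 3 := by
  have := Real.one_le_cosh (node j * t)
  rw [weight, one_div]
  exact inv_anti₀ (by norm_num) (by linarith)

theorem mass_nonneg (n : ℕ) (t : ℝ) : 0 ≤ mass n t := Finset.sum_nonneg fun j _ => (weight_pos t j).le

theorem moment_nonneg (k n : ℕ) (t : ℝ) : 0 ≤ moment k n t :=
  Finset.sum_nonneg fun j _ => mul_nonneg (pow_nonneg (node_pos j).le _) (weight_pos t j).le

theorem weight_eq (t : ℝ) (j : ℕ) : weight t j = Real.exp (-(node j * t)) /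
    (1 + Real.exp (-(node j * t)) + Real.exp (-(node j * t)) ^ 2) := by
  have h : Real.exp (-(node j * t)) * Real.exp (node j * t) = 1 := by
    rw [← Real.exp_add]; simp
  have h0 := Real.exp_pos (-(node j * t))
  have h1 := Real.exp_pos (node j * t)
  rw [weight, Real.cosh_eq, inv_eq_one_div, div_eq_div_iff (by positivity) (by positivity)]
  linear_combination -h

theorem cosh_mul_cosh_le {a b c d : ℝ} (hs : a + b = c + d) (hd : |a - b| ≤ |c - d|) :
    (1 + 2 * Real.cosh a) * (1 + 2 * Real.cosh b) ≤
      (1 + 2 * Real.cosh c) * (1 + 2 * Real.cosh d) := by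
  have key : ∀ u v : ℝ, (1 + 2 * Real.cosh u) * (1 + 2 * Real.cosh v) =
      1 + 4 * Real.cosh ((u + v) / 2) * Real.cosh ((u - v) / 2) + 2 * Real.cosh (u + v) +
        2 * Real.cosh (u - v) := by
    intro u v
    have h1 : Real.cosh u = Real.cosh ((u + v) / 2 + (u - v) / 2) := by ring_nf
    have h2 : Real.cosh v = Real.cosh ((u + v) / 2 - (u - v) / 2) := by ring_nf
    have h3 : Real.cosh u + Real.cosh v = 2 * Real.cosh ((u + v) / 2) * Real.cosh ((u - v) / 2) := by
      rw [h1, h2, Real.cosh_add, Real.cosh_sub]; ring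
    rw [Real.cosh_add, Real.cosh_sub]
    linear_combination 2 * h3
  rw [key, key, hs]
  have h1 : Real.cosh ((a - b) / 2) ≤ Real.cosh ((c - d) / 2) := by
    rw [Real.cosh_le_cosh, abs_div, abs_div]
    gcongr
  have h2 : Real.cosh (a - b) ≤ Real.cosh (c - d) := Real.cosh_le_cosh.2 hd
  have h3 := Real.cosh_pos ((c + d) / 2)
  nlinarith [mul_le_mul_of_nonneg_left h1 h3.le]

theorem weight_mul_weight_le (t : ℝ) (i j k : ℕ) (hij : i ≤ j) :
    weight t (j + k) * weight t i ≤ weight t (i + k) * weight t j := by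
  rw [weight, weight, weight, weight, ← mul_inv, ← mul_inv]
  have h1 := Real.cosh_pos (node (i + k) * t)
  have h2 := Real.cosh_pos (node j * t)
  refine inv_anti₀ (by positivity) (cosh_mul_cosh_le ?_ ?_)
  · simp only [node]; push_cast; ring
  · have hij' : (i : ℝ) ≤ j := Nat.cast_le.2 hij
    have hk : (0 : ℝ) ≤ k := Nat.cast_nonneg k
    rw [← sub_mul, ← sub_mul, abs_mul, abs_mul]
    gcongr 1
    simp only [node]
    push_cast
    rw [abs_le]
    constructor <;> rw [abs_of_nonneg (by linarith)] <;> linarith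

theorem weight_anti {t : ℝ} {i j : ℕ} (hij : i ≤ j) : weight t j ≤ weight t i := by
  have h1 := Real.cosh_pos (node i * t)
  refine inv_anti₀ (by positivity) ?_
  have : Real.cosh (node i * t) ≤ Real.cosh (node j * t) := by
    rw [Real.cosh_le_cosh, abs_mul, abs_mul, abs_of_pos (node_pos i), abs_of_pos (node_pos j)]
    have hij' : (i : ℝ) ≤ j := Nat.cast_le.2 hij
    gcongr
    simp only [node]
    linarith
  linarith

theorem sum_exp_mul_sinh (n : ℕ) (a : ℝ) :
    2 * Real.sinh a * ∑ j ∈ Finset.range n, Real.exp (-((2 * j + 1) * a)) =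
      1 - Real.exp (-(2 * n * a)) := by
  induction n with
  | zero => simp
  | succ n ih =>
    rw [Finset.sum_range_succ, mul_add, ih, Real.sinh_eq]
    have h1 : Real.exp a * Real.exp (-((2 * n + 1) * a)) = Real.exp (-(2 * n * a)) := by
      rw [← Real.exp_add]; ring_nf
    have h2 : Real.exp (-a) * Real.exp (-((2 * n + 1) * a)) = Real.exp (-(2 * (n + 1 : ℕ) * a)) := by
      rw [← Real.exp_add]; push_cast; ring_nf
    linear_combination h1 - h2

theorem sum_exp_mul_le (n : ℕ) {a : ℝ} (ha : 0 ≤ a) :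
    2 * a * ∑ j ∈ Finset.range n, Real.exp (-((2 * j + 1) * a)) ≤ 1 - Real.exp (-(2 * n * a)) := by
  rw [← sum_exp_mul_sinh]
  gcongr
  exact Real.self_le_sinh_iff.2 ha

theorem node_mul_tilt_mul_sq_le {t : ℝ} (ht : 0 ≤ t) (n : ℕ) :
    (∑ j ∈ Finset.range n, node j * tilt t j) * t ^ 2 ≤ 0.736 := by
  have he : Real.exp (-1) ≤ 0.368 := by
    rw [Real.exp_neg, ← one_div, div_le_iff₀ (Real.exp_pos 1)]
    have := Real.exp_one_gt_d9
    linarith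
  have h1 : ∀ j : ℕ, node j * tilt t j * t ≤
      3 * Real.exp (-1) * Real.exp (-((2 * j + 1) * (3 / 4 * t))) := by
    intro j
    set s := node j * t with hs
    have hs0 : 0 ≤ s := mul_nonneg (node_pos j).le ht
    have h2 : Real.exp (-s) = Real.exp (-(s / 2)) * Real.exp (-(s / 2)) := by
      rw [← Real.exp_add]; ring_nf
    have h3 : Real.exp (-((2 * j + 1) * (3 / 4 * t))) = Real.exp (-(s / 2)) := by
      rw [hs, node]; ring_nf
    have h4 : s / 2 * Real.exp (-(s / 2)) ≤ Real.exp (-1) := by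
      have := Real.add_one_le_exp (s / 2 - 1)
      calc s / 2 * Real.exp (-(s / 2)) ≤ Real.exp (s / 2 - 1) * Real.exp (-(s / 2)) := by
            gcongr; linarith
        _ = Real.exp (-1) := by rw [← Real.exp_add]; ring_nf
    have h5 : tilt t j ≤ 3 / 2 * Real.exp (-s) := by
      have hx := Real.exp_pos (-s)
      rw [tilt, ← hs, div_le_iff₀ (by positivity)]
      nlinarith [mul_nonneg hx.le (sq_nonneg (Real.exp (-s) - 1 / 3)), mul_pos hx hx]
    rw [h3]
    calc node j * tilt t j * t = s * tilt t j := by rw [hs]; ring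
      _ ≤ s * (3 / 2 * Real.exp (-s)) := by gcongr
      _ = 3 * (s / 2 * Real.exp (-(s / 2))) * Real.exp (-(s / 2)) := by rw [h2]; ring
      _ ≤ _ := by gcongr
  have h2 := sum_exp_mul_le n (a := 3 / 4 * t) (by positivity)
  have h3 : (∑ j ∈ Finset.range n, node j * tilt t j) * t ≤
      3 * Real.exp (-1) * ∑ j ∈ Finset.range n, Real.exp (-((2 * j + 1) * (3 / 4 * t))) := by
    rw [Finset.sum_mul, Finset.mul_sum]
    exact Finset.sum_le_sum fun j _ => h1 j
  have h4 := Real.exp_pos (-(2 * n * (3 / 4 * t)))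
  have h5 := Real.exp_pos (-1)
  calc _ = ((∑ j ∈ Finset.range n, node j * tilt t j) * t) * t := by ring
    _ ≤ (3 * Real.exp (-1) * ∑ j ∈ Finset.range n, Real.exp (-((2 * j + 1) * (3 / 4 * t)))) * t := by
        gcongr
    _ = 2 * Real.exp (-1) * (2 * (3 / 4 * t) *
          ∑ j ∈ Finset.range n, Real.exp (-((2 * j + 1) * (3 / 4 * t)))) := by ring
    _ ≤ 2 * Real.exp (-1) * 1 := by gcongr; linarith
    _ ≤ 0.736 := by linarith

theorem sum_node (n : ℕ) : ∑ j ∈ Finset.range n, node j = 3 / 2 * n ^ 2 := by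
  induction n with
  | zero => simp
  | succ n ih => rw [Finset.sum_range_succ, ih, node]; push_cast; ring

theorem exists_saddle {n m : ℕ} (hm : 36500 ≤ m) (hmn : 2 * m ≤ 3 * n ^ 2) :
    ∃ t : ℝ, 0 ≤ t ∧ t ≤ 0.0045 ∧ ∑ j ∈ Finset.range n, node j * tilt t j = m := by
  have hm' : (36500 : ℝ) ≤ m := by exact_mod_cast hm
  have hc : Continuous fun t : ℝ => ∑ j ∈ Finset.range n, node j * tilt t j := by
    refine continuous_finsetSum _ fun j _ => continuous_const.mul ?_
    unfold tilt
    refine Continuous.div (by fun_prop) (by fun_prop) fun t => ?_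
    positivity
  have h0 : (m : ℝ) ≤ ∑ j ∈ Finset.range n, node j * tilt 0 j := by
    have : ∀ j, tilt 0 j = 1 := fun j => by simp [tilt]; norm_num
    simp only [this, mul_one, sum_node]
    have : (2 : ℝ) * m ≤ 3 * n ^ 2 := by exact_mod_cast hmn
    linarith
  have h1 : ∑ j ∈ Finset.range n, node j * tilt 1 j ≤ m := by
    have := node_mul_tilt_mul_sq_le zero_le_one n
    linarith
  obtain ⟨t, ht, htm⟩ := intermediate_value_Icc' zero_le_one hc.continuousOn ⟨h1, h0⟩
  refine ⟨t, ht.1, ?_, htm⟩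
  have h2 := node_mul_tilt_mul_sq_le ht.1 n
  simp only at htm
  rw [htm] at h2
  by_contra! h
  nlinarith

theorem weight_zero_lower {t : ℝ} (ht0 : 0 ≤ t) (ht : t ≤ 0.0045) : 1 ≤ 3.0001 * weight t 0 := by
  have h := Real.cosh_le_exp_half_sq (node 0 * t)
  have h1 : node 0 * t ≤ 0.00675 := by simp [node]; linarith
  have h2 : 0 ≤ node 0 * t := mul_nonneg (node_pos 0).le ht0
  have h3 : Real.exp ((node 0 * t) ^ 2 / 2) ≤ 1.00003 := by
    have h4 : (node 0 * t) ^ 2 / 2 ≤ 0.000023 := by nlinarith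
    have h5 := Real.exp_bound_div_one_sub_of_interval (x := (node 0 * t) ^ 2 / 2) (by positivity)
      (by linarith)
    refine h5.trans ?_
    rw [div_le_iff₀ (by linarith)]
    nlinarith
  have h6 := Real.cosh_pos (node 0 * t)
  rw [weight, ← div_eq_mul_inv, le_div_iff₀ (by positivity)]
  linarith

theorem sinh_le_of_abs_le {u : ℝ} (hu0 : 0 ≤ u) (hu : u ≤ 1) :
    Real.sinh u ≤ u + 2 / 9 * u ^ 3 := by
  have h1 := Real.exp_bound (x := u) (n := 3) (by rw [abs_of_nonneg hu0]; exact hu) (by norm_num)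
  have h2 := Real.exp_bound (x := -u) (n := 3) (by rw [abs_neg, abs_of_nonneg hu0]; exact hu)
    (by norm_num)
  rw [abs_of_nonneg hu0] at h1
  rw [abs_neg, abs_of_nonneg hu0] at h2
  simp only [Finset.sum_range_succ, Finset.sum_range_zero, Nat.factorial] at h1 h2
  norm_num at h1 h2
  rw [Real.sinh_eq]
  have h3 := (abs_le.1 h1).2
  have h4 := (abs_le.1 h2).1
  linarith

theorem mul_mass_le {n : ℕ} {t : ℝ} (ht0 : 0 ≤ t) (ht : t ≤ 0.0045) : t * mass n t ≤ 0.20375 := by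
  set S1 := ∑ j ∈ Finset.range n, Real.exp (-((2 * j + 1) * (3 / 2 * t))) with hS1
  set S2 := ∑ j ∈ Finset.range n, Real.exp (-((2 * j + 1) * (3 * t))) with hS2
  set S3 := ∑ j ∈ Finset.range n, Real.exp (-((2 * j + 1) * (9 / 2 * t))) with hS3
  set X := Real.exp (-(2 * n * (3 / 2 * t))) with hX
  have hX0 : 0 < X := Real.exp_pos _
  have hX1 : X ≤ 1 := Real.exp_le_one_iff.2 (by simp; positivity)
  have hX2 : Real.exp (-(2 * n * (3 * t))) = X ^ 2 := by
    rw [hX, ← Real.exp_nat_mul]; push_cast; ring_nf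
  have hX3 : Real.exp (-(2 * n * (9 / 2 * t))) = X ^ 3 := by
    rw [hX, ← Real.exp_nat_mul]; push_cast; ring_nf
  have h1 := sum_exp_mul_le n (a := 3 / 2 * t) (by positivity)
  have h2 := sum_exp_mul_sinh n (3 * t)
  have h3 := sum_exp_mul_le n (a := 9 / 2 * t) (by positivity)
  rw [hX2] at h2
  rw [hX3] at h3
  rw [← hS1] at h1
  rw [← hS2] at h2
  rw [← hS3] at h3
  have hS2n : 0 ≤ S2 := Finset.sum_nonneg fun j _ => (Real.exp_pos _).le
  have hle : mass n t ≤ S1 - S2 + S3 / 3 := by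
    rw [mass, hS1, hS2, hS3, Finset.sum_div, ← Finset.sum_sub_distrib, ← Finset.sum_add_distrib]
    refine Finset.sum_le_sum fun j _ => ?_
    have e1 : Real.exp (-((2 * j + 1) * (3 / 2 * t))) = Real.exp (-(node j * t)) := by
      rw [node]; ring_nf
    have e2 : Real.exp (-((2 * j + 1) * (3 * t))) = Real.exp (-(node j * t)) ^ 2 := by
      rw [node, ← Real.exp_nat_mul]; push_cast; ring_nf
    have e3 : Real.exp (-((2 * j + 1) * (9 / 2 * t))) = Real.exp (-(node j * t)) ^ 3 := by
      rw [node, ← Real.exp_nat_mul]; push_cast; ring_nf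
    rw [e1, e2, e3, weight_eq]
    have hx := Real.exp_pos (-(node j * t))
    set x := Real.exp (-(node j * t))
    rw [div_le_iff₀ (by positivity)]
    nlinarith [mul_nonneg hx.le (sq_nonneg (x * (1 - x)))]
  have hs : Real.sinh (3 * t) ≤ 3 * t * 1.0001 := by
    have h := sinh_le_of_abs_le (u := 3 * t) (by positivity) (by linarith)
    nlinarith [mul_nonneg ht0 (mul_nonneg (sub_nonneg.2 ht) (sub_nonneg.2 ht)),
      mul_nonneg ht0 (mul_nonneg ht0 (sub_nonneg.2 ht)), mul_nonneg ht0 (sub_nonneg.2 ht)]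
  have h4 : 1 - X ^ 2 ≤ 6.0006 * (t * S2) := by nlinarith
  have h5 : t * mass n t ≤ t * S1 - t * S2 + t * S3 / 3 := by
    have := mul_le_mul_of_nonneg_left hle ht0
    linarith
  have h6 : X - X ^ 2 / 2 + X ^ 3 / 9 ≥ 0 := by nlinarith [pow_pos hX0 3]
  nlinarith [pow_pos hX0 2]

theorem sum_mul_self_le (n : ℕ) (t : ℝ) :
    ∑ j ∈ Finset.range n, node j * weight t j ^ 2 ≤ 3 / 2 * mass n t ^ 2 := by
  have h : ∀ n : ℕ, (n : ℝ) * weight t n ≤ mass n t := by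
    intro n
    calc (n : ℝ) * weight t n = ∑ _j ∈ Finset.range n, weight t n := by simp
      _ ≤ _ := Finset.sum_le_sum fun j hj => weight_anti (Finset.mem_range.1 hj).le
  induction n with
  | zero => simp [mass]
  | succ n ih =>
    have hm : mass (n + 1) t = mass n t + weight t n := Finset.sum_range_succ _ _
    rw [Finset.sum_range_succ, hm, node]
    nlinarith [mul_le_mul_of_nonneg_right (h n) (weight_pos t n).le]

theorem moment_one_le {n : ℕ} {t : ℝ} (ht0 : 0 ≤ t) (ht : t ≤ 0.0045) :
    moment 1 n t ≤ 9.0003 * mass n t ^ 2 := by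
  have h := sum_succ_mul_le (n := n) (fun j => (weight_pos t j).le) (weight_mul_weight_le t)
  have h0 := weight_zero_lower ht0 ht
  have h1 : moment 1 n t ≤ 3 * ∑ j ∈ Finset.range n, (j + 1 : ℝ) * weight t j := by
    rw [moment, Finset.mul_sum]
    refine Finset.sum_le_sum fun j _ => ?_
    have := weight_pos t j
    rw [node]
    nlinarith
  have h2 : 0 ≤ ∑ j ∈ Finset.range n, (j + 1 : ℝ) * weight t j :=
    Finset.sum_nonneg fun j _ => mul_nonneg (by positivity) (weight_pos t j).le
  rw [mass]
  nlinarith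

theorem moment_two_le {n : ℕ} {t : ℝ} (ht0 : 0 ≤ t) (ht : t ≤ 0.0045) :
    moment 2 n t ≤ 162.1 * mass n t ^ 3 := by
  have h := sum_succ_mul_add_two_mul_le (n := n) (fun j => (weight_pos t j).le)
    (weight_mul_weight_le t)
  have h0 := weight_zero_lower ht0 ht
  have h1 : moment 2 n t ≤ 9 * ∑ j ∈ Finset.range n, (j + 1 : ℝ) * (j + 2) * weight t j := by
    rw [moment, Finset.mul_sum]
    refine Finset.sum_le_sum fun j _ => ?_
    have := weight_pos t j
    have hj : (0 : ℝ) ≤ j := Nat.cast_nonneg j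
    rw [← mul_assoc]
    refine mul_le_mul_of_nonneg_right ?_ this.le
    rw [node]
    nlinarith
  have h2 : 0 ≤ ∑ j ∈ Finset.range n, (j + 1 : ℝ) * (j + 2) * weight t j :=
    Finset.sum_nonneg fun j _ => mul_nonneg (by positivity) (weight_pos t j).le
  have h3 : 1 ≤ 9.0007 * weight t 0 ^ 2 := by nlinarith
  rw [mass]
  nlinarith

theorem mass_lower {n m : ℕ} {t : ℝ} (ht0 : 0 ≤ t) (ht : t ≤ 0.0045) (hm : 36500 ≤ m)
    (hs : ∑ j ∈ Finset.range n, node j * tilt t j = m) : 45 ≤ mass n t := by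
  have h1 := moment_one_le (n := n) ht0 ht
  have h2 := sum_mul_self_le n t
  have h3 : ∑ j ∈ Finset.range n, node j * tilt t j ≤
      moment 1 n t + 6 * ∑ j ∈ Finset.range n, node j * weight t j ^ 2 := by
    rw [moment, Finset.mul_sum, ← Finset.sum_add_distrib]
    refine Finset.sum_le_sum fun j _ => ?_
    have h4 : tilt t j ≤ weight t j + 6 * weight t j ^ 2 := by
      have hx := Real.exp_pos (-(node j * t))
      have hx1 : Real.exp (-(node j * t)) ≤ 1 :=
        Real.exp_le_one_iff.2 (by simpa using mul_nonneg (node_pos j).le ht0)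
      rw [tilt, weight_eq]
      set x := Real.exp (-(node j * t))
      rw [div_pow, ← mul_div_assoc, div_add_div _ _ (by positivity) (by positivity),
        div_le_div_iff₀ (by positivity) (by positivity)]
      have : 0 ≤ (2 - x - x ^ 2) * x ^ 2 * (1 + x + x ^ 2) ^ 2 :=
        mul_nonneg (mul_nonneg (by nlinarith) (by positivity)) (by positivity)
      nlinarith
    have := node_pos j
    nlinarith
  have hm' : (36500 : ℝ) ≤ m := by exact_mod_cast hm
  have := mass_nonneg n t
  nlinarith

theorem sum_range_node_sq (k : ℕ) :
    ∑ j ∈ Finset.range k, node j ^ 2 = 3 * (k : ℝ) ^ 3 - 3 / 4 * k := by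
  induction k with
  | zero => simp
  | succ k ih => rw [Finset.sum_range_succ, ih, node]; push_cast; ring

theorem moment_two_lower {n : ℕ} {t : ℝ} (hM : 45 ≤ mass n t) :
    26.99 * mass n t ^ 3 ≤ moment 2 n t := by
  set M := mass n t with hMdef
  set E := 9 * M with hE
  set k := ⌈(E - 3 / 2) / 3⌉₊ with hk
  have hlt : ∀ j : ℕ, j < k ↔ node j < E := by
    intro j
    rw [hk, Nat.lt_ceil, node, lt_div_iff₀ (by norm_num)]
    constructor <;> intro h <;> linarith
  have hk1 : (k : ℝ) < (E - 3 / 2) / 3 + 1 := Nat.ceil_lt_add_one (by linarith)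
  have h1 : E ^ 2 * M - moment 2 n t ≤ 1 / 3 * (k * E ^ 2 - (3 * (k : ℝ) ^ 3 - 3 / 4 * k)) := by
    calc E ^ 2 * M - moment 2 n t
        = ∑ j ∈ Finset.range n, (E ^ 2 - node j ^ 2) * weight t j := by
          rw [hMdef, mass, moment, Finset.mul_sum, ← Finset.sum_sub_distrib]
          exact Finset.sum_congr rfl fun j _ => by ring
      _ ≤ ∑ j ∈ Finset.range n, if j < k then 1 / 3 * (E ^ 2 - node j ^ 2) else 0 := by
          refine Finset.sum_le_sum fun j _ => ?_
          have hw := weight_le t j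
          have hw0 := weight_pos t j
          have hn := node_pos j
          split_ifs with h
          · have := (hlt j).1 h
            have : 0 ≤ E ^ 2 - node j ^ 2 := by nlinarith
            nlinarith
          · have := not_lt.1 (mt (hlt j).2 h)
            have : E ^ 2 - node j ^ 2 ≤ 0 := by nlinarith
            nlinarith
      _ = ∑ j ∈ Finset.range n with j < k, 1 / 3 * (E ^ 2 - node j ^ 2) :=
          (Finset.sum_filter _ _).symm
      _ ≤ ∑ j ∈ Finset.range k, 1 / 3 * (E ^ 2 - node j ^ 2) := by
          refine Finset.sum_le_sum_of_subset_of_nonneg (fun j hj => ?_) fun j hj _ => ?_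
          · exact Finset.mem_range.2 (Finset.mem_filter.1 hj).2
          · have := (hlt j).1 (Finset.mem_range.1 hj)
            have hn := node_pos j
            nlinarith
      _ = _ := by
          rw [← Finset.mul_sum, Finset.sum_sub_distrib, sum_range_node_sq]
          simp
  have h2 : k * E ^ 2 - 3 * (k : ℝ) ^ 3 ≤ 2 / 9 * E ^ 3 := by
    have hk0 : (0 : ℝ) ≤ k := Nat.cast_nonneg k
    nlinarith [mul_nonneg (show 0 ≤ 3 * (k : ℝ) + 2 * E by linarith) (sq_nonneg (3 * (k : ℝ) - E))]
  rw [hE] at h1 h2 hk1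
  nlinarith [pow_pos (show 0 < M by linarith) 3]

theorem moment_four_mul_le (n : ℕ) (t : ℝ) :
    moment 4 n t * mass n t ≤ 6 * moment 2 n t ^ 2 := by
  have h := fourth_moment_mul_le (n := n) (fun j => (weight_pos t j).le) (weight_mul_weight_le t)
  have h4 : moment 4 n t = 81 * ∑ j ∈ Finset.range n, (j + 1 / 2 : ℝ) ^ 4 * weight t j := by
    rw [moment, Finset.mul_sum]
    exact Finset.sum_congr rfl fun j _ => by rw [node]; ring
  have h2 : moment 2 n t = 9 * ∑ j ∈ Finset.range n, (j + 1 / 2 : ℝ) ^ 2 * weight t j := by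
    rw [moment, Finset.mul_sum]
    exact Finset.sum_congr rfl fun j _ => by rw [node]; ring
  rw [h4, h2]
  rw [← mass] at h
  linarith

theorem moment_three_sq_le (n : ℕ) (t : ℝ) : moment 3 n t ^ 2 ≤ moment 2 n t * moment 4 n t :=
  Finset.sum_sq_le_sum_mul_sum_of_sq_le_mul _
    (fun j _ => mul_nonneg (pow_nonneg (node_pos j).le _) (weight_pos t j).le)
    (fun j _ => mul_nonneg (pow_nonneg (node_pos j).le _) (weight_pos t j).le)
    fun j _ => le_of_eq (by ring)

theorem weight_mul_node_le (n : ℕ) (t : ℝ) {j : ℕ} (hj : j < n) :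
    weight t j * node j ≤ 3 * mass n t := by
  have h : ((j + 1 : ℕ) : ℝ) * weight t j ≤ mass n t := by
    calc ((j + 1 : ℕ) : ℝ) * weight t j = ∑ _i ∈ Finset.range (j + 1), weight t j := by simp
      _ ≤ ∑ i ∈ Finset.range (j + 1), weight t i := Finset.sum_le_sum fun i hi =>
          weight_anti (Nat.lt_succ_iff.1 (Finset.mem_range.1 hi))
      _ ≤ _ := Finset.sum_le_sum_of_subset_of_nonneg
          (Finset.range_mono (by omega)) fun i _ _ => (weight_pos t i).le
  have := weight_pos t j
  rw [node]
  push_cast at h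
  nlinarith

/-- The normalised factor `(1 + Z + Z²) / (1 + x + x²) · exp (-i H U)`, where `Z = x exp (i U)` and
`H = (x + 2x²) / (1 + x + x²)`. -/
noncomputable def normFactor (x U : ℝ) : ℂ :=
  (1 + x * Complex.exp (U * Complex.I) + (x * Complex.exp (U * Complex.I)) ^ 2) /
    ((1 + x + x ^ 2 : ℝ) : ℂ) *
    Complex.exp (-(((x + 2 * x ^ 2) / (1 + x + x ^ 2) * U : ℝ) : ℂ) * Complex.I)

theorem sq_norm_trinomial (x U : ℝ) :
    ‖1 + (x : ℂ) * Complex.exp (U * Complex.I) + (x * Complex.exp (U * Complex.I)) ^ 2‖ ^ 2 =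
      (1 + x + x ^ 2) ^ 2 -
        2 * x * (1 - Real.cos U) * ((1 + x + x ^ 2) + x * (1 + 2 * Real.cos U)) := by
  have h := Real.sin_sq_add_cos_sq U
  have hs : Real.sin U ^ 2 = 1 - Real.cos U ^ 2 := by linarith
  have e : (1 + (x : ℂ) * Complex.exp (U * Complex.I) + (x * Complex.exp (U * Complex.I)) ^ 2) =
      ((1 + x * Real.cos U + x ^ 2 * (2 * Real.cos U ^ 2 - 1) : ℝ) : ℂ) +
      ((x * Real.sin U + x ^ 2 * (2 * Real.cos U * Real.sin U) : ℝ) : ℂ) * Complex.I := by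
    rw [Complex.exp_mul_I]
    push_cast
    linear_combination (x : ℂ) ^ 2 * Complex.sin U ^ 2 * Complex.I_sq - (x : ℂ) ^ 2 * Complex.sin_sq U
  rw [e, Complex.sq_norm, Complex.normSq_add_mul_I]
  linear_combination (x ^ 2 + 4 * x ^ 3 * Real.cos U + 4 * x ^ 4 * Real.cos U ^ 2) * hs

theorem normFactor_mul (x U : ℝ) (hx : 0 ≤ x) :
    normFactor x U * ((1 + x + x ^ 2 : ℝ) : ℂ) =
      Complex.exp ((-((x + 2 * x ^ 2) / (1 + x + x ^ 2) * U) : ℝ) * Complex.I) +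
      x * Complex.exp ((U - (x + 2 * x ^ 2) / (1 + x + x ^ 2) * U : ℝ) * Complex.I) +
      (x ^ 2 : ℝ) * Complex.exp ((2 * U - (x + 2 * x ^ 2) / (1 + x + x ^ 2) * U : ℝ) * Complex.I) := by
  have hD : ((1 + x + x ^ 2 : ℝ) : ℂ) ≠ 0 := by
    exact_mod_cast (by positivity : (1 + x + x ^ 2 : ℝ) ≠ 0)
  rw [normFactor]
  set α := (x + 2 * x ^ 2) / (1 + x + x ^ 2) * U
  have h1 : Complex.exp ((U - α : ℝ) * Complex.I) =
      Complex.exp (U * Complex.I) * Complex.exp (-(α : ℂ) * Complex.I) := by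
    rw [← Complex.exp_add]; push_cast; ring_nf
  have h2 : Complex.exp ((2 * U - α : ℝ) * Complex.I) =
      Complex.exp (U * Complex.I) ^ 2 * Complex.exp (-(α : ℂ) * Complex.I) := by
    rw [← Complex.exp_nat_mul, ← Complex.exp_add]; push_cast; ring_nf
  rw [h1, h2]
  field_simp
  push_cast
  ring_nf

theorem normFactor_re_im (x U : ℝ) (hx : 0 ≤ x) :
    (normFactor x U).re * (1 + x + x ^ 2) =
      Real.cos ((x + 2 * x ^ 2) / (1 + x + x ^ 2) * U) +
      x * Real.cos (U - (x + 2 * x ^ 2) / (1 + x + x ^ 2) * U) +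
      x ^ 2 * Real.cos (2 * U - (x + 2 * x ^ 2) / (1 + x + x ^ 2) * U) ∧
    (normFactor x U).im * (1 + x + x ^ 2) =
      -Real.sin ((x + 2 * x ^ 2) / (1 + x + x ^ 2) * U) +
      x * Real.sin (U - (x + 2 * x ^ 2) / (1 + x + x ^ 2) * U) +
      x ^ 2 * Real.sin (2 * U - (x + 2 * x ^ 2) / (1 + x + x ^ 2) * U) := by
  have h := normFactor_mul x U hx
  constructor
  · have h' := congrArg Complex.re h
    rw [Complex.re_mul_ofReal] at h'
    rw [h', Complex.add_re, Complex.add_re, Complex.re_ofReal_mul, Complex.re_ofReal_mul,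
      Complex.exp_ofReal_mul_I_re, Complex.exp_ofReal_mul_I_re, Complex.exp_ofReal_mul_I_re,
      Real.cos_neg]
  · have h' := congrArg Complex.im h
    rw [Complex.im_mul_ofReal] at h'
    rw [h', Complex.add_im, Complex.add_im, Complex.im_ofReal_mul, Complex.im_ofReal_mul,
      Complex.exp_ofReal_mul_I_im, Complex.exp_ofReal_mul_I_im, Complex.exp_ofReal_mul_I_im,
      Real.sin_neg]

theorem normFactor_neg (x U : ℝ) : normFactor x (-U) = (starRingEnd ℂ) (normFactor x U) := by
  simp only [normFactor, map_mul, map_div₀, map_add, map_pow, map_one, Complex.conj_ofReal,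
    ← Complex.exp_conj, Complex.conj_I, map_neg]
  push_cast
  ring_nf

theorem sq_norm_normFactor (x U : ℝ) (hx : 0 ≤ x) :
    ‖normFactor x U‖ ^ 2 = 1 - 2 * (x / (1 + x + x ^ 2)) * (1 - Real.cos U) *
      (1 + x / (1 + x + x ^ 2) * (1 + 2 * Real.cos U)) := by
  have hD : 0 < 1 + x + x ^ 2 := by positivity
  have he : ‖Complex.exp (-(((x + 2 * x ^ 2) / (1 + x + x ^ 2) * U : ℝ) : ℂ) * Complex.I)‖ = 1 := by
    rw [← Complex.ofReal_neg, Complex.norm_exp_ofReal_mul_I]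
  rw [normFactor, norm_mul, he, mul_one, norm_div, div_pow, sq_norm_trinomial, Complex.norm_real,
    Real.norm_eq_abs, sq_abs]
  field_simp

theorem abs_sin_sub_self_le (w : ℝ) : |Real.sin w - w| ≤ |w| ^ 3 / 6 := by
  rcases le_total 0 w with h | h
  · have h1 := Real.sin_ge_sub_cube h
    have h2 := Real.sin_le h
    rw [abs_of_nonneg h, abs_of_nonpos (by linarith)]
    linarith
  · have h1 := Real.sin_ge_sub_cube (neg_nonneg.2 h)
    have h2 := Real.sin_le (neg_nonneg.2 h)
    rw [Real.sin_neg] at h1 h2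
    rw [abs_of_nonpos h, abs_of_nonneg (by linarith)]
    linarith

theorem abs_im_normFactor_le (x U : ℝ) (hx : 0 ≤ x) (hx1 : x ≤ 1) :
    |(normFactor x U).im| ≤ 1 / 3 * (x / (1 + x + x ^ 2)) * |U| ^ 3 := by
  have hD : 0 < 1 + x + x ^ 2 := by positivity
  have h := (normFactor_re_im x U hx).2
  set H := (x + 2 * x ^ 2) / (1 + x + x ^ 2) with hH
  have hHD : H * (1 + x + x ^ 2) = x + 2 * x ^ 2 := by rw [hH]; field_simp
  have hH0 : 0 ≤ H := by rw [hH]; positivity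
  have hH1 : H ≤ 1 := by rw [hH, div_le_one hD]; nlinarith
  have s1 := abs_le.1 (abs_sin_sub_self_le (H * U))
  have s2 := abs_le.1 (abs_sin_sub_self_le (U - H * U))
  have s3 := abs_le.1 (abs_sin_sub_self_le (2 * U - H * U))
  have e2 : U - H * U = (1 - H) * U := by ring
  have e3 : 2 * U - H * U = (2 - H) * U := by ring
  rw [abs_mul, abs_of_nonneg hH0, mul_pow] at s1
  rw [show |U - H * U| = (1 - H) * |U| by
    rw [e2, abs_mul, abs_of_nonneg (by linarith)], mul_pow] at s2
  rw [show |2 * U - H * U| = (2 - H) * |U| by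
    rw [e3, abs_mul, abs_of_nonneg (by linarith)], mul_pow] at s3
  have hzero : -(H * U) + x * (U - H * U) + x ^ 2 * (2 * U - H * U) = 0 := by
    linear_combination (-U) * hHD
  have hpoly : H ^ 3 + x * (1 - H) ^ 3 + x ^ 2 * (2 - H) ^ 3 ≤ 2 * x := by
    have e1 : 1 - H = (1 - x ^ 2) / (1 + x + x ^ 2) := by rw [hH]; field_simp; ring
    have e2 : 2 - H = (2 + x) / (1 + x + x ^ 2) := by rw [hH]; field_simp; ring
    rw [e1, e2, hH, div_pow, div_pow, div_pow, ← mul_div_assoc, ← mul_div_assoc, ← add_div,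
      ← add_div, div_le_iff₀ (by positivity)]
    have : 0 ≤ x * ((1 - x) ^ 2 * (1 + x ^ 2 + 4 * x ^ 3 + 3 * x ^ 4)) := by positivity
    linear_combination this
  have hU : 0 ≤ |U| ^ 3 := by positivity
  have hx2 : 0 ≤ x ^ 2 := by positivity
  have key : |(normFactor x U).im * (1 + x + x ^ 2)| ≤ 2 * x * |U| ^ 3 / 6 := by
    rw [h, abs_le]
    have := mul_le_mul_of_nonneg_right hpoly hU
    constructor
    · nlinarith [mul_le_mul_of_nonneg_left s2.1 hx, mul_le_mul_of_nonneg_left s3.1 hx2]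
    · nlinarith [mul_le_mul_of_nonneg_left s2.2 hx, mul_le_mul_of_nonneg_left s3.2 hx2]
  rw [abs_mul, abs_of_pos hD] at key
  rw [show 1 / 3 * (x / (1 + x + x ^ 2)) * |U| ^ 3 = (2 * x * |U| ^ 3 / 6) / (1 + x + x ^ 2) by
    field_simp; ring, le_div_iff₀ hD]
  exact key

theorem norm_normFactor_le_one (x U : ℝ) (hx : 0 ≤ x) : ‖normFactor x U‖ ≤ 1 := by
  have h := sq_norm_normFactor x U hx
  have hD : 0 < 1 + x + x ^ 2 := by positivity
  have hN : x / (1 + x + x ^ 2) ≤ 1 / 3 := by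
    rw [div_le_div_iff₀ hD (by norm_num)]; nlinarith [sq_nonneg (1 - x)]
  have hN0 : 0 ≤ x / (1 + x + x ^ 2) := by positivity
  set N := x / (1 + x + x ^ 2)
  have h1 := Real.cos_le_one U
  have h2 := Real.neg_one_le_cos U
  have : 0 ≤ 2 * N * (1 - Real.cos U) * (1 + N * (1 + 2 * Real.cos U)) :=
    mul_nonneg (mul_nonneg (by linarith) (by linarith)) (by nlinarith)
  nlinarith [norm_nonneg (normFactor x U)]

theorem exp_neg_le_one_sub {X : ℝ} (h0 : 0 ≤ X) (h : X ≤ 0.4) :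
    Real.exp (-X - 7 / 6 * X ^ 2) ≤ 1 - X := by
  have h1 : 1 + X + X ^ 2 / 2 + 7 / 6 * X ^ 2 ≤ Real.exp (X + 7 / 6 * X ^ 2) := by
    have h2 := Real.quadratic_le_exp_of_nonneg (x := X + 7 / 6 * X ^ 2) (by positivity)
    nlinarith [pow_nonneg h0 3, pow_nonneg h0 4]
  rw [show -X - 7 / 6 * X ^ 2 = -(X + 7 / 6 * X ^ 2) by ring, Real.exp_neg]
  rw [inv_le_iff_one_le_mul₀ (Real.exp_pos _)]
  have h3 : 0 ≤ 1 - X := by linarith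
  calc (1 : ℝ) ≤ (1 - X) * (1 + X + X ^ 2 / 2 + 7 / 6 * X ^ 2) := by
        nlinarith [mul_nonneg (sq_nonneg X) (sub_nonneg.2 h)]
    _ ≤ _ := by gcongr

/-- A lower bound for a single factor whose phase shift is moderate. -/
theorem sq_norm_normFactor_lower {x U : ℝ} (hx : 0 ≤ x)
    (hU : x / (1 + x + x ^ 2) * |U| ≤ 0.1723) :
    0.6 ≤ ‖normFactor x U‖ ^ 2 ∧
    Real.exp (-(2 * (x / (1 + x + x ^ 2)) * U ^ 2) - 14 / 9 * (x / (1 + x + x ^ 2)) * U ^ 4) ≤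
      ‖normFactor x U‖ ^ 2 := by
  have h := sq_norm_normFactor x U hx
  have hD : 0 < 1 + x + x ^ 2 := by positivity
  have hN : x / (1 + x + x ^ 2) ≤ 1 / 3 := by
    rw [div_le_div_iff₀ hD (by norm_num)]; nlinarith [sq_nonneg (1 - x)]
  have hN0 : 0 ≤ x / (1 + x + x ^ 2) := by positivity
  set N := x / (1 + x + x ^ 2)
  set c := Real.cos U
  have h1 : c ≤ 1 := Real.cos_le_one U
  have h2 : -1 ≤ c := Real.neg_one_le_cos U
  have h3 : 1 - U ^ 2 / 2 ≤ c := Real.one_sub_sq_div_two_le_cos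
  set X := 2 * N * (1 - c) * (1 + N * (1 + 2 * c)) with hX
  have hX0 : 0 ≤ X := mul_nonneg (mul_nonneg (by linarith) (by linarith)) (by nlinarith)
  have hXU : X ≤ 2 * N * U ^ 2 := by
    have e1 : 1 + N * (1 + 2 * c) ≤ 2 := by nlinarith
    have e2 : 0 ≤ 2 * N * (1 - c) := mul_nonneg (by linarith) (by linarith)
    nlinarith [mul_le_mul_of_nonneg_left e1 e2]
  have hX4 : X ≤ 0.4 := by
    rcases le_total N 0.1 with hN1 | hN1
    · have : X ≤ 4 * N := by
        rw [hX]
        nlinarith [mul_nonneg hN0 (sub_nonneg.2 h1), mul_nonneg hN0 (sub_nonneg.2 h2),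
          mul_nonneg (mul_nonneg hN0 (sub_nonneg.2 h2)) (sub_nonneg.2 hN1),
          mul_nonneg (mul_nonneg (mul_nonneg hN0 hN0) (sub_nonneg.2 h1)) (sub_nonneg.2 h2)]
      linarith
    · have hNU : (N * |U|) ^ 2 ≤ 0.1723 ^ 2 := by gcongr
      rw [mul_pow, sq_abs] at hNU
      have hU2 : U ^ 2 ≤ 2.97 := by nlinarith [sq_nonneg U]
      have e1 : 2 * N * (1 - c) ≤ N * U ^ 2 := by nlinarith
      have e2 : 1 + N * (1 + 2 * c) ≤ 1 + 3 * N := by nlinarith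
      have e3 : 0 ≤ 2 * N * (1 - c) := mul_nonneg (by linarith) (by linarith)
      have e4 : X ≤ N * U ^ 2 * (1 + 3 * N) := by
        rw [hX]
        exact mul_le_mul e1 e2 (by nlinarith) (by positivity)
      nlinarith [sq_nonneg U]
  refine ⟨by linarith, ?_⟩
  rw [h]
  refine le_trans (Real.exp_le_exp.2 ?_) (exp_neg_le_one_sub hX0 hX4)
  have hX2 : X ^ 2 ≤ 4 / 3 * N * U ^ 4 := by
    have : X ^ 2 ≤ (2 * N * U ^ 2) ^ 2 := by gcongr
    have h4 : 0 ≤ N * U ^ 4 := by positivity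
    nlinarith
  linarith

theorem sq_norm_div_norm_sub_one {q : ℂ} (hq : q ≠ 0) :
    ‖q / (‖q‖ : ℂ) - 1‖ ^ 2 * ‖q‖ = 2 * (‖q‖ - q.re) := by
  have hr : 0 < ‖q‖ := norm_pos_iff.2 hq
  have h : ‖q‖ ^ 2 = q.re ^ 2 + q.im ^ 2 := by rw [Complex.sq_norm, Complex.normSq_apply]; ring
  rw [Complex.sq_norm, Complex.normSq_apply]
  simp only [Complex.sub_re, Complex.sub_im, Complex.div_ofReal_re, Complex.div_ofReal_im,
    Complex.one_re, Complex.one_im, sub_zero]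
  field_simp
  linear_combination -h

theorem norm_normFactor_div_norm_sub_one_le {x U : ℝ} (hx : 0 ≤ x) (hx1 : x ≤ 1)
    (hU : x / (1 + x + x ^ 2) * |U| ≤ 0.1723) :
    ‖normFactor x U / (‖normFactor x U‖ : ℂ) - 1‖ ≤ 0.45 * (x / (1 + x + x ^ 2)) * |U| ^ 3 := by
  have hD : 0 < 1 + x + x ^ 2 := by positivity
  have hlow := (sq_norm_normFactor_lower hx hU).1
  have him := abs_im_normFactor_le x U hx hx1
  have hre := (normFactor_re_im x U hx).1
  have hN0 : 0 ≤ x / (1 + x + x ^ 2) := by positivity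
  have hH : (x + 2 * x ^ 2) / (1 + x + x ^ 2) = (1 + 2 * x) * (x / (1 + x + x ^ 2)) := by
    field_simp
  have hND : x / (1 + x + x ^ 2) * (1 + x + x ^ 2) = x := by field_simp
  rw [hH] at hre
  set N := x / (1 + x + x ^ 2) with hN
  set q := normFactor x U
  set α := (1 + 2 * x) * N * U with hα
  have habs : |α| = (1 + 2 * x) * (N * |U|) := by
    rw [hα, abs_mul, abs_mul, abs_of_nonneg hN0, abs_of_nonneg (by linarith)]; ring
  have hr0 : 0 ≤ ‖q‖ := norm_nonneg q
  have hr : 0.77 ≤ ‖q‖ := by nlinarith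
  have hsq : ‖q‖ ^ 2 = q.re ^ 2 + q.im ^ 2 := by rw [Complex.sq_norm, Complex.normSq_apply]; ring
  have hU0 := abs_nonneg U
  have hre1 : 1 - |α| ^ 2 / 2 - |α| ≤ q.re := by
    have c0 := Real.one_sub_sq_div_two_le_cos (x := α)
    have c1 := (abs_le.1 (Real.abs_cos_sub_cos_le (U - α) (-α))).1
    have c2 := (abs_le.1 (Real.abs_cos_sub_cos_le (2 * U - α) (-α))).1
    rw [Real.cos_neg, show U - α - -α = U by ring] at c1
    rw [Real.cos_neg, show 2 * U - α - -α = 2 * U by ring, abs_mul, abs_two] at c2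
    rw [sq_abs]
    have h1 : (1 - α ^ 2 / 2 - |α|) * (1 + x + x ^ 2) ≤ q.re * (1 + x + x ^ 2) := by
      rw [hre]
      have h2 : |α| * (1 + x + x ^ 2) = (x + 2 * x ^ 2) * |U| := by
        rw [habs]; linear_combination ((1 + 2 * x) * |U|) * hND
      nlinarith [mul_le_mul_of_nonneg_left c1 hx, mul_le_mul_of_nonneg_left c2 (sq_nonneg x),
        mul_le_mul_of_nonneg_right c0 hD.le]
    exact le_of_mul_le_mul_right h1 hD
  have hα0 := abs_nonneg α
  have hR : 0.7 ≤ q.re := by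
    rcases le_total |U| 1 with h | h
    · have hα1 : |α| ≤ 0.52 := by rw [habs]; nlinarith
      have hα2 : |α| ^ 2 ≤ 0.52 ^ 2 := pow_le_pow_left₀ hα0 hα1 2
      have hpos : 0 ≤ q.re := by linarith
      have h2 : N * |U| ^ 3 ≤ 0.1723 := by
        have : N * |U| ^ 3 ≤ N * |U| := by
          refine mul_le_mul_of_nonneg_left ?_ hN0
          calc |U| ^ 3 ≤ |U| ^ 1 := pow_le_pow_of_le_one hU0 h (by norm_num)
            _ = |U| := pow_one _
        linarith
      have h3 : q.im ^ 2 ≤ 0.06 ^ 2 := by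
        rw [← sq_abs]
        gcongr
        linarith
      nlinarith
    · have hN2 : N ≤ 0.1723 := by nlinarith
      have hx2 : x ≤ 0.23 := by
        rw [hN, div_le_iff₀ hD] at hN2
        nlinarith
      have hα1 : |α| ≤ 0.252 := by rw [habs]; nlinarith
      have hα2 : |α| ^ 2 ≤ 0.252 ^ 2 := pow_le_pow_left₀ hα0 hα1 2
      linarith
  have hq : q ≠ 0 := norm_pos_iff.1 (by linarith)
  have key := sq_norm_div_norm_sub_one hq
  have hb : q.im ^ 2 ≤ (1 / 3 * N * |U| ^ 3) ^ 2 := by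
    rw [← sq_abs]
    gcongr
  refine abs_le_of_sq_le_sq' ?_ (by positivity) |>.2
  have h5 : ‖q / (‖q‖ : ℂ) - 1‖ ^ 2 * (‖q‖ * (‖q‖ + q.re)) = 2 * q.im ^ 2 := by
    linear_combination (‖q‖ + q.re) * key + 2 * hsq
  have h6 : 1.1 ≤ ‖q‖ * (‖q‖ + q.re) := by
    have : 0.77 * 0.7 ≤ ‖q‖ * q.re := mul_le_mul hr hR (by norm_num) hr0
    linarith
  have h7 := mul_le_mul_of_nonneg_left h6 (sq_nonneg ‖q / (‖q‖ : ℂ) - 1‖)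
  have h8 : 0 ≤ (N * |U| ^ 3) ^ 2 := sq_nonneg _
  rw [h5] at h7
  linarith

/-- The ratio `Z / (1 + Z + Z²)` for `Z = x exp (i U)`. -/
noncomputable def ratioFactor (x U : ℝ) : ℂ :=
  x * Complex.exp (U * Complex.I) /
    (1 + x * Complex.exp (U * Complex.I) + (x * Complex.exp (U * Complex.I)) ^ 2)

theorem norm_trinomial (x U : ℝ) (hx : 0 ≤ x) :
    ‖1 + (x : ℂ) * Complex.exp (U * Complex.I) + (x * Complex.exp (U * Complex.I)) ^ 2‖ =
      ‖normFactor x U‖ * (1 + x + x ^ 2) := by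
  have hD : 0 < 1 + x + x ^ 2 := by positivity
  have he : ‖Complex.exp (-(((x + 2 * x ^ 2) / (1 + x + x ^ 2) * U : ℝ) : ℂ) * Complex.I)‖ = 1 := by
    rw [← Complex.ofReal_neg, Complex.norm_exp_ofReal_mul_I]
  rw [normFactor, norm_mul, he, mul_one, norm_div, Complex.norm_real, Real.norm_eq_abs,
    abs_of_pos hD]
  field_simp

theorem norm_ratioFactor_le {x U : ℝ} (hx : 0 ≤ x)
    (hU : x / (1 + x + x ^ 2) * |U| ≤ 0.1723) :
    ‖ratioFactor x U‖ ≤ 1.292 * (x / (1 + x + x ^ 2)) := by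
  have hD : 0 < 1 + x + x ^ 2 := by positivity
  have hlow := (sq_norm_normFactor_lower hx hU).1
  have hr : 0.774 ≤ ‖normFactor x U‖ := by nlinarith [norm_nonneg (normFactor x U)]
  rw [ratioFactor, norm_div, norm_trinomial x U hx, norm_mul, Complex.norm_exp_ofReal_mul_I,
    Complex.norm_real, Real.norm_eq_abs, abs_of_nonneg hx, mul_one, ← mul_div_assoc,
    div_le_div_iff₀ (by positivity) hD]
  have : 0 ≤ x * (1 + x + x ^ 2) := by positivity
  nlinarith

theorem norm_ratioFactor_sub_le {x U : ℝ} (hx : 0 < x)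
    (hU : x / (1 + x + x ^ 2) * |U| ≤ 0.1723) :
    ‖ratioFactor x U - ((x / (1 + x + x ^ 2) : ℝ) : ℂ)‖ ≤ ‖ratioFactor x U‖ * |U| := by
  have hD : 0 < 1 + x + x ^ 2 := by positivity
  have hlow := (sq_norm_normFactor_lower hx.le hU).1
  have hT := norm_trinomial x U hx.le
  have hT0 : 1 + (x : ℂ) * Complex.exp (U * Complex.I) + (x * Complex.exp (U * Complex.I)) ^ 2 ≠ 0 := by
    intro h
    rw [h, norm_zero] at hT
    have : ‖normFactor x U‖ = 0 := by
      rcases mul_eq_zero.1 hT.symm with h | h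
      · exact h
      · linarith
    rw [this] at hlow
    norm_num at hlow
  set w := Complex.exp (U * Complex.I) with hw
  have hw1 : ‖w‖ = 1 := Complex.norm_exp_ofReal_mul_I U
  have hwU : ‖w - 1‖ ≤ |U| := by
    have := Real.norm_exp_I_mul_ofReal_sub_one_le (x := U)
    rwa [mul_comm, Real.norm_eq_abs] at this
  have hDc : ((1 + x + x ^ 2 : ℝ) : ℂ) ≠ 0 := by exact_mod_cast hD.ne'
  have key : ratioFactor x U - ((x / (1 + x + x ^ 2) : ℝ) : ℂ) =
      ratioFactor x U * ((w - 1) * (w⁻¹ - x ^ 2) / ((1 + x + x ^ 2 : ℝ) : ℂ)) := by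
    have hw0 : w ≠ 0 := Complex.exp_ne_zero _
    have hDc' : (1 + x + x ^ 2 : ℂ) ≠ 0 := by exact_mod_cast hD.ne'
    have hr : ratioFactor x U * (1 + (x : ℂ) * w + (x * w) ^ 2) = x * w := by
      rw [ratioFactor, ← hw, div_mul_cancel₀ _ hT0]
    have hw2 : w * w⁻¹ = 1 := mul_inv_cancel₀ hw0
    push_cast
    field_simp
    linear_combination hr
  rw [key, norm_mul]
  refine mul_le_mul_of_nonneg_left ?_ (norm_nonneg _)
  rw [norm_div, norm_mul, Complex.norm_real, Real.norm_eq_abs, abs_of_pos hD, div_le_iff₀ hD]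
  have h2 : ‖w⁻¹ - (x : ℂ) ^ 2‖ ≤ 1 + x ^ 2 := by
    calc _ ≤ ‖w⁻¹‖ + ‖(x : ℂ) ^ 2‖ := norm_sub_le _ _
      _ = 1 + x ^ 2 := by
        rw [norm_inv, hw1, norm_pow, Complex.norm_real, Real.norm_eq_abs, sq_abs]; norm_num
  calc ‖w - 1‖ * ‖w⁻¹ - (x : ℂ) ^ 2‖ ≤ |U| * (1 + x ^ 2) := by gcongr
    _ ≤ |U| * (1 + x + x ^ 2) := by gcongr; linarith

/-- The middle coefficient `2 cosh ((-t + iφ)/2 + iπ/3)`. -/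
noncomputable def midCoeff (t φ : ℝ) : ℂ :=
  ((Real.cosh (t / 2) * (Real.cos (φ / 2) - √3 * Real.sin (φ / 2)) : ℝ) : ℂ) -
    ((Real.sinh (t / 2) * (Real.sin (φ / 2) + √3 * Real.cos (φ / 2)) : ℝ) : ℂ) * Complex.I

theorem sqrt_three_bounds : 1.732 ≤ √3 ∧ √3 ≤ 1.7321 := by
  constructor
  · exact Real.le_sqrt_of_sq_le (by norm_num)
  · exact Real.sqrt_le_iff.2 ⟨by norm_num, by norm_num⟩

theorem cosh_le_one_add_sq {u : ℝ} (hu : u ^ 2 ≤ 1) : Real.cosh u ≤ 1 + u ^ 2 := by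
  refine (Real.cosh_le_exp_half_sq u).trans ?_
  have h5 := Real.exp_bound_div_one_sub_of_interval (x := u ^ 2 / 2) (by positivity) (by linarith)
  refine h5.trans ?_
  rw [div_le_iff₀ (by linarith)]
  nlinarith [sq_nonneg u]

theorem cosh_half_le {t : ℝ} (ht0 : 0 ≤ t) (ht : t ≤ 0.0045) :
    Real.cosh (t / 2) ≤ 1 + 0.0012 * t := by
  have h := cosh_le_one_add_sq (u := t / 2) (by nlinarith)
  nlinarith

theorem sinh_half_le {t : ℝ} (ht0 : 0 ≤ t) (ht : t ≤ 0.0045) :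
    Real.sinh (t / 2) ≤ 0.500005 * t := by
  have h := sinh_le_of_abs_le (u := t / 2) (by linarith) (by linarith)
  have h2 : t ^ 2 ≤ 0.0045 ^ 2 := pow_le_pow_left₀ ht0 ht 2
  nlinarith [mul_le_mul_of_nonneg_left h2 ht0]

theorem norm_midCoeff_sub_le {t φ : ℝ} (ht0 : 0 ≤ t) (ht : t ≤ 0.0045) (hφ : |φ| ≤ 0.002) :
    ‖midCoeff t φ - midCoeff t 0‖ ≤ 0.87 * |φ| := by
  obtain ⟨h3l, h3u⟩ := sqrt_three_bounds
  have hC := cosh_half_le ht0 ht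
  have hS := sinh_half_le ht0 ht
  have hC0 := Real.cosh_pos (t / 2)
  have hS0 : 0 ≤ Real.sinh (t / 2) := Real.sinh_nonneg_iff.2 (by linarith)
  have e : midCoeff t φ - midCoeff t 0 =
      ((Real.cosh (t / 2) * ((Real.cos (φ / 2) - 1) - √3 * Real.sin (φ / 2)) : ℝ) : ℂ) +
      ((-(Real.sinh (t / 2) * (Real.sin (φ / 2) + √3 * (Real.cos (φ / 2) - 1))) : ℝ) : ℂ) *
        Complex.I := by
    simp only [midCoeff, zero_div, Real.cos_zero, Real.sin_zero]
    push_cast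
    ring
  have hs : |Real.sin (φ / 2)| ≤ |φ| / 2 := by
    have := Real.abs_sin_le_abs (x := φ / 2)
    rwa [abs_div, abs_two] at this
  have hc : |Real.cos (φ / 2) - 1| ≤ 0.00025 * |φ| := by
    have h1 := Real.one_sub_sq_div_two_le_cos (x := φ / 2)
    have h2 := Real.cos_le_one (φ / 2)
    rw [abs_of_nonpos (by linarith)]
    have : φ ^ 2 ≤ 0.002 * |φ| := by
      rw [← sq_abs]; nlinarith [abs_nonneg φ]
    linarith
  rw [e]
  refine (norm_add_le _ _).trans ?_
  rw [norm_mul, Complex.norm_I, mul_one, Complex.norm_real, Complex.norm_real, Real.norm_eq_abs,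
    Real.norm_eq_abs, abs_neg, abs_mul, abs_mul, abs_of_pos hC0, abs_of_nonneg hS0]
  have hφ0 := abs_nonneg φ
  have h1 : |Real.cos (φ / 2) - 1 - √3 * Real.sin (φ / 2)| ≤ 0.867 * |φ| := by
    refine (abs_sub _ _).trans ?_
    rw [abs_mul, abs_of_nonneg (by linarith : 0 ≤ √3)]
    have : √3 * |Real.sin (φ / 2)| ≤ 1.7321 * (|φ| / 2) := by gcongr
    linarith
  have h2 : |Real.sin (φ / 2) + √3 * (Real.cos (φ / 2) - 1)| ≤ |φ| := by
    refine (abs_add_le _ _).trans ?_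
    rw [abs_mul, abs_of_nonneg (by linarith : 0 ≤ √3)]
    have : √3 * |Real.cos (φ / 2) - 1| ≤ 1.7321 * (0.00025 * |φ|) := by gcongr
    linarith
  have h3 : Real.cosh (t / 2) * |Real.cos (φ / 2) - 1 - √3 * Real.sin (φ / 2)| ≤
      1.00001 * (0.867 * |φ|) := by
    gcongr
    linarith
  have h4 : Real.sinh (t / 2) * |Real.sin (φ / 2) + √3 * (Real.cos (φ / 2) - 1)| ≤
      0.0023 * |φ| := by
    gcongr
    linarith
  linarith

theorem midCoeff_zero (t : ℝ) : midCoeff t 0 =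
    (Real.cosh (t / 2) : ℂ) - ((Real.sinh (t / 2) * √3 : ℝ) : ℂ) * Complex.I := by
  simp [midCoeff]

theorem norm_midCoeff_zero_sub_one_le {t : ℝ} (ht0 : 0 ≤ t) (ht : t ≤ 0.0045) :
    ‖midCoeff t 0 - 1‖ ≤ 0.87 * t := by
  obtain ⟨h3l, h3u⟩ := sqrt_three_bounds
  have hC := cosh_half_le ht0 ht
  have hS := sinh_half_le ht0 ht
  have hC1 := Real.one_le_cosh (t / 2)
  have hS0 : 0 ≤ Real.sinh (t / 2) := Real.sinh_nonneg_iff.2 (by linarith)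
  have e : midCoeff t 0 - 1 = ((Real.cosh (t / 2) - 1 : ℝ) : ℂ) -
      ((Real.sinh (t / 2) * √3 : ℝ) : ℂ) * Complex.I := by
    rw [midCoeff_zero]; push_cast; ring
  rw [e]
  refine (norm_sub_le _ _).trans ?_
  rw [norm_mul, Complex.norm_I, mul_one, Complex.norm_real, Complex.norm_real, Real.norm_eq_abs,
    Real.norm_eq_abs, abs_of_nonneg (by linarith), abs_of_nonneg (by positivity)]
  have : Real.sinh (t / 2) * √3 ≤ 0.500005 * t * 1.7321 := by gcongr
  linarith

/-- The point `exp (-t node j) exp (i φ node j)`. -/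
noncomputable def point (t φ : ℝ) (j : ℕ) : ℂ :=
  (Real.exp (-(node j * t)) : ℂ) * Complex.exp ((node j * φ : ℝ) * Complex.I)

/-- The value of the Borwein polynomial at `exp (-t + i(2π/3 + φ))`, as a product of trinomials. -/
noncomputable def circleValue (n : ℕ) (t φ : ℝ) : ℂ :=
  ∏ j ∈ Finset.range n, (1 + midCoeff t φ * point t φ j + point t φ j ^ 2)

/-- The product of the symmetric parts, normalised by value and phase at `φ = 0`. -/
noncomputable def symPart (n : ℕ) (t φ : ℝ) : ℂ :=
  ∏ j ∈ Finset.range n, normFactor (Real.exp (-(node j * t))) (node j * φ)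

/-- The product of the corrections due to the middle coefficient. -/
noncomputable def corrPart (n : ℕ) (t φ : ℝ) : ℂ :=
  ∏ j ∈ Finset.range n,
    (1 + (midCoeff t φ - 1) * ratioFactor (Real.exp (-(node j * t))) (node j * φ))

theorem ratioFactor_zero (x : ℝ) : ratioFactor x 0 = ((x / (1 + x + x ^ 2) : ℝ) : ℂ) := by
  simp [ratioFactor]

theorem normFactor_zero (x : ℝ) (hx : 0 ≤ x) : normFactor x 0 = 1 := by
  have hD : (1 + x + x ^ 2 : ℂ) ≠ 0 := by
    exact_mod_cast (by positivity : (1 + x + x ^ 2 : ℝ) ≠ 0)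
  simp [normFactor, hD]

theorem factor_eq (τ : ℂ) {x U : ℝ} (hx : 0 ≤ x) (hU : x / (1 + x + x ^ 2) * |U| ≤ 0.1723) :
    (1 + τ * (x * Complex.exp (U * Complex.I)) + (x * Complex.exp (U * Complex.I)) ^ 2) *
      Complex.exp (-(((x + 2 * x ^ 2) / (1 + x + x ^ 2) * U : ℝ) : ℂ) * Complex.I) =
    ((1 + x + x ^ 2 : ℝ) : ℂ) * normFactor x U * (1 + (τ - 1) * ratioFactor x U) := by
  have hD : 0 < 1 + x + x ^ 2 := by positivity
  have hlow := (sq_norm_normFactor_lower hx hU).1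
  have hT := norm_trinomial x U hx
  have hT0 : 1 + (x : ℂ) * Complex.exp (U * Complex.I) + (x * Complex.exp (U * Complex.I)) ^ 2 ≠ 0 := by
    rw [← norm_ne_zero_iff, hT]
    have : 0 < ‖normFactor x U‖ := by
      by_contra! h
      nlinarith [norm_nonneg (normFactor x U)]
    positivity
  have hDc : ((1 + x + x ^ 2 : ℝ) : ℂ) ≠ 0 := by exact_mod_cast hD.ne'
  rw [normFactor, ratioFactor]
  generalize (x : ℂ) * Complex.exp (U * Complex.I) = Z at *
  generalize Complex.exp (-(((x + 2 * x ^ 2) / (1 + x + x ^ 2) * U : ℝ) : ℂ) * Complex.I) = E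
  field_simp
  ring

theorem exp_div_mul_abs_le {n : ℕ} {t φ : ℝ} (h : 3 * mass n t * |φ| ≤ 0.1723) {j : ℕ}
    (hj : j < n) : Real.exp (-(node j * t)) / (1 + Real.exp (-(node j * t)) +
      Real.exp (-(node j * t)) ^ 2) * |node j * φ| ≤ 0.1723 := by
  rw [← weight_eq, abs_mul, abs_of_pos (node_pos j), ← mul_assoc]
  exact (mul_le_mul_of_nonneg_right (weight_mul_node_le n t hj) (abs_nonneg φ)).trans h

theorem circleValue_mul_exp {n : ℕ} {m t φ : ℝ} (hφ : 3 * mass n t * |φ| ≤ 0.1723)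
    (hm : ∑ j ∈ Finset.range n, node j * tilt t j = m) :
    circleValue n t φ * Complex.exp (-((m * φ : ℝ) : ℂ) * Complex.I) =
      ((∏ j ∈ Finset.range n, (1 + Real.exp (-(node j * t)) + Real.exp (-(node j * t)) ^ 2) : ℝ) : ℂ) *
        symPart n t φ * corrPart n t φ := by
  have he : Complex.exp (-((m * φ : ℝ) : ℂ) * Complex.I) =
      ∏ j ∈ Finset.range n, Complex.exp (-((tilt t j * (node j * φ) : ℝ) : ℂ) * Complex.I) := by
    rw [← Complex.exp_sum, ← Finset.sum_mul, ← hm]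
    congr 2
    rw [Finset.sum_neg_distrib, Finset.sum_mul]
    push_cast
    congr 1
    exact Finset.sum_congr rfl fun j _ => by ring
  rw [he, circleValue, symPart, corrPart, Complex.ofReal_prod, ← Finset.prod_mul_distrib,
    ← Finset.prod_mul_distrib, ← Finset.prod_mul_distrib]
  refine Finset.prod_congr rfl fun j hj => ?_
  exact factor_eq (midCoeff t φ) (Real.exp_pos _).le
    (exp_div_mul_abs_le hφ (Finset.mem_range.1 hj))

theorem circleValue_zero (n : ℕ) (t : ℝ) : circleValue n t 0 =
    ((∏ j ∈ Finset.range n, (1 + Real.exp (-(node j * t)) + Real.exp (-(node j * t)) ^ 2) : ℝ) : ℂ) *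
      corrPart n t 0 := by
  rw [circleValue, corrPart, Complex.ofReal_prod, ← Finset.prod_mul_distrib]
  refine Finset.prod_congr rfl fun j _ => ?_
  have h := factor_eq (midCoeff t 0) (x := Real.exp (-(node j * t))) (U := 0) (Real.exp_pos _).le
    (by simp; norm_num)
  rw [normFactor_zero _ (Real.exp_pos _).le] at h
  simpa [point] using h

theorem corrPart_zero (n : ℕ) (t : ℝ) : corrPart n t 0 =
    ∏ j ∈ Finset.range n, (1 + (midCoeff t 0 - 1) * (weight t j : ℂ)) := by
  refine Finset.prod_congr rfl fun j _ => ?_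
  rw [mul_zero, ratioFactor_zero, weight_eq]

theorem one_le_re_factor (t : ℝ) (j : ℕ) :
    1 ≤ (1 + (midCoeff t 0 - 1) * (weight t j : ℂ)).re := by
  have := Real.one_le_cosh (t / 2)
  have hw := weight_pos t j
  rw [midCoeff_zero]
  simp [-Complex.ofReal_cosh, -Complex.ofReal_sinh]
  nlinarith

theorem one_le_norm_factor (t : ℝ) (j : ℕ) : 1 ≤ ‖1 + (midCoeff t 0 - 1) * (weight t j : ℂ)‖ :=
  (one_le_re_factor t j).trans (Complex.re_le_norm _)

theorem corrPart_zero_ne (n : ℕ) (t : ℝ) : corrPart n t 0 ≠ 0 := by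
  rw [corrPart_zero, Finset.prod_ne_zero_iff]
  intro j _
  exact norm_pos_iff.1 (by linarith [one_le_norm_factor t j])

theorem norm_corrPart_div_sub_one_le {n : ℕ} {t φ : ℝ} (ht0 : 0 ≤ t) (ht : t ≤ 0.0045)
    (hφ1 : |φ| ≤ 0.002) (hφ : 3 * mass n t * |φ| ≤ 0.1723) :
    ‖corrPart n t φ / corrPart n t 0 - 1‖ ≤ Real.exp (3.2 * mass n t * |φ|) - 1 := by
  set a : ℕ → ℂ := fun j =>
    1 + (midCoeff t φ - 1) * ratioFactor (Real.exp (-(node j * t))) (node j * φ) with ha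
  set b : ℕ → ℂ := fun j => 1 + (midCoeff t 0 - 1) * (weight t j : ℂ) with hb
  have hb1 : ∀ j, 1 ≤ ‖b j‖ := one_le_norm_factor t
  have e : corrPart n t φ / corrPart n t 0 = ∏ j ∈ Finset.range n, (1 + (a j - b j) / b j) := by
    rw [corrPart_zero, corrPart, ← Finset.prod_div_distrib]
    refine Finset.prod_congr rfl fun j _ => ?_
    have : b j ≠ 0 := norm_pos_iff.1 (by linarith [hb1 j])
    change a j / b j = _
    field_simp
    ring
  rw [e]
  refine (Finset.norm_prod_one_add_sub_one_le _ _).trans ?_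
  gcongr
  have hterm : ∀ j ∈ Finset.range n, ‖(a j - b j) / b j‖ ≤
      1.12405 * |φ| * weight t j + 1.12405 * t * |φ| * (node j ^ 1 * weight t j) := by
    intro j hj
    have hU := exp_div_mul_abs_le hφ (Finset.mem_range.1 hj)
    have hr := norm_ratioFactor_le (Real.exp_pos _).le hU
    have hr2 := norm_ratioFactor_sub_le (Real.exp_pos _) hU
    rw [← weight_eq] at hr hr2
    set r := ratioFactor (Real.exp (-(node j * t))) (node j * φ)
    have hw := weight_pos t j
    have hn := node_pos j
    have e2 : a j - b j = (midCoeff t φ - midCoeff t 0) * r +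
        (midCoeff t 0 - 1) * (r - (weight t j : ℂ)) := by
      simp only [ha, hb]; ring
    have h1 := norm_midCoeff_sub_le ht0 ht hφ1
    have h2 := norm_midCoeff_zero_sub_one_le ht0 ht
    rw [abs_mul, abs_of_pos hn] at hr2
    have h3 : ‖a j - b j‖ ≤ 0.87 * |φ| * (1.292 * weight t j) +
        0.87 * t * (1.292 * weight t j * (node j * |φ|)) := by
      rw [e2]
      refine (norm_add_le _ _).trans ?_
      rw [norm_mul, norm_mul]
      have := hr2.trans (mul_le_mul_of_nonneg_right hr (by positivity : 0 ≤ node j * |φ|))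
      gcongr
    rw [norm_div]
    refine (div_le_self (norm_nonneg _) (hb1 j)).trans (h3.trans ?_)
    have : 0 ≤ |φ| * weight t j := by positivity
    have : 0 ≤ t * |φ| * (node j * weight t j) := by positivity
    rw [pow_one]
    nlinarith
  refine (Finset.sum_le_sum hterm).trans ?_
  rw [Finset.sum_add_distrib, ← Finset.mul_sum, ← Finset.mul_sum, ← mass, ← moment]
  have h1 := moment_one_le (n := n) ht0 ht
  have h2 := mul_mass_le (n := n) ht0 ht
  have h3 := mass_nonneg n t
  have h4 : t * moment 1 n t ≤ 1.8339 * mass n t := by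
    have := mul_le_mul_of_nonneg_left h1 ht0
    nlinarith
  have h5 := mul_le_mul_of_nonneg_right h4 (abs_nonneg φ)
  have h6 : 0 ≤ mass n t * |φ| := by positivity
  linarith

theorem norm_prod_sub_one_le_sum {ι : Type*} (s : Finset ι) (f : ι → ℂ) (h : ∀ i ∈ s, ‖f i‖ ≤ 1) :
    ‖∏ i ∈ s, f i - 1‖ ≤ ∑ i ∈ s, ‖f i - 1‖ := by
  classical
  induction s using Finset.induction_on with
  | empty => simp
  | insert a s ha ih =>
    rw [Finset.prod_insert ha, Finset.sum_insert ha]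
    have h1 := ih fun i hi => h i (Finset.mem_insert_of_mem hi)
    have h2 := h a (Finset.mem_insert_self a s)
    have e : f a * ∏ i ∈ s, f i - 1 = f a * (∏ i ∈ s, f i - 1) + (f a - 1) := by ring
    rw [e]
    refine (norm_add_le _ _).trans ?_
    rw [norm_mul]
    have := mul_le_mul_of_nonneg_right h2 (norm_nonneg (∏ i ∈ s, f i - 1))
    linarith

theorem re_eq_of_norm_eq_one {u : ℂ} (hu : ‖u‖ = 1) : u.re = 1 - ‖u - 1‖ ^ 2 / 2 := by
  have h1 : ‖u‖ ^ 2 = 1 := by rw [hu, one_pow]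
  rw [Complex.sq_norm, Complex.normSq_apply] at h1 ⊢
  simp only [Complex.sub_re, Complex.one_re, Complex.sub_im, Complex.one_im]
  linarith

theorem symPart_neg (n : ℕ) (t φ : ℝ) :
    symPart n t (-φ) = (starRingEnd ℂ) (symPart n t φ) := by
  rw [symPart, symPart, map_prod]
  refine Finset.prod_congr rfl fun j _ => ?_
  rw [mul_neg, normFactor_neg]

theorem norm_symPart_le_one (n : ℕ) (t φ : ℝ) : ‖symPart n t φ‖ ≤ 1 := by
  rw [symPart, norm_prod]
  exact Finset.prod_le_one (fun _ _ => norm_nonneg _) fun j _ =>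
    norm_normFactor_le_one _ _ (Real.exp_pos _).le

theorem moment_four_mul_pow_le {n : ℕ} {t φ y : ℝ} (hM : 45 ≤ mass n t)
    (hy : moment 2 n t * φ ^ 2 ≤ y ^ 2) : moment 4 n t * φ ^ 4 ≤ 6 / 45 * y ^ 4 := by
  have h4 := moment_four_mul_le n t
  have h0 := moment_nonneg 4 n t
  have h2 := moment_nonneg 2 n t
  have h5 : 45 * moment 4 n t ≤ 6 * moment 2 n t ^ 2 := by nlinarith
  have h6 : (moment 2 n t * φ ^ 2) ^ 2 ≤ (y ^ 2) ^ 2 := by gcongr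
  have h7 := mul_le_mul_of_nonneg_right h5 (by positivity : 0 ≤ φ ^ 4)
  nlinarith

theorem exp_neg_le_norm_symPart {n : ℕ} {t φ y : ℝ} (hM : 45 ≤ mass n t)
    (hφ : 3 * mass n t * |φ| ≤ 0.1723) (hy : moment 2 n t * φ ^ 2 ≤ y ^ 2) :
    Real.exp (-(y ^ 2 + 0.1038 * y ^ 4)) ≤ ‖symPart n t φ‖ := by
  have h1 : Real.exp (-(2 * (moment 2 n t * φ ^ 2) + 14 / 9 * (moment 4 n t * φ ^ 4))) ≤
      ‖symPart n t φ‖ ^ 2 := by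
    rw [symPart, norm_prod, ← Finset.prod_pow]
    have e : -(2 * (moment 2 n t * φ ^ 2) + 14 / 9 * (moment 4 n t * φ ^ 4)) =
        ∑ j ∈ Finset.range n, (-(2 * weight t j * (node j * φ) ^ 2) -
          14 / 9 * weight t j * (node j * φ) ^ 4) := by
      rw [moment, moment, Finset.sum_mul, Finset.sum_mul, Finset.mul_sum, Finset.mul_sum,
        ← Finset.sum_add_distrib, ← Finset.sum_neg_distrib]
      exact Finset.sum_congr rfl fun j _ => by ring
    rw [e, Real.exp_sum]
    refine Finset.prod_le_prod (fun _ _ => (Real.exp_pos _).le) fun j hj => ?_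
    have := (sq_norm_normFactor_lower (Real.exp_pos _).le
      (exp_div_mul_abs_le hφ (Finset.mem_range.1 hj))).2
    rw [← weight_eq] at this
    exact le_trans (le_of_eq (by congr 1)) this
  have h4 := moment_four_mul_pow_le hM hy
  have h2 : Real.exp (-(y ^ 2 + 0.1038 * y ^ 4)) ^ 2 ≤ ‖symPart n t φ‖ ^ 2 := by
    refine le_trans ?_ h1
    rw [← Real.exp_nat_mul, Real.exp_le_exp]
    have : 0 ≤ y ^ 4 := by positivity
    push_cast
    linarith
  exact (pow_le_pow_iff_left₀ (Real.exp_pos _).le (norm_nonneg _) two_ne_zero).1 h2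

theorem le_re_symPart {n : ℕ} {t φ y : ℝ} (ht0 : 0 ≤ t) (hM : 45 ≤ mass n t)
    (hφ : 3 * mass n t * |φ| ≤ 0.1723) (hy : moment 2 n t * φ ^ 2 ≤ y ^ 2) :
    ‖symPart n t φ‖ * (1 - 0.0135 * y ^ 6) ≤ (symPart n t φ).re := by
  set q : ℕ → ℂ := fun j => normFactor (Real.exp (-(node j * t))) (node j * φ) with hq
  have hne : ∀ j ∈ Finset.range n, ‖q j‖ ≠ 0 := by
    intro j hj h
    have := (sq_norm_normFactor_lower (Real.exp_pos _).le
      (exp_div_mul_abs_le hφ (Finset.mem_range.1 hj))).1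
    simp only [hq] at h
    rw [h] at this
    norm_num at this
  set u : ℂ := ∏ j ∈ Finset.range n, q j / (‖q j‖ : ℂ) with hu
  have hn1 : ∀ j ∈ Finset.range n, ‖q j / (‖q j‖ : ℂ)‖ = 1 := by
    intro j hj
    rw [norm_div, Complex.norm_real, norm_norm, div_self (hne j hj)]
  have hu1 : ‖u‖ = 1 := by
    rw [hu, norm_prod]
    exact Finset.prod_eq_one hn1
  have hQ : symPart n t φ = (‖symPart n t φ‖ : ℂ) * u := by
    rw [hu, symPart, norm_prod, Complex.ofReal_prod, ← Finset.prod_mul_distrib]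
    refine Finset.prod_congr rfl fun j hj => ?_
    have : (‖q j‖ : ℂ) ≠ 0 := by exact_mod_cast hne j hj
    change q j = (‖q j‖ : ℂ) * (q j / (‖q j‖ : ℂ))
    field_simp
  have hu2 : ‖u - 1‖ ≤ 0.45 * (moment 3 n t * |φ| ^ 3) := by
    refine (norm_prod_sub_one_le_sum _ _ fun j hj => (hn1 j hj).le).trans ?_
    rw [moment, Finset.sum_mul, Finset.mul_sum]
    refine Finset.sum_le_sum fun j hj => ?_
    have := norm_normFactor_div_norm_sub_one_le (Real.exp_pos (-(node j * t))).le
      (Real.exp_le_one_iff.2 (neg_nonpos.2 (mul_nonneg (node_pos j).le ht0))) (exp_div_mul_abs_le hφ (Finset.mem_range.1 hj))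
    rw [← weight_eq, abs_mul, abs_of_pos (node_pos j)] at this
    refine this.trans (le_of_eq ?_)
    ring
  have h3 : (moment 3 n t * |φ| ^ 3) ^ 2 ≤ 6 / 45 * y ^ 6 := by
    have h4 := moment_four_mul_pow_le hM hy
    have h5 := moment_three_sq_le n t
    have h2 := moment_nonneg 2 n t
    have h6 := moment_nonneg 4 n t
    have e : (|φ| ^ 3) ^ 2 = φ ^ 2 * φ ^ 4 := by
      rw [← pow_mul, Even.pow_abs (by decide)]; ring
    calc (moment 3 n t * |φ| ^ 3) ^ 2 = moment 3 n t ^ 2 * (φ ^ 2 * φ ^ 4) := by rw [mul_pow, e]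
      _ ≤ (moment 2 n t * moment 4 n t) * (φ ^ 2 * φ ^ 4) := by gcongr
      _ = (moment 2 n t * φ ^ 2) * (moment 4 n t * φ ^ 4) := by ring
      _ ≤ y ^ 2 * (6 / 45 * y ^ 4) := by gcongr
      _ = 6 / 45 * y ^ 6 := by ring
  have h7 : ‖u - 1‖ ^ 2 ≤ 0.2025 * (6 / 45 * y ^ 6) := by
    have := pow_le_pow_left₀ (norm_nonneg _) hu2 2
    rw [mul_pow] at this
    linarith
  rw [hQ, Complex.re_ofReal_mul, re_eq_of_norm_eq_one hu1, ← hQ]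
  gcongr
  linarith

theorem le_re_mul_corrPart_zero {n : ℕ} {t : ℝ} (ht0 : 0 ≤ t) (ht : t ≤ 0.0045) {ζ : ℂ}
    (hζ : 1 / 2 ≤ ζ.re) (hζ2 : |ζ.im| ≤ √3 / 2) :
    0.338 * ‖corrPart n t 0‖ ≤ (ζ * corrPart n t 0).re := by
  obtain ⟨h3l, h3u⟩ := sqrt_three_bounds
  set v : ℕ → ℂ := fun j => 1 + (midCoeff t 0 - 1) * (weight t j : ℂ) with hv
  have hv1 : ∀ j, 1 ≤ ‖v j‖ := one_le_norm_factor t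
  have hn1 : ∀ j ∈ Finset.range n, ‖v j / (‖v j‖ : ℂ)‖ = 1 := by
    intro j hj
    rw [norm_div, Complex.norm_real, norm_norm, div_self (by linarith [hv1 j])]
  set u : ℂ := ∏ j ∈ Finset.range n, v j / (‖v j‖ : ℂ) with hu
  have hu1 : ‖u‖ = 1 := by
    rw [hu, norm_prod]
    exact Finset.prod_eq_one hn1
  have hF : corrPart n t 0 = (‖corrPart n t 0‖ : ℂ) * u := by
    rw [hu, corrPart_zero, norm_prod, Complex.ofReal_prod, ← Finset.prod_mul_distrib]
    refine Finset.prod_congr rfl fun j hj => ?_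
    have : (‖v j‖ : ℂ) ≠ 0 := by exact_mod_cast (by linarith [hv1 j] : ‖v j‖ ≠ 0)
    change v j = (‖v j‖ : ℂ) * (v j / (‖v j‖ : ℂ))
    field_simp
  have hS := sinh_half_le ht0 ht
  have hS0 : 0 ≤ Real.sinh (t / 2) := Real.sinh_nonneg_iff.2 (by linarith)
  have hb : ∀ j, ‖v j / (‖v j‖ : ℂ) - 1‖ ≤ Real.sinh (t / 2) * √3 * weight t j := by
    intro j
    have hw := weight_pos t j
    have hne : v j ≠ 0 := norm_pos_iff.1 (by linarith [hv1 j])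
    have h1 := sq_norm_div_norm_sub_one hne
    have h2 : ‖v j‖ ^ 2 = (v j).re ^ 2 + (v j).im ^ 2 := by
      rw [Complex.sq_norm, Complex.normSq_apply]; ring
    have hre : 1 ≤ (v j).re := one_le_re_factor t j
    have him : (v j).im = -(Real.sinh (t / 2) * √3 * weight t j) := by
      simp only [hv]
      rw [midCoeff_zero]
      simp [-Complex.ofReal_cosh, -Complex.ofReal_sinh]
    rw [him, neg_sq] at h2
    set b := Real.sinh (t / 2) * √3 * weight t j
    set r := ‖v j‖
    have hr : 1 ≤ r := hv1 j
    have hra : 0 ≤ r - (v j).re := sub_nonneg.2 (Complex.re_le_norm _)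
    refine (pow_le_pow_iff_left₀ (norm_nonneg _) (by positivity) two_ne_zero).1 ?_
    have h3 : 2 * (r - (v j).re) ≤ b ^ 2 * r := by
      have e : b ^ 2 = (r - (v j).re) * (r + (v j).re) := by linarith
      rw [e, mul_assoc, mul_comm 2]
      refine mul_le_mul_of_nonneg_left ?_ hra
      nlinarith
    rw [← h1] at h3
    exact le_of_mul_le_mul_right h3 (by linarith)
  have hu2 : ‖u - 1‖ ≤ 0.1765 := by
    refine (norm_prod_sub_one_le_sum _ _ fun j hj => (hn1 j hj).le).trans ?_
    refine (Finset.sum_le_sum fun j _ => hb j).trans ?_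
    rw [← Finset.mul_sum, ← mass]
    have h2 := mul_mass_le (n := n) ht0 ht
    have h3 := mass_nonneg n t
    calc Real.sinh (t / 2) * √3 * mass n t ≤ 0.500005 * t * 1.7321 * mass n t := by gcongr
      _ ≤ 0.1765 := by nlinarith
  have hre := re_eq_of_norm_eq_one hu1
  have hsq : ‖u - 1‖ ^ 2 ≤ 0.1765 ^ 2 := pow_le_pow_left₀ (norm_nonneg _) hu2 2
  have him : |u.im| ≤ 0.1765 := by
    have := Complex.abs_im_le_norm (u - 1)
    simp only [Complex.sub_im, Complex.one_im, sub_zero] at this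
    linarith
  have hfin : 0.338 ≤ (ζ * u).re := by
    rw [Complex.mul_re]
    have h1 : ζ.im * u.im ≤ √3 / 2 * 0.1765 := by
      refine (le_abs_self _).trans ?_
      rw [abs_mul]
      gcongr
    have h2 : 0.984 ≤ u.re := by rw [hre]; norm_num at hsq ⊢; linarith
    nlinarith
  rw [hF, mul_left_comm, Complex.re_ofReal_mul, ← hF, mul_comm]
  exact mul_le_mul_of_nonneg_left hfin (norm_nonneg _)

/-- A lower bound for the normalised integrand near the saddle point. -/
noncomputable def innerBound (y : ℝ) : ℝ :=
  min (Real.exp (-(y ^ 2 + 0.1038 * y ^ 4)) *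
      (0.338 * (1 - 0.0135 * y ^ 6) - 0.0919 * y - 0.0046 * y ^ 2))
    (0.338 * (1 - 0.0135 * y ^ 6) - 0.0919 * y - 0.0046 * y ^ 2)

theorem moment_two_ge_of_mass {n : ℕ} {t : ℝ} (hM : 45 ≤ mass n t) :
    34.85 ^ 2 * mass n t ^ 2 ≤ moment 2 n t := by
  refine le_trans ?_ (moment_two_lower hM)
  nlinarith [sq_nonneg (mass n t)]

theorem mass_mul_abs_le {n : ℕ} {t φ y : ℝ} (hM : 45 ≤ mass n t) (hy0 : 0 ≤ y)
    (hy : moment 2 n t * φ ^ 2 ≤ y ^ 2) : mass n t * |φ| ≤ y / 34.85 := by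
  rw [le_div_iff₀ (by norm_num)]
  refine (pow_le_pow_iff_left₀ (by positivity) hy0 two_ne_zero).1 ?_
  have := mul_le_mul_of_nonneg_right (moment_two_ge_of_mass hM) (sq_nonneg φ)
  have e : (mass n t * |φ| * 34.85) ^ 2 = 34.85 ^ 2 * mass n t ^ 2 * φ ^ 2 := by
    rw [mul_pow, mul_pow, sq_abs]; ring
  linarith

theorem inner_lower {n : ℕ} {m t φ y : ℝ} (ht0 : 0 ≤ t) (ht : t ≤ 0.0045) (hM : 45 ≤ mass n t)
    (hm : ∑ j ∈ Finset.range n, node j * tilt t j = m) {ζ : ℂ} (hζ1 : ‖ζ‖ = 1)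
    (hζ : 1 / 2 ≤ ζ.re) (hζ2 : |ζ.im| ≤ √3 / 2) (hy0 : 0 ≤ y) (hy2 : y ≤ 2)
    (hy : moment 2 n t * φ ^ 2 ≤ y ^ 2) :
    2 * ‖circleValue n t 0‖ * innerBound y ≤
      (ζ * (circleValue n t φ * Complex.exp (-((m * φ : ℝ) : ℂ) * Complex.I))).re +
      (ζ * (circleValue n t (-φ) * Complex.exp (-((m * -φ : ℝ) : ℂ) * Complex.I))).re := by
  have hMφ := mass_mul_abs_le hM hy0 hy
  have hφ0 := abs_nonneg φ
  have hφ : 3 * mass n t * |φ| ≤ 0.1723 := by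
    have : y / 34.85 ≤ 2 / 34.85 := by gcongr
    norm_num at this hMφ ⊢
    linarith
  have hφ1 : |φ| ≤ 0.002 := by
    nlinarith
  have hφ' : 3 * mass n t * |-φ| ≤ 0.1723 := by rwa [abs_neg]
  have hφ1' : |-φ| ≤ 0.002 := by rwa [abs_neg]
  rw [circleValue_mul_exp hφ hm, circleValue_mul_exp hφ' hm, symPart_neg, circleValue_zero]
  have hF := le_re_mul_corrPart_zero (n := n) ht0 ht hζ hζ2
  have h1 := norm_corrPart_div_sub_one_le ht0 ht hφ1 hφ
  have h2 := norm_corrPart_div_sub_one_le ht0 ht hφ1' hφ'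
  rw [abs_neg] at h2
  have hη : Real.exp (3.2 * mass n t * |φ|) - 1 ≤ 0.0919 * y + 0.0046 * y ^ 2 := by
    have hv : 3.2 * mass n t * |φ| ≤ 0.09183 * y := by
      norm_num at hMφ ⊢
      linarith
    have h4 := Real.exp_bound' (x := 0.09183 * y) (by positivity) (by linarith) (n := 3) (by norm_num)
    have h5 := Real.exp_le_exp.2 hv
    simp only [Finset.sum_range_succ, Finset.sum_range_zero, Nat.factorial] at h4
    norm_num at h4
    nlinarith [mul_le_mul_of_nonneg_right hy2 (sq_nonneg y)]
  have hQ1 := exp_neg_le_norm_symPart hM hφ hy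
  have hQ2 := norm_symPart_le_one n t φ
  have hQ3 := le_re_symPart ht0 hM hφ hy
  have hD : (0 : ℝ) ≤ ∏ j ∈ Finset.range n,
      (1 + Real.exp (-(node j * t)) + Real.exp (-(node j * t)) ^ 2) := by positivity
  have hF0 := corrPart_zero_ne n t
  set D := ∏ j ∈ Finset.range n, (1 + Real.exp (-(node j * t)) + Real.exp (-(node j * t)) ^ 2)
  set F := corrPart n t 0
  set Q := symPart n t φ
  set ε := corrPart n t φ / F - 1 with hε
  set ε' := corrPart n t (-φ) / F - 1 with hε'
  have e1 : corrPart n t φ = F * (1 + ε) := by rw [hε]; field_simp; ring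
  have e2 : corrPart n t (-φ) = F * (1 + ε') := by rw [hε']; field_simp; ring
  set b := 0.338 * (1 - 0.0135 * y ^ 6) - 0.0919 * y - 0.0046 * y ^ 2 with hb
  set η := 0.0919 * y + 0.0046 * y ^ 2 with hηdef
  have hib : innerBound y ≤ ‖Q‖ * b := by
    rw [innerBound]
    rcases le_total 0 b with h | h
    · exact (min_le_left _ _).trans (mul_le_mul_of_nonneg_right hQ1 h)
    · refine (min_le_right _ _).trans ?_
      nlinarith
  have e3 : (ζ * (D * Q * (F * (1 + ε)))).re + (ζ * (D * (starRingEnd ℂ) Q * (F * (1 + ε')))).re =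
      D * (2 * Q.re * (ζ * F).re + (ζ * F * (Q * ε)).re + (ζ * F * ((starRingEnd ℂ) Q * ε')).re) := by
    rw [← Complex.add_re]
    have : ζ * (D * Q * (F * (1 + ε))) + ζ * (D * (starRingEnd ℂ) Q * (F * (1 + ε'))) =
        D * ((Q + (starRingEnd ℂ) Q) * (ζ * F) + ζ * F * (Q * ε) +
          ζ * F * ((starRingEnd ℂ) Q * ε')) := by ring
    rw [this, Complex.re_ofReal_mul, Complex.add_conj, Complex.add_re, Complex.add_re,
      Complex.re_ofReal_mul]
  rw [e1, e2, e3, norm_mul, Complex.norm_real, Real.norm_eq_abs, abs_of_nonneg hD]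
  have h5 : -(‖F‖ * (‖Q‖ * η)) ≤ (ζ * F * (Q * ε)).re := by
    refine neg_le_of_abs_le ((Complex.abs_re_le_norm _).trans ?_)
    rw [norm_mul, norm_mul, norm_mul, hζ1, one_mul]
    gcongr
    exact h1.trans hη
  have h6 : -(‖F‖ * (‖Q‖ * η)) ≤ (ζ * F * ((starRingEnd ℂ) Q * ε')).re := by
    refine neg_le_of_abs_le ((Complex.abs_re_le_norm _).trans ?_)
    rw [norm_mul, norm_mul, norm_mul, hζ1, one_mul, RCLike.norm_conj]
    gcongr
    exact h2.trans hη
  have hy6 : 0 ≤ 1 - 0.0135 * y ^ 6 := by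
    have : y ^ 6 ≤ 2 ^ 6 := pow_le_pow_left₀ hy0 hy2 6
    linarith
  have h7 : (‖Q‖ * (1 - 0.0135 * y ^ 6)) * (0.338 * ‖F‖) ≤ Q.re * (ζ * F).re := by
    gcongr
    exact le_trans (by positivity) hQ3
  have h8 := mul_le_mul_of_nonneg_left hib (norm_nonneg F)
  have h9 : ‖F‖ * (‖Q‖ * b) = (‖Q‖ * (1 - 0.0135 * y ^ 6)) * (0.338 * ‖F‖) -
      ‖F‖ * (‖Q‖ * η) := by rw [hb, hηdef]; ring
  have : 2 * (D * ‖F‖) * innerBound y = D * (2 * (‖F‖ * innerBound y)) := by ring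
  rw [this]
  gcongr
  linarith

/-- The real part of the rotated Cauchy integrand on the circle of radius `exp (-t)`. -/
noncomputable def integrand (n : ℕ) (m t : ℝ) (ζ : ℂ) (φ : ℝ) : ℝ :=
  (ζ * (circleValue n t φ * Complex.exp (-((m * φ : ℝ) : ℂ) * Complex.I))).re

theorem continuous_integrand (n : ℕ) (m t : ℝ) (ζ : ℂ) : Continuous (integrand n m t ζ) := by
  unfold integrand circleValue midCoeff point
  fun_prop

theorem mul_sum_le_integral {f : ℝ → ℝ} (hf : Continuous f) {h : ℝ} (hh : 0 ≤ h) (c : ℕ → ℝ)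
    (N : ℕ) (hc : ∀ k < N, ∀ x, h * k ≤ x → x ≤ h * (k + 1) → c k ≤ f x) :
    h * ∑ k ∈ Finset.range N, c k ≤ ∫ x in (0 : ℝ)..h * N, f x := by
  induction N with
  | zero => simp
  | succ N ih =>
    have hi : ∀ a b : ℝ, IntervalIntegrable f MeasureTheory.volume a b :=
      fun a b => hf.intervalIntegrable a b
    rw [Finset.sum_range_succ, mul_add, Nat.cast_succ,
      ← intervalIntegral.integral_add_adjacent_intervals (hi 0 (h * N)) (hi _ _)]
    refine add_le_add (ih fun k hk => hc k (hk.trans N.lt_succ_self)) ?_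
    have hle : h * (N : ℝ) ≤ h * (N + 1) := by nlinarith
    have := intervalIntegral.integral_mono_on hle
      (intervalIntegrable_const (c := c N)) (hi (h * N) (h * (N + 1)))
      fun x hx => hc N N.lt_succ_self x hx.1 hx.2
    rw [intervalIntegral.integral_const, smul_eq_mul] at this
    linarith

theorem innerBound_ge {y : ℝ} (h : y ^ 2 + 0.1038 * y ^ 4 ≤ 64)
    (hb : 0 ≤ 0.338 * (1 - 0.0135 * y ^ 6) - 0.0919 * y - 0.0046 * y ^ 2) :
    (1 - (y ^ 2 + 0.1038 * y ^ 4) / 64) ^ 64 *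
      (0.338 * (1 - 0.0135 * y ^ 6) - 0.0919 * y - 0.0046 * y ^ 2) ≤ innerBound y := by
  have h1 := Real.one_sub_div_pow_le_exp_neg (n := 64) (by exact_mod_cast h)
  have h2 : Real.exp (-(y ^ 2 + 0.1038 * y ^ 4)) ≤ 1 :=
    Real.exp_le_one_iff.2 (neg_nonpos.2 (by positivity))
  rw [innerBound]
  push_cast at h1
  refine le_min (mul_le_mul_of_nonneg_right h1 hb) ?_
  exact mul_le_of_le_one_left hb (h1.trans h2)

theorem innerBound_ge_of_neg {y : ℝ}
    (hb : 0.338 * (1 - 0.0135 * y ^ 6) - 0.0919 * y - 0.0046 * y ^ 2 ≤ 0) :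
    0.338 * (1 - 0.0135 * y ^ 6) - 0.0919 * y - 0.0046 * y ^ 2 ≤ innerBound y := by
  have h2 : Real.exp (-(y ^ 2 + 0.1038 * y ^ 4)) ≤ 1 :=
    Real.exp_le_one_iff.2 (neg_nonpos.2 (by positivity))
  rw [innerBound]
  refine le_min ?_ le_rfl
  nlinarith

theorem sum_innerBound_ge :
    (3.32 : ℝ) ≤ ∑ k ∈ Finset.range 32, innerBound (((k : ℝ) + 1) / 16) := by
  have h : ∀ k ∈ Finset.range 28, (((1 : ℚ) - ((((k : ℚ) + 1) / 16) ^ 2 +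
      0.1038 * (((k : ℚ) + 1) / 16) ^ 4) / 64) ^ 64 *
      (0.338 * (1 - 0.0135 * (((k : ℚ) + 1) / 16) ^ 6) - 0.0919 * (((k : ℚ) + 1) / 16) -
        0.0046 * (((k : ℚ) + 1) / 16) ^ 2) : ℚ) ≤ innerBound (((k : ℝ) + 1) / 16) := by
    intro k hk
    have hk1 : ((k : ℝ) + 1) / 16 ≤ 1.75 := by
      have : (k : ℝ) ≤ 27 := by exact_mod_cast Nat.le_of_lt_succ (Finset.mem_range.1 hk)
      linarith
    have hk0 : 0 ≤ ((k : ℝ) + 1) / 16 := by positivity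
    push_cast
    have p2 := pow_le_pow_left₀ hk0 hk1 2
    have p4 := pow_le_pow_left₀ hk0 hk1 4
    have p6 := pow_le_pow_left₀ hk0 hk1 6
    norm_num at p2 p4 p6 hk1
    exact innerBound_ge (by linarith) (by linarith)
  have h1 := Finset.sum_le_sum h
  have h29 := innerBound_ge_of_neg (y := 29 / 16) (by norm_num)
  have h30 := innerBound_ge_of_neg (y := 30 / 16) (by norm_num)
  have h31 := innerBound_ge_of_neg (y := 31 / 16) (by norm_num)
  have h32 := innerBound_ge_of_neg (y := 32 / 16) (by norm_num)
  rw [← Rat.cast_sum] at h1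
  have h2 : (3.56 : ℚ) ≤ ∑ k ∈ Finset.range 28, (((1 : ℚ) - ((((k : ℚ) + 1) / 16) ^ 2 +
      0.1038 * (((k : ℚ) + 1) / 16) ^ 4) / 64) ^ 64 *
      (0.338 * (1 - 0.0135 * (((k : ℚ) + 1) / 16) ^ 6) - 0.0919 * (((k : ℚ) + 1) / 16) -
        0.0046 * (((k : ℚ) + 1) / 16) ^ 2) : ℚ) := by
    decide +kernel
  have h3 : ((3.56 : ℚ) : ℝ) ≤ _ := (Rat.cast_le (K := ℝ)).2 h2
  have h4 := h3.trans h1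
  push_cast at h4
  rw [Finset.sum_range_succ, Finset.sum_range_succ, Finset.sum_range_succ, Finset.sum_range_succ]
  norm_num at h29 h30 h31 h32 h4 ⊢
  linarith

theorem inner_integral_ge {n : ℕ} {m t : ℝ} (ht0 : 0 ≤ t) (ht : t ≤ 0.0045) (hM : 45 ≤ mass n t)
    (hm : ∑ j ∈ Finset.range n, node j * tilt t j = m) {ζ : ℂ} (hζ1 : ‖ζ‖ = 1)
    (hζ : 1 / 2 ≤ ζ.re) (hζ2 : |ζ.im| ≤ √3 / 2) :
    0.415 * (‖circleValue n t 0‖ / √(moment 2 n t)) ≤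
      ∫ φ in -(2 / √(moment 2 n t))..2 / √(moment 2 n t), integrand n m t ζ φ := by
  have hL : 0 < moment 2 n t := by
    have := moment_two_ge_of_mass hM
    nlinarith
  have hs : 0 < √(moment 2 n t) := Real.sqrt_pos.2 hL
  have hsq := Real.sq_sqrt hL.le
  set s := √(moment 2 n t)
  have hc := continuous_integrand n m t ζ
  have hi : ∀ a b : ℝ, IntervalIntegrable (integrand n m t ζ) MeasureTheory.volume a b :=
    fun a b => hc.intervalIntegrable a b
  have hc2 : Continuous fun φ => integrand n m t ζ φ + integrand n m t ζ (-φ) := by fun_prop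
  have e : ∫ φ in -(2 / s)..2 / s, integrand n m t ζ φ =
      ∫ φ in (0 : ℝ)..2 / s, (integrand n m t ζ φ + integrand n m t ζ (-φ)) := by
    rw [intervalIntegral.integral_add (hi _ _) ((by fun_prop : Continuous fun φ =>
      integrand n m t ζ (-φ)).intervalIntegrable _ _),
      intervalIntegral.integral_comp_neg (fun φ => integrand n m t ζ φ), neg_zero, add_comm,
      intervalIntegral.integral_add_adjacent_intervals (hi _ _) (hi _ _)]
  have h := mul_sum_le_integral hc2 (h := 1 / (16 * s)) (by positivity)
    (fun k => 2 * ‖circleValue n t 0‖ * innerBound (((k : ℝ) + 1) / 16)) 32 (by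
      intro k hk x hx0 hx
      have hk2 : ((k : ℝ) + 1) ≤ 32 := by exact_mod_cast hk
      have hx00 : 0 ≤ x := le_trans (by positivity) hx0
      refine inner_lower ht0 ht hM hm hζ1 hζ hζ2 (by positivity) (by linarith) ?_
      have h1 : s * x ≤ ((k : ℝ) + 1) / 16 := by
        calc s * x ≤ s * (1 / (16 * s) * (k + 1)) := by gcongr
          _ = _ := by field_simp
      rw [← hsq, ← mul_pow]
      gcongr)
  rw [e]
  have e2 : 1 / (16 * s) * ((32 : ℕ) : ℝ) = 2 / s := by
    push_cast; field_simp; norm_num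
  rw [e2, ← Finset.mul_sum] at h
  refine le_trans ?_ h
  have h2 := sum_innerBound_ge
  have : 1 / (16 * s) * (2 * ‖circleValue n t 0‖ *
      ∑ k ∈ Finset.range 32, innerBound (((k : ℝ) + 1) / 16)) =
      (‖circleValue n t 0‖ / s) *
        ((∑ k ∈ Finset.range 32, innerBound (((k : ℝ) + 1) / 16)) / 8) := by
    field_simp; ring
  rw [this, mul_comm]
  gcongr
  linarith

/-- The point `exp (-t + i(2π/3 + φ))`. -/
noncomputable def circlePoint (t φ : ℝ) : ℂ :=
  Complex.exp (((-t : ℝ) : ℂ) + ((2 * Real.pi / 3 + φ : ℝ) : ℂ) * Complex.I)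

theorem midCoeff_eq (t φ : ℝ) : midCoeff t φ =
    Complex.exp (((-(t / 2) : ℝ) : ℂ) + ((Real.pi / 3 + φ / 2 : ℝ) : ℂ) * Complex.I) +
    Complex.exp (-(((-(t / 2) : ℝ) : ℂ) + ((Real.pi / 3 + φ / 2 : ℝ) : ℂ) * Complex.I)) := by
  have hc := Real.cosh_eq (t / 2)
  have hs := Real.sinh_eq (t / 2)
  apply Complex.ext
  · simp only [midCoeff, Complex.add_re, Complex.exp_re, Complex.sub_re, Complex.neg_re,
      Complex.neg_im, Complex.add_im, Complex.mul_re, Complex.mul_im, Complex.ofReal_re,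
      Complex.ofReal_im, Complex.I_re, Complex.I_im, mul_zero, mul_one, zero_add, add_zero,
      sub_zero, neg_neg, Real.cos_neg, hc, Real.cos_add, Real.cos_pi_div_three,
      Real.sin_pi_div_three]
    ring
  · simp only [midCoeff, Complex.add_re, Complex.exp_im, Complex.sub_im, Complex.neg_re,
      Complex.neg_im, Complex.add_im, Complex.mul_re, Complex.mul_im, Complex.ofReal_re,
      Complex.ofReal_im, Complex.I_re, Complex.I_im, mul_zero, mul_one, zero_add, add_zero,
      sub_zero, neg_neg, Real.sin_neg, hs, Real.sin_add, Real.cos_pi_div_three,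
      Real.sin_pi_div_three, zero_sub]
    ring

theorem one_sub_pow_mul_one_sub_pow (t φ : ℝ) (j : ℕ) :
    (1 - circlePoint t φ ^ (3 * j + 1)) * (1 - circlePoint t φ ^ (3 * j + 2)) =
      1 + midCoeff t φ * point t φ j + point t φ j ^ 2 := by
  set w : ℂ := Complex.exp (((-(t / 2) : ℝ) : ℂ) + ((Real.pi / 3 + φ / 2 : ℝ) : ℂ) * Complex.I)
    with hw
  have hw0 : w ≠ 0 := Complex.exp_ne_zero _
  have hz : circlePoint t φ = w ^ 2 := by
    rw [hw, ← Complex.exp_nat_mul, circlePoint]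
    congr 1
    push_cast
    ring
  have hp : point t φ j = -w ^ (6 * j + 3) := by
    rw [hw, ← Complex.exp_nat_mul, point, Complex.ofReal_exp, ← Complex.exp_add]
    have : ((6 * j + 3 : ℕ) : ℂ) * (((-(t / 2) : ℝ) : ℂ) + ((Real.pi / 3 + φ / 2 : ℝ) : ℂ) *
        Complex.I) = ((-(node j * t) : ℝ) : ℂ) + ((node j * φ : ℝ) : ℂ) * Complex.I +
        (Real.pi * Complex.I + (j : ℂ) * (2 * Real.pi * Complex.I)) := by
      rw [node]; push_cast; ring
    rw [this, Complex.exp_add _ (Real.pi * Complex.I + (j : ℂ) * (2 * Real.pi * Complex.I)),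
      Complex.exp_add (Real.pi * Complex.I), Complex.exp_pi_mul_I,
      Complex.exp_nat_mul_two_pi_mul_I]
    ring
  rw [midCoeff_eq, Complex.exp_neg, ← hw, hz, hp]
  field_simp
  ring

theorem circleValue_eq_prod (n : ℕ) (t φ : ℝ) : circleValue n t φ =
    ∏ j ∈ Finset.range n,
      (1 - circlePoint t φ ^ (3 * j + 1)) * (1 - circlePoint t φ ^ (3 * j + 2)) :=
  Finset.prod_congr rfl fun j _ => (one_sub_pow_mul_one_sub_pow t φ j).symm

/-- The function `1 / (1 + 2 cosh u)`. -/
noncomputable def bump (u : ℝ) : ℝ := (1 + 2 * Real.cosh u)⁻¹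

theorem bump_pos (u : ℝ) : 0 < bump u := by
  have := Real.cosh_pos u
  unfold bump
  positivity

theorem bump_le (u : ℝ) : bump u ≤ 1 / 3 := by
  have := Real.one_le_cosh u
  rw [bump, one_div]
  exact inv_anti₀ (by norm_num) (by linarith)

theorem bump_anti {u v : ℝ} (hu : 0 ≤ u) (h : u ≤ v) : bump v ≤ bump u := by
  have := Real.cosh_pos u
  have : Real.cosh u ≤ Real.cosh v := by
    rw [Real.cosh_le_cosh, abs_of_nonneg hu, abs_of_nonneg (hu.trans h)]; exact h
  unfold bump
  exact inv_anti₀ (by positivity) (by linarith)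

theorem exp_neg_mul_bump_le {u v : ℝ} (hv : 0 ≤ v) :
    Real.exp (-v) * bump u ≤ bump (u + v) := by
  have h1 := Real.cosh_pos u
  have h2 := Real.cosh_pos (u + v)
  have h3 : Real.cosh (u + v) ≤ Real.exp v * Real.cosh u := by
    rw [Real.cosh_add, ← Real.cosh_add_sinh v]
    have := Real.sinh_lt_cosh u
    have := Real.sinh_nonneg_iff.2 hv
    nlinarith
  have h4 := Real.one_le_exp hv
  unfold bump
  rw [Real.exp_neg, ← mul_inv]
  exact inv_anti₀ (by positivity) (by linarith)

theorem sq_norm_one_sub_circlePoint_pow (t φ : ℝ) (i : ℕ) :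
    ‖1 - circlePoint t φ ^ i‖ ^ 2 =
      (1 + Real.exp (-(i * t)) + Real.exp (-(i * t)) ^ 2) *
        (1 - 2 * (bump (i * t) * (1 / 2 + Real.cos (i * (2 * Real.pi / 3 + φ))))) := by
  have h1 : circlePoint t φ ^ i = ((Real.exp (-(i * t)) : ℝ) : ℂ) *
      Complex.exp (((i * (2 * Real.pi / 3 + φ) : ℝ) : ℂ) * Complex.I) := by
    rw [circlePoint, ← Complex.exp_nat_mul, Complex.ofReal_exp, ← Complex.exp_add]
    congr 1
    push_cast
    ring
  have hb : bump (i * t) * (1 + Real.exp (-(i * t)) + Real.exp (-(i * t)) ^ 2) =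
      Real.exp (-(i * t)) := by
    rw [bump, Real.cosh_eq, Real.exp_neg]
    have := Real.exp_pos (i * t)
    field_simp
    ring
  rw [h1, Complex.sq_norm, Complex.normSq_apply, Complex.exp_mul_I, ← Complex.ofReal_cos,
    ← Complex.ofReal_sin]
  set r := Real.exp (-(i * t))
  set θ : ℝ := i * (2 * Real.pi / 3 + φ)
  simp only [Complex.sub_re, Complex.sub_im, Complex.one_re, Complex.one_im, Complex.mul_re,
    Complex.mul_im, Complex.add_re, Complex.add_im, Complex.ofReal_re, Complex.ofReal_im,
    Complex.I_re, Complex.I_im, mul_zero, mul_one, zero_mul, sub_zero, add_zero, zero_add]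
  have := Real.sin_sq_add_cos_sq θ
  linear_combination r ^ 2 * this + (1 + 2 * Real.cos θ) * hb

theorem norm_circleValue_le (n : ℕ) (t φ : ℝ) : ‖circleValue n t φ‖ ≤ ‖circleValue n t 0‖ *
    Real.exp (-∑ j ∈ Finset.range n,
      (bump ((3 * j + 1 : ℕ) * t) * (1 / 2 + Real.cos ((3 * j + 1 : ℕ) * (2 * Real.pi / 3 + φ))) +
      bump ((3 * j + 2 : ℕ) * t) *
        (1 / 2 + Real.cos ((3 * j + 2 : ℕ) * (2 * Real.pi / 3 + φ))))) := by
  have key : ∀ i : ℕ, Real.cos (i * (2 * Real.pi / 3)) = -1 / 2 →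
      ‖1 - circlePoint t φ ^ i‖ ≤ ‖1 - circlePoint t 0 ^ i‖ *
        Real.exp (-(bump (i * t) * (1 / 2 + Real.cos (i * (2 * Real.pi / 3 + φ))))) := by
    intro i hi
    refine (pow_le_pow_iff_left₀ (norm_nonneg _) (by positivity) two_ne_zero).1 ?_
    rw [mul_pow, sq_norm_one_sub_circlePoint_pow, sq_norm_one_sub_circlePoint_pow, add_zero, hi]
    norm_num
    gcongr
    set s := bump (i * t) * (1 / 2 + Real.cos (i * (2 * Real.pi / 3 + φ)))
    have h1 := Real.add_one_le_exp (-(2 * s))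
    have h2 : Real.exp (-s) ^ 2 = Real.exp (-(2 * s)) := by
      rw [← Real.exp_nat_mul]; congr 1; push_cast; ring
    linarith
  have h1 : ∀ j : ℕ, Real.cos ((3 * j + 1 : ℕ) * (2 * Real.pi / 3)) = -1 / 2 := by
    intro j
    have : ((3 * j + 1 : ℕ) : ℝ) * (2 * Real.pi / 3) =
        Real.pi - Real.pi / 3 + j * (2 * Real.pi) := by push_cast; ring
    rw [this, Real.cos_add_nat_mul_two_pi, Real.cos_pi_sub, Real.cos_pi_div_three]
    norm_num
  have h2 : ∀ j : ℕ, Real.cos ((3 * j + 2 : ℕ) * (2 * Real.pi / 3)) = -1 / 2 := by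
    intro j
    have : ((3 * j + 2 : ℕ) : ℝ) * (2 * Real.pi / 3) =
        Real.pi / 3 + Real.pi + j * (2 * Real.pi) := by push_cast; ring
    rw [this, Real.cos_add_nat_mul_two_pi, Real.cos_add_pi, Real.cos_pi_div_three]
    norm_num
  rw [circleValue_eq_prod, circleValue_eq_prod, norm_prod, norm_prod, ← Finset.sum_neg_distrib,
    Real.exp_sum, ← Finset.prod_mul_distrib]
  refine Finset.prod_le_prod (fun _ _ => norm_nonneg _) fun j _ => ?_
  rw [norm_mul, norm_mul, neg_add, Real.exp_add]
  have := mul_le_mul (key _ (h1 j)) (key _ (h2 j)) (norm_nonneg _) (by positivity)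
  refine this.trans (le_of_eq ?_)
  ring

theorem sum_bump_sub_le {t : ℝ} (ht : 0 ≤ t) (n : ℕ) :
    ∑ j ∈ Finset.range n, (bump ((3 * j + 1 : ℕ) * t) - bump ((3 * j + 2 : ℕ) * t)) ≤
      1 / 3 - bump ((3 * n + 1 : ℕ) * t) := by
  induction n with
  | zero => simpa using bump_le _
  | succ n ih =>
    rw [Finset.sum_range_succ]
    have : bump ((3 * (n + 1) + 1 : ℕ) * t) ≤ bump ((3 * n + 2 : ℕ) * t) := by
      apply bump_anti (by positivity)
      exact mul_le_mul_of_nonneg_right (by exact_mod_cast (by omega)) ht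
    linarith

/-- The weight at the upper exponent of the `j`-th pair. -/
noncomputable def upperWeight (t : ℝ) (j : ℕ) : ℝ := bump ((3 * j + 2 : ℕ) * t)

theorem norm_circleValue_le_exp {t : ℝ} (ht : 0 ≤ t) (n : ℕ) (φ : ℝ) :
    ‖circleValue n t φ‖ ≤ ‖circleValue n t 0‖ * Real.exp (1 / 6 - ∑ j ∈ Finset.range n,
      upperWeight t j * (1 - 2 * Real.cos (Real.pi / 3 + φ / 2) * Real.cos (node j * φ))) := by
  refine (norm_circleValue_le n t φ).trans ?_
  gcongr
  have h := sum_bump_sub_le ht n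
  have hb := bump_pos ((3 * n + 1 : ℕ) * t)
  have : ∑ j ∈ Finset.range n,
      (upperWeight t j * (1 - 2 * Real.cos (Real.pi / 3 + φ / 2) * Real.cos (node j * φ)) -
        1 / 2 * (bump ((3 * j + 1 : ℕ) * t) - bump ((3 * j + 2 : ℕ) * t))) ≤
      ∑ j ∈ Finset.range n,
      (bump ((3 * j + 1 : ℕ) * t) * (1 / 2 + Real.cos ((3 * j + 1 : ℕ) * (2 * Real.pi / 3 + φ))) +
      bump ((3 * j + 2 : ℕ) * t) *
        (1 / 2 + Real.cos ((3 * j + 2 : ℕ) * (2 * Real.pi / 3 + φ)))) := by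
    refine Finset.sum_le_sum fun j _ => ?_
    have hle : bump ((3 * j + 2 : ℕ) * t) ≤ bump ((3 * j + 1 : ℕ) * t) := by
      apply bump_anti (by positivity)
      exact mul_le_mul_of_nonneg_right (by exact_mod_cast (by omega)) ht
    have e1 : ((3 * j + 1 : ℕ) : ℝ) * (2 * Real.pi / 3 + φ) =
        node j * φ + Real.pi + j * (2 * Real.pi) - (Real.pi / 3 + φ / 2) := by
      rw [node]; push_cast; ring
    have e2 : ((3 * j + 2 : ℕ) : ℝ) * (2 * Real.pi / 3 + φ) =
        node j * φ + Real.pi + j * (2 * Real.pi) + (Real.pi / 3 + φ / 2) := by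
      rw [node]; push_cast; ring
    have e3 : Real.cos ((3 * j + 1 : ℕ) * (2 * Real.pi / 3 + φ)) +
        Real.cos ((3 * j + 2 : ℕ) * (2 * Real.pi / 3 + φ)) =
        -(2 * Real.cos (Real.pi / 3 + φ / 2) * Real.cos (node j * φ)) := by
      rw [e1, e2, Real.cos_sub, Real.cos_add _ (Real.pi / 3 + φ / 2),
        Real.cos_add_nat_mul_two_pi, Real.cos_add_pi]
      ring
    have hc := Real.neg_one_le_cos ((3 * j + 1 : ℕ) * (2 * Real.pi / 3 + φ))
    have h5 := mul_nonneg (sub_nonneg.2 hle)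
      (by linarith : 0 ≤ 1 + Real.cos ((3 * j + 1 : ℕ) * (2 * Real.pi / 3 + φ)))
    rw [upperWeight]
    linear_combination h5 - bump ((3 * j + 2 : ℕ) * t) * e3
  rw [Finset.sum_sub_distrib, ← Finset.mul_sum] at this
  linarith

theorem integral_cos_int_mul (k m : ℕ) :
    ∫ φ in -(2 * Real.pi / 3)..Real.pi / 3,
      Real.cos (((k : ℝ) - m) * (2 * Real.pi / 3 + φ)) = if k = m then Real.pi else 0 := by
  rw [intervalIntegral.integral_comp_add_left (fun x => Real.cos (((k : ℝ) - m) * x))]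
  have e1 : 2 * Real.pi / 3 + -(2 * Real.pi / 3) = 0 := by ring
  have e2 : 2 * Real.pi / 3 + Real.pi / 3 = Real.pi := by ring
  rw [e1, e2]
  split_ifs with h
  · simp [h]
  · have hne : (k : ℝ) - m ≠ 0 := sub_ne_zero.2 (by exact_mod_cast h)
    rw [intervalIntegral.integral_comp_mul_left (fun x => Real.cos x) hne, integral_cos]
    have : ((k : ℝ) - m) * Real.pi = ((k - m : ℤ) : ℝ) * Real.pi := by push_cast; ring
    rw [this, Real.sin_int_mul_pi]
    simp

/-- The sign predicted for the `m`-th coefficient. -/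
noncomputable def borweinSign (m : ℕ) : ℝ := if m % 3 = 0 then 1 else -1

/-- The rotation that makes the main term of the Cauchy integral have positive real part. -/
noncomputable def phaseFactor (m : ℕ) : ℂ :=
  (borweinSign m : ℂ) * Complex.exp (-((m * (2 * Real.pi / 3) : ℝ) : ℂ) * Complex.I)

theorem phaseFactor_bounds (m : ℕ) :
    ‖phaseFactor m‖ = 1 ∧ 1 / 2 ≤ (phaseFactor m).re ∧ |(phaseFactor m).im| ≤ √3 / 2 := by
  have h3 : 0 ≤ √3 / 2 := by positivity
  have hre : (phaseFactor m).re = borweinSign m * Real.cos (m * (2 * Real.pi / 3)) := by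
    rw [phaseFactor, Complex.re_ofReal_mul, ← Complex.ofReal_neg, Complex.exp_ofReal_mul_I_re,
      Real.cos_neg]
  have him : (phaseFactor m).im = -(borweinSign m * Real.sin (m * (2 * Real.pi / 3))) := by
    rw [phaseFactor, Complex.im_ofReal_mul, ← Complex.ofReal_neg, Complex.exp_ofReal_mul_I_im,
      Real.sin_neg, mul_neg]
  have hm : (m : ℝ) = 3 * (m / 3 : ℕ) + (m % 3 : ℕ) := by exact_mod_cast (Nat.div_add_mod m 3).symm
  have hang : (m : ℝ) * (2 * Real.pi / 3) =
      (m % 3 : ℕ) * (2 * Real.pi / 3) + (m / 3 : ℕ) * (2 * Real.pi) := by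
    nth_rewrite 1 [hm]; ring
  rw [hang, Real.cos_add_nat_mul_two_pi] at hre
  rw [hang, Real.sin_add_nat_mul_two_pi] at him
  refine ⟨?_, ?_⟩
  · rw [phaseFactor, norm_mul, ← Complex.ofReal_neg, Complex.norm_exp_ofReal_mul_I, mul_one,
      Complex.norm_real, borweinSign]
    split_ifs <;> simp
  have h1 : 2 * Real.pi / 3 = Real.pi - Real.pi / 3 := by ring
  have h2 : 2 * (Real.pi - Real.pi / 3) = Real.pi / 3 + Real.pi := by ring
  have hlt := Nat.mod_lt m (by norm_num : 3 > 0)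
  rw [hre, him, borweinSign, h1]
  interval_cases h : m % 3
  · norm_num [h3]
  · norm_num [Real.cos_pi_sub, Real.sin_pi_sub, abs_of_nonneg h3]
  · norm_num [h2, Real.cos_add_pi, Real.sin_add_pi, abs_of_nonneg h3]

theorem integrand_eq (n m : ℕ) (t φ : ℝ) : integrand n m t (phaseFactor m) φ =
    ∑ k ∈ Finset.range ((borweinPoly n).natDegree + 1), borweinSign m *
      (((borweinPoly n).coeff k : ℝ) * Real.exp (-(k * t))) *
        Real.cos (((k : ℝ) - m) * (2 * Real.pi / 3 + φ)) := by
  have h1 : circleValue n t φ = (borweinPoly n).eval₂ (Int.castRingHom ℂ) (circlePoint t φ) := by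
    rw [circleValue_eq_prod, borweinPoly, Polynomial.eval₂_finsetProd]
    simp
  rw [integrand, h1, Polynomial.eval₂_eq_sum_range, Finset.sum_mul, Finset.mul_sum, Complex.re_sum]
  refine Finset.sum_congr rfl fun k _ => ?_
  have h2 : phaseFactor m * ((Int.castRingHom ℂ) ((borweinPoly n).coeff k) * circlePoint t φ ^ k *
      Complex.exp (-((m * φ : ℝ) : ℂ) * Complex.I)) =
      ((borweinSign m * (((borweinPoly n).coeff k : ℝ) * Real.exp (-(k * t))) : ℝ) : ℂ) *
        Complex.exp (((((k : ℝ) - m) * (2 * Real.pi / 3 + φ) : ℝ) : ℂ) * Complex.I) := by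
    have e : Complex.exp (((((k : ℝ) - m) * (2 * Real.pi / 3 + φ) : ℝ) : ℂ) * Complex.I) *
        ((Real.exp (-(k * t)) : ℝ) : ℂ) =
        Complex.exp (-((m * (2 * Real.pi / 3) : ℝ) : ℂ) * Complex.I) * circlePoint t φ ^ k *
          Complex.exp (-((m * φ : ℝ) : ℂ) * Complex.I) := by
      rw [circlePoint, ← Complex.exp_nat_mul, Complex.ofReal_exp, ← Complex.exp_add,
        ← Complex.exp_add, ← Complex.exp_add]
      congr 1
      push_cast
      ring
    rw [phaseFactor, Complex.ofReal_mul (borweinSign m),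
      Complex.ofReal_mul ((borweinPoly n).coeff k : ℝ), eq_intCast, Complex.ofReal_intCast]
    linear_combination -((borweinSign m : ℂ) * ((borweinPoly n).coeff k : ℂ)) * e
  rw [h2, Complex.re_ofReal_mul, Complex.exp_ofReal_mul_I_re]

theorem integral_integrand (n m : ℕ) (t : ℝ) :
    ∫ φ in -(2 * Real.pi / 3)..Real.pi / 3, integrand n m t (phaseFactor m) φ =
      Real.pi * Real.exp (-(m * t)) * (borweinSign m * (borweinPoly n).coeff m) := by
  simp_rw [integrand_eq]
  rw [intervalIntegral.integral_finsetSum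
    fun k _ => (by fun_prop : Continuous _).intervalIntegrable _ _]
  simp_rw [intervalIntegral.integral_const_mul, integral_cos_int_mul, mul_ite, mul_zero]
  rw [Finset.sum_ite_eq']
  split_ifs with h
  · ring
  · rw [Polynomial.coeff_eq_zero_of_natDegree_lt (by simpa using h)]
    simp

theorem abs_integrand_le (n : ℕ) (m t φ : ℝ) {ζ : ℂ} (hζ : ‖ζ‖ = 1) :
    |integrand n m t ζ φ| ≤ ‖circleValue n t φ‖ := by
  refine (Complex.abs_re_le_norm _).trans (le_of_eq ?_)
  rw [norm_mul, norm_mul, hζ, one_mul, ← Complex.ofReal_neg, Complex.norm_exp_ofReal_mul_I, mul_one]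

theorem cos_le_taylor {x : ℝ} (hx : 0 ≤ x) (hx2 : x ≤ 2) :
    Real.cos x ≤ 1 - x ^ 2 / 2 + x ^ 4 / 24 := by
  have h1 := Real.sin_ge_sub_cube (x := x / 2) (by linarith)
  have h2 : Real.cos x = 1 - 2 * Real.sin (x / 2) ^ 2 := by
    have := Real.cos_sq (x / 2)
    have h3 := Real.sin_sq_add_cos_sq (x / 2)
    rw [mul_div_cancel₀ x two_ne_zero] at this
    linarith
  have hx3 : x ^ 2 ≤ 4 := by nlinarith
  have h0 : 0 ≤ x / 2 - (x / 2) ^ 3 / 6 := by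
    nlinarith [mul_le_mul_of_nonneg_left hx3 hx]
  have h4 := pow_le_pow_left₀ h0 h1 2
  rw [h2]
  nlinarith [sq_nonneg (x ^ 3)]

theorem sin_le_taylor {x : ℝ} (hx : 0 ≤ x) (hx2 : x ≤ 2) :
    Real.sin x ≤ x - x ^ 3 / 6 + x ^ 5 / 120 := by
  have hd : ∀ y : ℝ, HasDerivAt (fun y : ℝ => y - y ^ 3 / 6 + y ^ 5 / 120 - Real.sin y)
      (1 - y ^ 2 / 2 + y ^ 4 / 24 - Real.cos y) y := by
    intro y
    have h := ((((hasDerivAt_id y).sub (((hasDerivAt_id y).pow 3).div_const 6)).add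
      (((hasDerivAt_id y).pow 5).div_const 120))).sub (Real.hasDerivAt_sin y)
    refine h.congr_deriv ?_
    simp only [id]
    norm_num
    ring
  have hmono : MonotoneOn (fun y : ℝ => y - y ^ 3 / 6 + y ^ 5 / 120 - Real.sin y)
      (Set.Icc 0 2) := by
    refine monotoneOn_of_deriv_nonneg (convex_Icc 0 2)
      (fun y _ => (hd y).continuousAt.continuousWithinAt)
      (fun y _ => (hd y).differentiableAt.differentiableWithinAt) fun y hy => ?_
    rw [interior_Icc] at hy
    rw [(hd y).deriv]
    linarith [cos_le_taylor hy.1.le hy.2.le]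
  have := hmono (Set.left_mem_Icc.2 (by norm_num)) ⟨hx, hx2⟩ hx
  norm_num at this
  linarith

theorem cube_div_le_sub_sin {w : ℝ} (hw : 0 ≤ w) :
    w ^ 3 / (6 + 1.1 * w ^ 2) ≤ w - Real.sin w := by
  rw [div_le_iff₀ (by positivity)]
  rcases le_total w 1.3 with h | h
  · have h1 := sin_le_taylor hw (by linarith)
    have h2 : w ^ 2 ≤ 1.69 := by nlinarith
    have h3 : w ^ 3 / 6 - w ^ 5 / 120 ≤ w - Real.sin w := by linarith
    have h4 := mul_le_mul_of_nonneg_right h3 (by positivity : 0 ≤ 6 + 1.1 * w ^ 2)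
    refine le_trans ?_ h4
    have h5 : 0 ≤ w ^ 5 * (1.69 - w ^ 2) := mul_nonneg (by positivity) (by linarith)
    have h6 : 0 ≤ w ^ 5 := by positivity
    nlinarith
  · have h1 := Real.sin_le_one w
    have h3 := mul_le_mul_of_nonneg_right (sub_le_sub_left h1 w)
      (by positivity : 0 ≤ 6 + 1.1 * w ^ 2)
    refine le_trans ?_ h3
    nlinarith [mul_nonneg (sub_nonneg.2 h) (sq_nonneg (w - 4.85)), sq_nonneg (w - 4)]

theorem neg_div_four_le_sin {v : ℝ} (hv : 0 ≤ v) : -(v / 4) ≤ Real.sin v := by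
  have hp := Real.pi_gt_d2
  rcases le_total v Real.pi with h | h
  · linarith [Real.sin_nonneg_of_nonneg_of_le_pi hv h]
  rcases le_total v 4 with h4 | h4
  · have h1 := Real.sin_le (x := v - Real.pi) (by linarith)
    rw [Real.sin_sub_pi] at h1
    linarith
  · linarith [Real.neg_one_le_sin v]

theorem sum_mul_le_sum_mul_of_antitone {μ a b : ℕ → ℝ} (hμ : Antitone μ) (h0 : ∀ j, 0 ≤ μ j)
    (hab : ∀ k, ∑ j ∈ Finset.range k, a j ≤ ∑ j ∈ Finset.range k, b j) (n : ℕ) :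
    ∑ j ∈ Finset.range n, μ j * a j ≤ ∑ j ∈ Finset.range n, μ j * b j := by
  have key : ∀ n, μ n * ∑ j ∈ Finset.range (n + 1), (b j - a j) ≤
      ∑ j ∈ Finset.range (n + 1), μ j * (b j - a j) := by
    intro n
    induction n with
    | zero => simp
    | succ n ih =>
      rw [Finset.sum_range_succ, Finset.sum_range_succ _ (n + 1)]
      have h1 : 0 ≤ ∑ j ∈ Finset.range (n + 1), (b j - a j) := by
        rw [Finset.sum_sub_distrib]; linarith [hab (n + 1)]
      have h2 := mul_le_mul_of_nonneg_right (hμ n.le_succ) h1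
      rw [mul_add]
      linarith
  rcases n with _ | n
  · simp
  have h1 : 0 ≤ ∑ j ∈ Finset.range (n + 1), (b j - a j) := by
    rw [Finset.sum_sub_distrib]; linarith [hab (n + 1)]
  have h2 := (mul_nonneg (h0 n) h1).trans (key n)
  simp_rw [mul_sub] at h2
  rw [Finset.sum_sub_distrib] at h2
  linarith

theorem two_sin_mul_sum_cos (φ : ℝ) (k : ℕ) :
    2 * Real.sin (3 / 2 * φ) * ∑ j ∈ Finset.range k, Real.cos (node j * φ) =
      Real.sin (3 * k * φ) := by
  induction k with
  | zero => simp
  | succ k ih =>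
    rw [Finset.sum_range_succ, mul_add, ih]
    have e1 : (3 * ((k + 1 : ℕ) : ℝ) * φ) = node k * φ + 3 / 2 * φ := by
      rw [node]; push_cast; ring
    have e2 : (3 * (k : ℝ) * φ) = node k * φ - 3 / 2 * φ := by rw [node]; ring
    rw [e1, e2, Real.sin_add, Real.sin_sub]
    ring

theorem upperWeight_pos (t : ℝ) (j : ℕ) : 0 < upperWeight t j := bump_pos _

theorem antitone_upperWeight {t : ℝ} (ht : 0 ≤ t) : Antitone (upperWeight t) := by
  intro i j hij
  apply bump_anti (by positivity)
  exact mul_le_mul_of_nonneg_right (by exact_mod_cast (by omega)) ht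

theorem weight_eq_bump (t : ℝ) (j : ℕ) : weight t j = bump (node j * t) := rfl

theorem upperWeight_le {t : ℝ} (ht : 0 ≤ t) (j : ℕ) : upperWeight t j ≤ weight t j := by
  rw [weight_eq_bump]
  apply bump_anti (mul_nonneg (node_pos j).le ht)
  refine mul_le_mul_of_nonneg_right ?_ ht
  rw [node]; push_cast; linarith

theorem le_upperWeight {t : ℝ} (ht0 : 0 ≤ t) (ht : t ≤ 0.0045) (j : ℕ) :
    0.9977 * weight t j ≤ upperWeight t j := by
  have h := exp_neg_mul_bump_le (u := node j * t) (v := t / 2) (by linarith)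
  have e : node j * t + t / 2 = ((3 * j + 2 : ℕ) : ℝ) * t := by rw [node]; push_cast; ring
  rw [e, ← weight_eq_bump] at h
  refine le_trans ?_ h
  have := Real.add_one_le_exp (-(t / 2))
  have hw := (weight_pos t j).le
  gcongr
  linarith

/-- A single nonzero term at the origin bounds partial sums. -/
theorem sum_upperWeight_mul_le {t B : ℝ} (ht : 0 ≤ t) (hB : 0 ≤ B) {a : ℕ → ℝ}
    (ha : ∀ k, ∑ j ∈ Finset.range k, a j ≤ B) (n : ℕ) :
    ∑ j ∈ Finset.range n, upperWeight t j * a j ≤ B / 3 := by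
  rcases n with _ | n
  · simp; linarith
  have h := sum_mul_le_sum_mul_of_antitone (antitone_upperWeight ht)
    (fun j => (upperWeight_pos t j).le) (a := a) (b := fun j => if j = 0 then B else 0) (by
      intro k
      rcases k with _ | k
      · simp
      · simpa using ha (k + 1)) (n + 1)
  refine h.trans ?_
  simp only [mul_ite, mul_zero, Finset.sum_ite_eq', Finset.mem_range, Nat.succ_pos, if_true]
  have := bump_le ((3 * 0 + 2 : ℕ) * t)
  rw [upperWeight]
  nlinarith

/-- The exponent controlling the decay of the product away from the saddle point. -/
noncomputable def decay (n : ℕ) (t φ : ℝ) : ℝ := ∑ j ∈ Finset.range n,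
  upperWeight t j * (1 - 2 * Real.cos (Real.pi / 3 + φ / 2) * Real.cos (node j * φ))

theorem sum_upperWeight_ge {t : ℝ} (ht0 : 0 ≤ t) (ht : t ≤ 0.0045) (n : ℕ) :
    0.9977 * mass n t ≤ ∑ j ∈ Finset.range n, upperWeight t j := by
  rw [mass, Finset.mul_sum]
  exact Finset.sum_le_sum fun j _ => le_upperWeight ht0 ht j

theorem mul_abs_le_abs_sin {φ : ℝ} (hφ : |φ| ≤ Real.pi / 3) :
    0.954 * |φ| ≤ |Real.sin (3 / 2 * φ)| := by
  have hp := Real.pi_lt_d4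
  have hp0 := Real.pi_pos
  have h := Real.mul_abs_le_abs_sin (x := 3 / 2 * φ) (by
    rw [abs_mul, abs_of_pos (by norm_num : (0 : ℝ) < 3 / 2)]; linarith)
  refine le_trans ?_ h
  rw [abs_mul, abs_of_pos (by norm_num : (0 : ℝ) < 3 / 2), ← mul_assoc]
  gcongr
  rw [div_mul_eq_mul_div, le_div_iff₀ hp0]
  linarith

theorem decay_ge_of_abs_le {n : ℕ} {t φ : ℝ} (ht0 : 0 ≤ t) (ht : t ≤ 0.0045)
    (hM : 45 ≤ mass n t) (hφ : |φ| ≤ Real.pi / 3) (hφ2 : 1 ≤ 3 * mass n t * |φ|) :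
    0.41 * mass n t ≤ decay n t φ := by
  have hp0 := Real.pi_pos
  have hφ0 : 0 < |φ| := by
    by_contra! h
    nlinarith
  have hs := mul_abs_le_abs_sin hφ
  obtain ⟨hl, hu⟩ := abs_le.1 hφ
  set c := 2 * Real.cos (Real.pi / 3 + φ / 2) with hc
  have hc0 : 0 ≤ c := mul_nonneg zero_le_two (Real.cos_nonneg_of_mem_Icc ⟨by linarith, by linarith⟩)
  have hc1 : c ≤ 1 + |φ| := by
    have := Real.abs_cos_sub_cos_le (Real.pi / 3 + φ / 2) (Real.pi / 3)
    rw [Real.cos_pi_div_three, add_sub_cancel_left, abs_div, abs_two] at this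
    linarith [le_abs_self (Real.cos (Real.pi / 3 + φ / 2) - 1 / 2)]
  have hB : (1 + |φ|) / (1.908 * |φ|) ≤ 1.573 * mass n t + 0.525 := by
    rw [div_le_iff₀ (by positivity)]
    nlinarith
  have hsum := sum_upperWeight_mul_le ht0 (B := (1 + |φ|) / (1.908 * |φ|)) (by positivity)
    (a := fun j => c * Real.cos (node j * φ)) (by
      intro k
      rw [← Finset.mul_sum]
      have h := two_sin_mul_sum_cos φ k
      set S := ∑ j ∈ Finset.range k, Real.cos (node j * φ)
      have h1 : 1.908 * |φ| * |S| ≤ 1 := by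
        have h2 : |2 * Real.sin (3 / 2 * φ) * S| ≤ 1 := by rw [h]; exact Real.abs_sin_le_one _
        rw [abs_mul, abs_mul, abs_two] at h2
        have := mul_le_mul_of_nonneg_right hs (abs_nonneg S)
        linarith
      rw [le_div_iff₀ (by positivity)]
      calc c * S * (1.908 * |φ|) ≤ c * |S| * (1.908 * |φ|) := by gcongr; exact le_abs_self _
        _ = c * (1.908 * |φ| * |S|) := by ring
        _ ≤ (1 + |φ|) * 1 := by gcongr
        _ = 1 + |φ| := mul_one _) n
  have hw := sum_upperWeight_ge ht0 ht n
  have e : decay n t φ = ∑ j ∈ Finset.range n, upperWeight t j -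
      ∑ j ∈ Finset.range n, upperWeight t j * (c * Real.cos (node j * φ)) := by
    rw [decay, ← Finset.sum_sub_distrib]
    exact Finset.sum_congr rfl fun j _ => by rw [hc]; ring
  rw [e]
  linarith

theorem decay_ge_of_le {n : ℕ} {t φ : ℝ} (ht0 : 0 ≤ t) (ht : t ≤ 0.0045)
    (hM : 45 ≤ mass n t) (hφ1 : -(2 * Real.pi / 3) < φ) (hφ2 : φ ≤ -(Real.pi / 3)) :
    0.41 * mass n t ≤ decay n t φ := by
  have hp0 := Real.pi_pos
  set θ := 2 * Real.pi / 3 + φ with hθ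
  have hθ0 : 0 < θ := by linarith
  have hθ1 : θ ≤ Real.pi / 3 := by linarith
  have hs := mul_abs_le_abs_sin (φ := θ) (by rwa [abs_of_pos hθ0])
  have hs0 : 0 ≤ Real.sin (3 / 2 * θ) :=
    Real.sin_nonneg_of_nonneg_of_le_pi (by linarith) (by linarith)
  rw [abs_of_pos hθ0, abs_of_nonneg hs0] at hs
  have hc0 : 0 ≤ Real.cos (θ / 2) := Real.cos_nonneg_of_mem_Icc ⟨by linarith, by linarith⟩
  have hc1 := Real.cos_le_one (θ / 2)
  have hcos : ∀ j, Real.cos (node j * φ) = -Real.cos (node j * θ) := by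
    intro j
    have : node j * θ = node j * φ + Real.pi + j * (2 * Real.pi) := by rw [hθ, node]; ring
    rw [this, Real.cos_add_nat_mul_two_pi, Real.cos_add_pi, neg_neg]
  have hw := sum_upperWeight_ge ht0 ht n
  have e : decay n t φ = ∑ j ∈ Finset.range n, upperWeight t j -
      ∑ j ∈ Finset.range n, upperWeight t j * (-(2 * Real.cos (θ / 2) * Real.cos (node j * θ))) := by
    rw [decay, ← Finset.sum_sub_distrib]
    have : Real.pi / 3 + φ / 2 = θ / 2 := by rw [hθ]; ring
    refine Finset.sum_congr rfl fun j _ => ?_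
    rw [hcos, this]; ring
  have hpart : ∀ a, 0 ≤ a → a ≤ Real.sin (3 / 2 * θ) → ∀ k, a * ∑ j ∈ Finset.range k,
      (-(2 * Real.cos (θ / 2) * Real.cos (node j * θ))) ≤ max 0 (-Real.sin (3 * k * θ)) := by
    intro a ha0 ha k
    rw [Finset.sum_neg_distrib, ← Finset.mul_sum]
    have h := two_sin_mul_sum_cos θ k
    set S := ∑ j ∈ Finset.range k, Real.cos (node j * θ)
    rcases le_total 0 S with hS | hS
    · refine le_max_of_le_left ?_
      have : 0 ≤ a * (2 * Real.cos (θ / 2) * S) := by positivity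
      linarith
    · refine le_max_of_le_right ?_
      rw [← h]
      have h1 := mul_le_mul ha hc1 hc0 hs0
      have h2 := mul_le_mul_of_nonneg_right h1 (neg_nonneg.2 hS)
      linarith
  rw [e]
  rcases le_total 0.6 (mass n t * θ) with h6 | h6
  · have hsum := sum_upperWeight_mul_le ht0 (B := 1 / (0.954 * θ)) (by positivity)
      (a := fun j => -(2 * Real.cos (θ / 2) * Real.cos (node j * θ))) (by
        intro k
        rw [le_div_iff₀ (by positivity), mul_comm]
        exact (hpart _ (by positivity) hs k).trans
          (max_le zero_le_one (by linarith [Real.neg_one_le_sin (3 * k * θ)]))) n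
    have : 1 / (0.954 * θ) ≤ 1.7471 * mass n t := by
      rw [div_le_iff₀ (by positivity)]
      linarith
    linarith
  · have hθ2 : θ ≤ 0.0134 := by linarith [mul_le_mul_of_nonneg_right hM hθ0.le]
    have hs2 : 1.49 * θ ≤ Real.sin (3 / 2 * θ) := by
      have h := Real.sin_ge_sub_cube (x := 3 / 2 * θ) (by linarith)
      have h2 : θ * θ ^ 2 ≤ θ * 0.0134 := by
        refine mul_le_mul_of_nonneg_left ?_ hθ0.le
        rw [sq]
        linarith [mul_le_mul hθ2 hθ2 hθ0.le (by norm_num : (0 : ℝ) ≤ 0.0134)]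
      linarith
    have hsum := sum_mul_le_sum_mul_of_antitone (antitone_upperWeight ht0)
      (fun j => (upperWeight_pos t j).le)
      (a := fun j => -(2 * Real.cos (θ / 2) * Real.cos (node j * θ))) (b := fun _ => 0.58) (by
        intro k
        have h1 := hpart _ (by positivity) hs2 k
        have h2 := neg_div_four_le_sin (v := 3 * k * θ) (by positivity)
        have h3 : max 0 (-Real.sin (3 * k * θ)) ≤ 3 * k * θ / 4 :=
          max_le (by positivity) (by linarith)
        rw [Finset.sum_const, Finset.card_range, nsmul_eq_mul]
        refine le_of_mul_le_mul_left (h1.trans (h3.trans ?_)) (by positivity : 0 < 1.49 * θ)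
        have : 0 ≤ (k : ℝ) * θ := by positivity
        linarith) n
    rw [← Finset.sum_mul] at hsum
    linarith

theorem cubic_le_sum_one_sub_cos {φ D : ℝ} (hφ : 0 < φ) (hD : 0 < D) (k : ℕ) :
    9 * (2 / D - 6 / D ^ 2) * φ ^ 2 * k ^ 3 - 81 * (1.1 / D ^ 2) * φ ^ 4 * k ^ 5 -
      0.38 * φ ^ 2 * k ≤ ∑ j ∈ Finset.range k, (1 - Real.cos (node j * φ)) := by
  have hk : (0 : ℝ) ≤ k := k.cast_nonneg
  have h := two_sin_mul_sum_cos φ k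
  have hC : ∑ j ∈ Finset.range k, Real.cos (node j * φ) ≤ k := by
    refine (Finset.sum_le_sum fun j _ => Real.cos_le_one (node j * φ)).trans ?_
    simp
  rw [Finset.sum_sub_distrib, Finset.sum_const, Finset.card_range, nsmul_eq_mul, mul_one]
  set C := ∑ j ∈ Finset.range k, Real.cos (node j * φ)
  set w := 3 * k * φ with hw
  have hw0 : 0 ≤ w := by positivity
  have h1 := cube_div_le_sub_sin hw0
  have h2 : (2 / D - 6 / D ^ 2) * w ^ 3 - 1.1 / D ^ 2 * w ^ 5 ≤ w ^ 3 / (6 + 1.1 * w ^ 2) := by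
    have e : w ^ 3 / (6 + 1.1 * w ^ 2) - ((2 / D - 6 / D ^ 2) * w ^ 3 - 1.1 / D ^ 2 * w ^ 5) =
        w ^ 3 * (6 + 1.1 * w ^ 2 - D) ^ 2 / ((6 + 1.1 * w ^ 2) * D ^ 2) := by
      field_simp
      ring
    have : 0 ≤ w ^ 3 * (6 + 1.1 * w ^ 2 - D) ^ 2 / ((6 + 1.1 * w ^ 2) * D ^ 2) := by positivity
    linarith
  have hs1 := Real.sin_le (x := 3 / 2 * φ) (by positivity)
  have hs2 := Real.sin_ge_sub_cube (x := 3 / 2 * φ) (by positivity)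
  have h3 : (3 * φ - 2 * Real.sin (3 / 2 * φ)) * C ≤ 1.14 * φ ^ 3 * k := by
    have h4 : 3 * φ - 2 * Real.sin (3 / 2 * φ) ≤ 1.14 * φ ^ 3 := by
      have : 0 < φ ^ 3 := by positivity
      linarith
    exact (mul_le_mul_of_nonneg_left hC (by linarith)).trans (mul_le_mul_of_nonneg_right h4 hk)
  refine le_of_mul_le_mul_left ?_ (by positivity : 0 < 3 * φ)
  have e : 3 * φ * (9 * (2 / D - 6 / D ^ 2) * φ ^ 2 * k ^ 3 - 81 * (1.1 / D ^ 2) * φ ^ 4 * k ^ 5 -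
      0.38 * φ ^ 2 * k) = (2 / D - 6 / D ^ 2) * w ^ 3 - 1.1 / D ^ 2 * w ^ 5 -
        1.14 * φ ^ 3 * k := by
    rw [hw]; ring
  rw [e]
  linarith

theorem sum_range_node_pow_four (k : ℕ) : ∑ j ∈ Finset.range k, node j ^ 4 =
    81 / 5 * (k : ℝ) ^ 5 - 27 / 2 * (k : ℝ) ^ 3 + 189 / 80 * k := by
  induction k with
  | zero => simp
  | succ k ih => rw [Finset.sum_range_succ, ih, node]; push_cast; ring

theorem moments_le_sum_weight_mul_one_sub_cos {n : ℕ} {t φ D : ℝ} (hφ : 0 < φ)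
    (hD : 6 ≤ D) :
    3 * (2 / D - 6 / D ^ 2) * (moment 2 n t * φ ^ 2) - 5.5 / D ^ 2 * φ ^ 4 *
      (moment 4 n t + 4.5 * moment 2 n t + 3.375 * mass n t) - 0.38 * φ ^ 2 * mass n t ≤
        ∑ j ∈ Finset.range n, weight t j * (1 - Real.cos (node j * φ)) := by
  have hD0 : 0 < D := by linarith
  have h := sum_mul_le_sum_mul_of_antitone (μ := weight t)
    (fun _ _ hij => weight_anti hij) (fun j => (weight_pos t j).le)
    (a := fun j => 3 * (2 / D - 6 / D ^ 2) * φ ^ 2 * node j ^ 2 - 5.5 / D ^ 2 * φ ^ 4 *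
      (node j ^ 4 + 4.5 * node j ^ 2 + 3.375) - 0.38 * φ ^ 2)
    (b := fun j => 1 - Real.cos (node j * φ)) (by
      intro k
      refine le_trans ?_ (cubic_le_sum_one_sub_cos hφ hD0 k)
      simp only [Finset.sum_sub_distrib, Finset.sum_add_distrib, ← Finset.mul_sum,
        sum_range_node_sq, sum_range_node_pow_four, Finset.sum_const, Finset.card_range,
        nsmul_eq_mul]
      have hk : (0 : ℝ) ≤ k := k.cast_nonneg
      have h1 : 0 ≤ (2 / D - 6 / D ^ 2) * (φ ^ 2 * k) := by
        refine mul_nonneg ?_ (by positivity)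
        rw [sub_nonneg, div_le_div_iff₀ (by positivity) hD0]
        nlinarith
      have h2 : 0 ≤ 1 / D ^ 2 * (φ ^ 4 * k) := by positivity
      have e : (5.5 : ℝ) / D ^ 2 = 5.5 * (1 / D ^ 2) := by ring
      have e' : (1.1 : ℝ) / D ^ 2 = 1.1 * (1 / D ^ 2) := by ring
      rw [e, e']
      set Q := 1 / D ^ 2
      set R := 2 / D - 6 / D ^ 2
      linarith) n
  refine le_trans (le_of_eq ?_) h
  have e : ∀ j ∈ Finset.range n, weight t j * (3 * (2 / D - 6 / D ^ 2) * φ ^ 2 * node j ^ 2 -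
      5.5 / D ^ 2 * φ ^ 4 * (node j ^ 4 + 4.5 * node j ^ 2 + 3.375) - 0.38 * φ ^ 2) =
      3 * (2 / D - 6 / D ^ 2) * φ ^ 2 * (node j ^ 2 * weight t j) - 5.5 / D ^ 2 * φ ^ 4 *
      (node j ^ 4 * weight t j + 4.5 * (node j ^ 2 * weight t j) + 3.375 * weight t j) -
        0.38 * φ ^ 2 * weight t j := fun j _ => by ring
  rw [Finset.sum_congr rfl e]
  simp only [Finset.sum_sub_distrib, Finset.sum_add_distrib, ← Finset.mul_sum]
  rw [← moment, ← moment, ← mass]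
  ring

theorem sum_weight_mul_one_sub_cos_ge {n : ℕ} {t φ y : ℝ} (hM : 45 ≤ mass n t) (hφ : 0 < φ)
    (hφM : 3 * mass n t * φ ≤ 1) (hy : moment 2 n t * φ ^ 2 = y ^ 2) :
    3 * y ^ 2 / (6 + 11 * y ^ 2 / mass n t) - 0.0013 ≤
      ∑ j ∈ Finset.range n, weight t j * (1 - Real.cos (node j * φ)) := by
  set M := mass n t with hMdef
  have hM0 : 0 < M := by linarith
  have hφ1 : φ ≤ 1 / 135 := by nlinarith
  set D := 6 + 11 * y ^ 2 / M with hD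
  have hy2 : 0 ≤ y ^ 2 / M := by positivity
  have hD6 : 6 ≤ D := by rw [hD]; linarith [show 11 * y ^ 2 / M = 11 * (y ^ 2 / M) by ring]
  have hD0 : 0 < D := by linarith
  refine le_trans ?_ (moments_le_sum_weight_mul_one_sub_cos (n := n) (t := t) hφ hD6)
  rw [hy, ← hMdef]
  have h4 : φ ^ 4 * moment 4 n t ≤ 6 * y ^ 4 / M := by
    rw [le_div_iff₀ hM0]
    have := mul_le_mul_of_nonneg_left (moment_four_mul_le n t) (by positivity : 0 ≤ φ ^ 4)
    have e : y ^ 4 = (moment 2 n t * φ ^ 2) ^ 2 := by rw [hy]; ring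
    rw [e]
    linarith
  have hφ2 : φ ^ 2 * M ≤ 1 / 405 := by nlinarith
  have hφ2' : φ ^ 2 * M ^ 2 ≤ 1 / 9 := by nlinarith [mul_pos hφ hM0]
  have hQ : 5.5 / D ^ 2 ≤ 1 := by
    rw [div_le_one (by positivity)]; nlinarith
  have hQ0 : 0 ≤ 5.5 / D ^ 2 := by positivity
  have hyD : 5.5 / D ^ 2 * y ^ 2 ≤ M / 48 := by
    have e : y ^ 2 = (D - 6) * M / 11 := by rw [hD]; field_simp; ring
    rw [e, div_mul_eq_mul_div, div_le_iff₀ (by positivity)]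
    nlinarith [mul_nonneg hM0.le (sq_nonneg (D - 12))]
  have hb : 5.5 / D ^ 2 * (φ ^ 4 * (4.5 * moment 2 n t)) ≤ 0.0003 := by
    have e : 5.5 / D ^ 2 * (φ ^ 4 * (4.5 * moment 2 n t)) =
        4.5 * φ ^ 2 * (5.5 / D ^ 2 * y ^ 2) := by rw [← hy]; ring
    rw [e]
    have := mul_le_mul_of_nonneg_left hyD (by positivity : 0 ≤ 4.5 * φ ^ 2)
    linarith
  have hc : 5.5 / D ^ 2 * (φ ^ 4 * (3.375 * M)) ≤ 0.00001 := by
    have h1 : φ ^ 4 * (3.375 * M) ≤ 0.00001 := by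
      have e : φ ^ 4 * (3.375 * M) = 3.375 * (φ ^ 2 * (φ ^ 2 * M)) := by ring
      have h2 : φ ^ 2 ≤ 1 / 18225 := by nlinarith
      have := mul_le_mul h2 hφ2 (by positivity) (by norm_num)
      rw [e]; linarith
    have := mul_le_mul hQ h1 (by positivity) zero_le_one
    linarith
  have hd : 5.5 / D ^ 2 * (φ ^ 4 * moment 4 n t) ≤ 5.5 / D ^ 2 * (6 * y ^ 4 / M) :=
    mul_le_mul_of_nonneg_left h4 hQ0
  have e : 3 * y ^ 2 / D = 3 * (2 / D - 6 / D ^ 2) * y ^ 2 - 5.5 / D ^ 2 * (6 * y ^ 4 / M) := by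
    have e : y ^ 4 / M = y ^ 2 * ((D - 6) / 11) := by rw [hD]; field_simp; ring
    rw [mul_div_assoc 6, e]
    field_simp
    ring
  linarith

theorem decay_ge_of_near {n : ℕ} {t φ y : ℝ} (ht0 : 0 ≤ t) (ht : t ≤ 0.0045)
    (hM : 45 ≤ mass n t) (hφ : φ ≠ 0) (hφM : 3 * mass n t * |φ| ≤ 1) (hy0 : 0 ≤ y)
    (hy : moment 2 n t * φ ^ 2 = y ^ 2) :
    0.9977 * (3 * y ^ 2 / (6 + 11 * y ^ 2 / mass n t) - 0.0013) - y / 34.85 ≤ decay n t φ := by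
  have h := sum_weight_mul_one_sub_cos_ge (φ := |φ|) (y := y) hM (abs_pos.2 hφ) hφM (by rwa [sq_abs])
  refine le_trans (sub_le_sub (mul_le_mul_of_nonneg_left h (by norm_num))
    (mass_mul_abs_le hM hy0 hy.le)) ?_
  rw [mass, Finset.mul_sum, Finset.sum_mul, ← Finset.sum_sub_distrib]
  refine Finset.sum_le_sum fun j _ => ?_
  have e : Real.cos (node j * |φ|) = Real.cos (node j * φ) := by
    rw [← Real.cos_abs (node j * φ), abs_mul, abs_of_pos (node_pos j)]
  rw [e]
  have hc1 : |2 * Real.cos (Real.pi / 3 + φ / 2) - 1| ≤ |φ| := by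
    have := Real.abs_cos_sub_cos_le (Real.pi / 3 + φ / 2) (Real.pi / 3)
    rw [Real.cos_pi_div_three, add_sub_cancel_left, abs_div, abs_two] at this
    have e2 : 2 * Real.cos (Real.pi / 3 + φ / 2) - 1 =
      2 * (Real.cos (Real.pi / 3 + φ / 2) - 1 / 2) := by ring
    rw [e2, abs_mul, abs_two]
    linarith
  set c := 2 * Real.cos (Real.pi / 3 + φ / 2)
  set u := Real.cos (node j * φ) with hu
  have hu1 : u ≤ 1 := Real.cos_le_one _
  have h3 : (c - 1) * u ≤ |φ| := by
    refine (le_abs_self _).trans ?_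
    rw [abs_mul]
    exact (mul_le_mul hc1 (Real.abs_cos_le_one _) (abs_nonneg _) (abs_nonneg _)).trans
      (mul_one _).le
  have h4 := mul_le_mul_of_nonneg_right (le_upperWeight ht0 ht j) (sub_nonneg.2 hu1)
  have h5 := mul_le_mul_of_nonneg_left h3 (upperWeight_pos t j).le
  have h6 := mul_le_mul_of_nonneg_right (upperWeight_le ht0 j) (abs_nonneg φ)
  linarith

theorem near_exponent_le {M y : ℝ} (hM : 45 ≤ M) (hy : 2 ≤ y) (hyM : y ^ 2 ≤ 18.02 * M) :
    1 / 6 - (0.9977 * (3 * y ^ 2 / (6 + 11 * y ^ 2 / M) - 0.0013) - y / 34.85) ≤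
      max (-1.4846 - 1.446 * (y - 2)) (-5.218 - 0.213 * (y - 2)) := by
  have hM0 : 0 < M := by linarith
  have h45 : 3 * y ^ 2 / (6 + 11 * y ^ 2 / 45) ≤ 3 * y ^ 2 / (6 + 11 * y ^ 2 / M) := by gcongr
  rcases le_total y 5 with h5 | h5
  · refine le_max_of_le_left ?_
    have h : (1.71 + 1.475 * (y - 2)) / 0.9977 ≤ 3 * y ^ 2 / (6 + 11 * y ^ 2 / 45) := by
      rw [div_le_div_iff₀ (by norm_num) (by positivity)]
      nlinarith [mul_nonneg (sub_nonneg.2 hy) (sub_nonneg.2 h5),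
        mul_nonneg (mul_nonneg (sub_nonneg.2 hy) (sub_nonneg.2 h5)) (sub_nonneg.2 hy)]
    have h' := h.trans h45
    rw [div_le_iff₀ (by norm_num)] at h'
    clear h h45
    generalize 3 * y ^ 2 / (6 + 11 * y ^ 2 / M) = g at h' ⊢
    norm_num at h' ⊢
    linarith
  · refine le_max_of_le_right ?_
    have h : (6.17 + 0.242 * (y - 5)) / 0.9977 ≤ 3 * y ^ 2 / (6 + 11 * y ^ 2 / M) := by
      rcases le_total y 28.5 with h6 | h6
      · refine le_trans ?_ h45
        rw [div_le_div_iff₀ (by norm_num) (by positivity)]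
        nlinarith [mul_nonneg (sub_nonneg.2 h5) (sub_nonneg.2 h6),
          mul_nonneg (mul_nonneg (sub_nonneg.2 h5) (sub_nonneg.2 h6)) (sub_nonneg.2 h5)]
      · have h7 : 11 * y ^ 2 / M ≤ 198.22 := by
          rw [div_le_iff₀ hM0]; linarith
        have h8 : 3 * y ^ 2 / 204.22 ≤ 3 * y ^ 2 / (6 + 11 * y ^ 2 / M) := by
          gcongr
          linarith
        refine le_trans ?_ h8
        rw [div_le_div_iff₀ (by norm_num) (by norm_num)]
        nlinarith
    rw [div_le_iff₀ (by norm_num)] at h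
    clear h45
    generalize 3 * y ^ 2 / (6 + 11 * y ^ 2 / M) = g at h ⊢
    norm_num at h ⊢
    linarith

theorem exp_near_exponent_le {M y : ℝ} (hM : 45 ≤ M) (hy : 2 ≤ y) (hyM : y ^ 2 ≤ 18.02 * M) :
    Real.exp (1 / 6 - (0.9977 * (3 * y ^ 2 / (6 + 11 * y ^ 2 / M) - 0.0013) - y / 34.85)) ≤
      0.227 * Real.exp (-(1.446 * (y - 2))) + 0.0055 * Real.exp (-(0.213 * (y - 2))) := by
  have he : 2.718 ≤ Real.exp 1 := by linarith [Real.exp_one_gt_d9]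
  have h1 : Real.exp (-1.4846) ≤ 0.227 := by
    have h := Real.sum_le_exp_of_nonneg (x := 0.4846) (by norm_num) 5
    simp only [Finset.sum_range_succ, Finset.sum_range_zero, Nat.factorial] at h
    have e : (-1.4846 : ℝ) = -(1 + 0.4846) := by norm_num
    rw [e, Real.exp_neg, Real.exp_add]
    refine inv_le_of_inv_le₀ (by norm_num) ?_
    have := mul_le_mul he h (by positivity) (Real.exp_pos _).le
    refine le_trans ?_ this
    norm_num
  have h2 : Real.exp (-5.218) ≤ 0.0055 := by
    have h := Real.sum_le_exp_of_nonneg (x := 0.218) (by norm_num) 3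
    simp only [Finset.sum_range_succ, Finset.sum_range_zero, Nat.factorial] at h
    have e : (-5.218 : ℝ) = -((5 : ℕ) * 1 + 0.218) := by norm_num
    rw [e, Real.exp_neg, Real.exp_add, Real.exp_nat_mul]
    refine inv_le_of_inv_le₀ (by norm_num) ?_
    have := mul_le_mul (pow_le_pow_left₀ (by norm_num) he 5) h (by positivity) (by positivity)
    refine le_trans ?_ this
    norm_num
  refine (Real.exp_le_exp.2 (near_exponent_le hM hy hyM)).trans ?_
  have p1 := Real.exp_pos (-(1.446 * (y - 2)))
  have p2 := Real.exp_pos (-(0.213 * (y - 2)))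
  rcases max_cases (-1.4846 - 1.446 * (y - 2)) (-5.218 - 0.213 * (y - 2)) with ⟨h, -⟩ | ⟨h, -⟩
  · rw [h, sub_eq_add_neg, Real.exp_add]
    nlinarith [mul_le_mul_of_nonneg_right h1 p1.le]
  · rw [h, sub_eq_add_neg, Real.exp_add]
    nlinarith [mul_le_mul_of_nonneg_right h2 p2.le]

theorem moment_two_pos {n : ℕ} {t : ℝ} (hM : 45 ≤ mass n t) : 0 < moment 2 n t :=
  lt_of_lt_of_le (by positivity) (moment_two_lower hM)

/-- A majorant of the integrand outside the central arc, relative to its size at the centre. -/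
noncomputable def outerBound (M y : ℝ) : ℝ :=
  0.227 * Real.exp (-(1.446 * (y - 2))) + 0.0055 * Real.exp (-(0.213 * (y - 2))) +
    1.2 * Real.exp (-(0.41 * M))

theorem norm_circleValue_le_outerBound {n : ℕ} {t φ : ℝ} (ht0 : 0 ≤ t) (ht : t ≤ 0.0045)
    (hM : 45 ≤ mass n t) (hφ1 : -(2 * Real.pi / 3) < φ) (hφ2 : φ ≤ Real.pi / 3)
    (hφ : 2 ≤ √(moment 2 n t) * |φ|) :
    ‖circleValue n t φ‖ ≤ ‖circleValue n t 0‖ * outerBound (mass n t) (√(moment 2 n t) * |φ|) := by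
  refine (norm_circleValue_le_exp ht0 n φ).trans ?_
  refine mul_le_mul_of_nonneg_left ?_ (norm_nonneg _)
  rw [← decay, outerBound]
  set y := √(moment 2 n t) * |φ| with hy
  have hM0 : 0 < mass n t := by linarith
  have hy2 : moment 2 n t * φ ^ 2 = y ^ 2 := by
    rw [hy, mul_pow, Real.sq_sqrt (moment_two_pos hM).le, sq_abs]
  rcases le_total (3 * mass n t * |φ|) 1 with h | h
  · have hyM : y ^ 2 ≤ 18.02 * mass n t := by
      have h1 := mul_le_mul_of_nonneg_right (moment_two_le (n := n) ht0 ht) (sq_nonneg φ)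
      have h2 : (3 * mass n t * |φ|) ^ 2 ≤ 1 := pow_le_one₀ (by positivity) h
      rw [mul_pow, sq_abs] at h2
      have h3 := mul_le_mul_of_nonneg_left h2 hM0.le
      linarith
    have hφ0 : φ ≠ 0 := by
      rintro rfl
      rw [abs_zero, mul_zero] at hy
      linarith
    have h1 := decay_ge_of_near ht0 ht hM hφ0 h (by linarith) hy2
    refine (Real.exp_le_exp.2 (sub_le_sub_left h1 _)).trans ?_
    have := exp_near_exponent_le hM hφ hyM
    have := Real.exp_pos (-(0.41 * mass n t))
    linarith
  · have h1 : 0.41 * mass n t ≤ decay n t φ := by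
      rcases le_total φ (-(Real.pi / 3)) with h2 | h2
      · exact decay_ge_of_le ht0 ht hM hφ1 h2
      · exact decay_ge_of_abs_le ht0 ht hM (abs_le.2 ⟨h2, hφ2⟩) h
    have h3 : Real.exp (1 / 6) ≤ 1.2 := by
      have := Real.exp_bound_div_one_sub_of_interval' (x := 1 / 6) (by norm_num) (by norm_num)
      exact this.le.trans (by norm_num)
    have h4 : Real.exp (1 / 6 - decay n t φ) ≤ 1.2 * Real.exp (-(0.41 * mass n t)) := by
      rw [sub_eq_add_neg, Real.exp_add]
      gcongr
    have := Real.exp_pos (-(1.446 * (y - 2)))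
    have := Real.exp_pos (-(0.213 * (y - 2)))
    linarith

theorem integral_exp_le {b r p q : ℝ} (hb : 0 < b) (hr : 0 < r) (hp : r * p = 2) :
    ∫ x in p..q, Real.exp (-(b * (r * x - 2))) ≤ 1 / (b * r) := by
  have hd : ∀ x ∈ Set.uIcc p q, HasDerivAt (fun x => -(1 / (b * r)) *
      Real.exp (-(b * (r * x - 2)))) (Real.exp (-(b * (r * x - 2)))) x := by
    intro x _
    have h : HasDerivAt (fun x => -(b * (r * x - 2))) (-(b * (r * 1))) x :=
      ((((hasDerivAt_id x).const_mul r).sub_const 2).const_mul b).neg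
    refine (h.exp.const_mul (-(1 / (b * r)))).congr_deriv ?_
    field_simp
  rw [intervalIntegral.integral_eq_sub_of_hasDerivAt hd
    (by apply Continuous.intervalIntegrable; fun_prop), hp, sub_self, mul_zero, neg_zero,
    Real.exp_zero]
  have : 0 ≤ 1 / (b * r) * Real.exp (-(b * (r * q - 2))) := by positivity
  linarith

theorem sqrt_moment_two_mul_exp_le {n : ℕ} {t : ℝ} (ht0 : 0 ≤ t) (ht : t ≤ 0.0045)
    (hM : 45 ≤ mass n t) : √(moment 2 n t) * Real.exp (-(0.41 * mass n t)) ≤ 0.004 := by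
  set M := mass n t with hMdef
  have hM0 : 0 < M := by linarith
  have h1 : √(moment 2 n t) ≤ 1.9 * M ^ 2 := by
    rw [Real.sqrt_le_left (by positivity)]
    refine (moment_two_le ht0 ht).trans ?_
    rw [← hMdef]
    nlinarith [pow_pos hM0 3]
  have h2 := Real.pow_div_factorial_le_exp (0.41 * M) (by positivity) 10
  have h3 : (45 : ℝ) ^ 8 ≤ M ^ 8 := pow_le_pow_left₀ (by norm_num) hM 8
  rw [Real.exp_neg, ← div_eq_mul_inv, div_le_iff₀ (Real.exp_pos _)]
  have h4 : 0.41 ^ 10 / 3628800 * (M ^ 2 * 45 ^ 8) ≤ (0.41 * M) ^ 10 / (Nat.factorial 10 : ℕ) := by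
    have e : ((Nat.factorial 10 : ℕ) : ℝ) = 3628800 := by norm_num [Nat.factorial]
    have := mul_le_mul_of_nonneg_left h3 (sq_nonneg M)
    rw [e, mul_pow]
    linarith
  have h5 := h4.trans h2
  norm_num at h5
  nlinarith [sq_nonneg M]

theorem integral_outerBound_le {M r q : ℝ} (hr : 0 < r) (hq2 : q ≤ 2 * Real.pi / 3)
    (hrM : r * Real.exp (-(0.41 * M)) ≤ 0.004) :
    ∫ x in 2 / r..q, outerBound M (r * x) ≤ 0.1946 / r := by
  have hp0 : 0 ≤ 2 / r := by positivity
  have hp : r * (2 / r) = 2 := by field_simp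
  unfold outerBound
  rw [intervalIntegral.integral_add (by apply Continuous.intervalIntegrable; fun_prop)
    (by apply Continuous.intervalIntegrable; fun_prop), intervalIntegral.integral_add
    (by apply Continuous.intervalIntegrable; fun_prop)
    (by apply Continuous.intervalIntegrable; fun_prop), intervalIntegral.integral_const_mul,
    intervalIntegral.integral_const_mul, intervalIntegral.integral_const, smul_eq_mul]
  have h1 := integral_exp_le (b := 1.446) (q := q) (by norm_num) hr hp
  have h2 := integral_exp_le (b := 0.213) (q := q) (by norm_num) hr hp
  have h3 : (q - 2 / r) * (1.2 * Real.exp (-(0.41 * M))) ≤ 0.0105 / r := by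
    have hpi := Real.pi_lt_d2
    have : (q - 2 / r) * (1.2 * Real.exp (-(0.41 * M))) ≤
        2.1 * (1.2 * Real.exp (-(0.41 * M))) := by
      gcongr
      linarith
    rw [le_div_iff₀ hr]
    have h4 := mul_le_mul_of_nonneg_right this hr.le
    linarith
  have e1 : 1 / (1.446 * r) = 1 / 1.446 * r⁻¹ := by field_simp
  have e2 : 1 / (0.213 * r) = 1 / 0.213 * r⁻¹ := by field_simp
  have e3 : 0.0105 / r = 0.0105 * r⁻¹ := by ring
  have e4 : 0.1946 / r = 0.1946 * r⁻¹ := by ring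
  rw [e1] at h1
  rw [e2] at h2
  rw [e3] at h3
  rw [e4]
  have hr1 : 0 < r⁻¹ := by positivity
  generalize (q - 2 / r) * (1.2 * Real.exp (-(0.41 * M))) = I3 at h3 ⊢
  generalize ∫ x in 2 / r..q, Real.exp (-(1.446 * (r * x - 2))) = I1 at h1 ⊢
  generalize ∫ x in 2 / r..q, Real.exp (-(0.213 * (r * x - 2))) = I2 at h2 ⊢
  clear hp0 hp e1 e2 e3 e4
  linarith

theorem continuous_outerBound (M r : ℝ) : Continuous fun x => outerBound M (r * x) := by
  unfold outerBound
  fun_prop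

theorem integral_integrand_pos {n m : ℕ} {t : ℝ} (ht0 : 0 ≤ t) (ht : t ≤ 0.0045)
    (hM : 45 ≤ mass n t) (hs : ∑ j ∈ Finset.range n, node j * tilt t j = m) :
    0 < ∫ φ in -(2 * Real.pi / 3)..Real.pi / 3, integrand n m t (phaseFactor m) φ := by
  obtain ⟨hζ1, hζ2, hζ3⟩ := phaseFactor_bounds m
  have hin := inner_integral_ge ht0 ht hM hs hζ1 hζ2 hζ3
  have hsm := sqrt_moment_two_mul_exp_le ht0 ht hM
  have hG : 0 < ‖circleValue n t 0‖ := by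
    rw [norm_pos_iff, circleValue_zero]
    refine mul_ne_zero ?_ (corrPart_zero_ne n t)
    rw [Complex.ofReal_ne_zero]
    exact (Finset.prod_pos fun j _ => by positivity).ne'
  have hr : 0 < √(moment 2 n t) := Real.sqrt_pos.2 (moment_two_pos hM)
  have hr2 : 34.85 * 45 ≤ √(moment 2 n t) := by
    refine Real.le_sqrt_of_sq_le ((moment_two_ge_of_mass hM).trans' ?_)
    rw [mul_pow]
    gcongr
  have hbound : ∀ φ, -(2 * Real.pi / 3) < φ → φ ≤ Real.pi / 3 → 2 ≤ √(moment 2 n t) * |φ| →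
      -(‖circleValue n t 0‖ * outerBound (mass n t) (√(moment 2 n t) * |φ|)) ≤
        integrand n m t (phaseFactor m) φ := fun φ h1 h2 h3 =>
    (abs_le.1 ((abs_integrand_le n m t φ hζ1).trans
      (norm_circleValue_le_outerBound ht0 ht hM h1 h2 h3))).1
  have hf := continuous_integrand n m t (phaseFactor m)
  set f := integrand n m t (phaseFactor m)
  set G := ‖circleValue n t 0‖
  set M := mass n t
  set r := √(moment 2 n t)
  have hp0 : 0 < 2 / r := by positivity
  have hpi := Real.pi_gt_d2
  have hp : 2 / r ≤ Real.pi / 3 := by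
    rw [div_le_iff₀ hr]
    nlinarith
  have hx : ∀ x, 2 / r < x → 2 ≤ r * |x| := by
    intro x hx
    rw [abs_of_pos (hp0.trans hx)]
    have := (div_lt_iff₀ hr).1 hx
    linarith
  have hcb : Continuous fun x => -(G * outerBound M (r * x)) :=
    ((continuous_outerBound M r).const_mul G).neg
  have hright : -(G * (0.1946 / r)) ≤ ∫ x in 2 / r..Real.pi / 3, f x := by
    have h := intervalIntegral.integral_mono_on_of_le_Ioo (μ := MeasureTheory.volume) hp (hcb.intervalIntegrable _ _)
      (hf.intervalIntegrable _ _) fun x hx' => by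
        have := hbound x (by linarith [hx'.1]) hx'.2.le (hx x hx'.1)
        rwa [abs_of_pos (hp0.trans hx'.1)] at this
    refine le_trans ?_ h
    rw [intervalIntegral.integral_neg, intervalIntegral.integral_const_mul]
    exact neg_le_neg (mul_le_mul_of_nonneg_left
      (integral_outerBound_le hr (by linarith) hsm) hG.le)
  have hleft : -(G * (0.1946 / r)) ≤ ∫ x in -(2 * Real.pi / 3)..-(2 / r), f x := by
    rw [← intervalIntegral.integral_comp_neg]
    have h := intervalIntegral.integral_mono_on_of_le_Ioo (μ := MeasureTheory.volume) (by linarith : 2 / r ≤ 2 * Real.pi / 3)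
      (hcb.intervalIntegrable _ _)
      ((hf.comp continuous_neg).intervalIntegrable _ _) fun x hx' => by
        have := hbound (-x) (by linarith [hx'.2]) (by linarith [hx'.1])
          (by rw [abs_neg]; exact hx x hx'.1)
        rwa [abs_neg, abs_of_pos (hp0.trans hx'.1)] at this
    refine le_trans ?_ h
    rw [intervalIntegral.integral_neg, intervalIntegral.integral_const_mul]
    exact neg_le_neg (mul_le_mul_of_nonneg_left
      (integral_outerBound_le hr le_rfl hsm) hG.le)
  rw [← intervalIntegral.integral_add_adjacent_intervals (b := 2 / r)
    (hf.intervalIntegrable _ _) (hf.intervalIntegrable _ _),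
    ← intervalIntegral.integral_add_adjacent_intervals (b := -(2 / r))
    (hf.intervalIntegrable _ _) (hf.intervalIntegrable _ _)]
  have hGr : 0 < G / r := by positivity
  have e : G * (0.1946 / r) = 0.1946 * (G / r) := by ring
  rw [e] at hleft hright
  linarith

theorem hasBorweinSign_of_ge {n m : ℕ} (hm : 36500 ≤ m) (hmn : 2 * m ≤ 3 * n ^ 2) :
    HasBorweinSign m ((borweinPoly n).coeff m) := by
  obtain ⟨t, ht0, ht, hs⟩ := exists_saddle hm hmn
  have h := integral_integrand_pos ht0 ht (mass_lower ht0 ht hm hs) hs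
  rw [integral_integrand] at h
  have h1 := pos_of_mul_pos_right h (by positivity)
  refine ⟨fun h0 => ?_, fun h0 => ?_⟩
  · rw [borweinSign, if_pos h0, one_mul] at h1
    exact_mod_cast h1.le
  · rw [borweinSign, if_neg h0] at h1
    have : ((borweinPoly n).coeff m : ℝ) < 0 := by linarith
    exact_mod_cast this.le

/-- **The First Borwein Conjecture** (proved by Chen Wang).
If `(q;q³)_n (q²;q³)_n = A(q³) - q·B(q³) - q²·C(q³)` is the 3-dissection of the
polynomial `(q;q³)_n (q²;q³)_n`, then `A`, `B`, `C` have nonnegative coefficients. -/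
theorem first_borwein_conjecture (n : ℕ) (A B C : Polynomial ℤ)
    (hdissect : borweinPoly n =
      A.comp (X ^ 3) - X * B.comp (X ^ 3) - X ^ 2 * C.comp (X ^ 3)) :
    (∀ k, 0 ≤ A.coeff k) ∧ (∀ k, 0 ≤ B.coeff k) ∧ (∀ k, 0 ≤ C.coeff k) := by
  exact dissection_nonneg _ A B C hdissect <| hasBorweinSign_of_le_half n fun m hm =>
    (lt_or_ge m 36501).elim (fun h => hasBorweinSign_of_lt n h)
      fun h => hasBorweinSign_of_ge (by omega) hm
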